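/- Let (R, m) be a Noetherian local ring possessing a canonical module ω_R of finite G-dimension. If Ext_R^i(ω_R, ω_R) = 0 for all 1 ≤ i ≤ depth_R(ω_R), then R is quasi-Gorenstein (ω_R ≅ R). -/

import Mathlib

open CategoryTheory IsLocalRing Pointwise

noncomputable section

/-- `E` is an injective hull of `S ⧸ J` over `S`. -/
def IsInjHull (S : Type) [CommRing S] (J : Ideal S) (E : Type) [AddCommGroup E]
    [Module S E] : Prop :=
  Module.Injective S E ∧
    ∃ f : (S ⧸ J) →ₗ[S] E, Function.Injective f ∧
      ∀ N : Submodule S E, N ≠ ⊥ → N ⊓ LinearMap.range f ≠ ⊥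

/-- Local cohomology `H^i_J(M)`. -/
abbrev LC (S : Type) [CommRing S] (J : Ideal S) (i : ℕ) (M : ModuleCat S) : ModuleCat S :=
  (localCohomology J i).obj M

/-- Krull dimension of a module (dimension of its support). -/
def mdim (S : Type) [CommRing S] (M : Type) [AddCommGroup M] [Module S M] : WithBot ℕ∞ :=
  Order.krullDim (Module.support S M)

/-- Depth/grade of an ideal `J` on `M`: supremum of lengths of `M`-regular sequences in `J`. -/
def gradeI (S : Type) [CommRing S] (J : Ideal S) (M : Type) [AddCommGroup M]
    [Module S M] : ℕ∞ :=
  sSup {n : ℕ∞ | ∃ rs : List S, (rs.length : ℕ∞) = n ∧ (∀ r ∈ rs, r ∈ J) ∧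
    RingTheory.Sequence.IsRegular M rs}

/-- The local "height" of `M` at a prime `p`, i.e. `dim_{S_p} M_p`. -/
def htM (S : Type) [CommRing S] (M : Type) [AddCommGroup M] [Module S M]
    (p : PrimeSpectrum S) : WithBot ℕ∞ :=
  mdim (Localization.AtPrime p.asIdeal) (LocalizedModule p.asIdeal.primeCompl M)

/-- `ht_M(a) = inf { dim_{S_p} M_p : p ⊇ a, p ∈ Supp M }`. -/
def htI (S : Type) [CommRing S] (M : Type) [AddCommGroup M] [Module S M]
    (a : Ideal S) : WithBot ℕ∞ :=
  sInf {d | ∃ p ∈ Module.support S M, a ≤ p.asIdeal ∧ d = htM S M p}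

/-- Serre's condition `S_n` for the module `M`. -/
def Serre (S : Type) [CommRing S] (n : ℕ) (M : Type) [AddCommGroup M] [Module S M] : Prop :=
  ∀ (p : Ideal S) [p.IsPrime],
    min (n : WithBot ℕ∞)
        (mdim (Localization.AtPrime p) (LocalizedModule p.primeCompl M)) ≤
      (gradeI (Localization.AtPrime p) (IsLocalRing.maximalIdeal (Localization.AtPrime p))
        (LocalizedModule p.primeCompl M) : ℕ∞)

/-- Attached primes of `M` (Macdonald): primes of the form `Ann(M ⧸ N)`. -/
def attachedPrimes (S : Type) [CommRing S] (M : Type) [AddCommGroup M] [Module S M] :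
    Set (Ideal S) :=
  {p | p.IsPrime ∧ ∃ N : Submodule S M, p = Module.annihilator S (M ⧸ N)}

/-- `ω` is a canonical module of the `d`-dimensional module `M` over `(S, J)`:
its "Matlis dual" `Hom_S(ω, E)` is isomorphic to `H^d_J(M)`. -/
def IsCanonicalModule (S : Type) [CommRing S] (J : Ideal S) (d : ℕ)
    (M ω : ModuleCat S) : Prop :=
  Module.Finite S ω ∧ ∃ E : ModuleCat S, IsInjHull S J ↥E ∧
    Nonempty ((↥ω →ₗ[S] ↥E) ≃ₗ[S] ↥(LC S J d M))

/-- `(S, J)` is quasi-Gorenstein: `H^d_J(S)` is an injective hull of `S ⧸ J`, `d = dim S`. -/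
def IsQuasiGorensteinAt (S : Type) [CommRing S] (J : Ideal S) : Prop :=
  ∃ d : ℕ, ringKrullDim S = (d : WithBot ℕ∞) ∧
    ∃ E : ModuleCat S, IsInjHull S J ↥E ∧
      Nonempty (↥(LC S J d (ModuleCat.of S S)) ≃ₗ[S] ↥E)

/-- Totally reflexive modules. -/
def TotallyReflexive (S : Type) [CommRing S] (M : ModuleCat S) : Prop :=
  Module.Finite S ↥M ∧ Module.IsReflexive S ↥M ∧
    ∀ i : ℕ, 0 < i →
      Subsingleton ↥(((Ext S (ModuleCat S) i).obj (Opposite.op M)).obj (ModuleCat.of S S)) ∧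
      Subsingleton ↥(((Ext S (ModuleCat S) i).obj
        (Opposite.op (ModuleCat.of S (Module.Dual S ↥M)))).obj (ModuleCat.of S S))

/-- `G`-dimension at most `n`. -/
def GdimLE (S : Type) [CommRing S] : ℕ → ModuleCat S → Prop
  | 0, M => TotallyReflexive S M
  | n + 1, M => ∃ (G : ModuleCat S) (f : ↥G →ₗ[S] ↥M), Function.Surjective f ∧
      TotallyReflexive S G ∧ GdimLE S n (ModuleCat.of S (LinearMap.ker f))

/-- Injective dimension at most `n`. -/
def InjDimLE (S : Type) [CommRing S] : ℕ → ModuleCat S → Prop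
  | 0, M => Module.Injective S ↥M
  | n + 1, M => ∃ (E : ModuleCat S) (f : ↥M →ₗ[S] ↥E), Function.Injective f ∧
      Module.Injective S ↥E ∧ InjDimLE S n (ModuleCat.of S (↥E ⧸ LinearMap.range f))

/-- Injective dimension, as an element of `ℕ∞`. -/
def injDim (S : Type) [CommRing S] (M : ModuleCat S) : ℕ∞ :=
  sInf {n : ℕ∞ | ∃ k : ℕ, (k : ℕ∞) = n ∧ InjDimLE S k M}

/-- Minimal number of generators. -/
def genNumber (S : Type) [CommRing S] (M : Type) [AddCommGroup M] [Module S M] : ℕ∞ :=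
  sInf {n : ℕ∞ | ∃ s : Finset M, (s.card : ℕ∞) = n ∧ Submodule.span S (↑s : Set M) = ⊤}

/-- The socle `0 :_M J`. -/
def socle (S : Type) [CommRing S] (J : Ideal S) (M : Type) [AddCommGroup M] [Module S M] :
    Submodule S M :=
  ⨅ r ∈ J, LinearMap.ker (LinearMap.lsmul S M r)

/-- Limit closure of the sequence `x` on `M`. -/
def limClo (S : Type) [CommRing S] {v : ℕ} (x : Fin v → S) (M : Type) [AddCommGroup M]
    [Module S M] : Submodule S M :=
  ⨆ t : ℕ, (Ideal.span (Set.range fun i => x i ^ (t + 1)) • (⊤ : Submodule S M)).comap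
      (LinearMap.lsmul S M ((∏ i, x i) ^ t))

end

/-- Krull dimension of a ring, valued in `WithBot ℕ∞`. -/
noncomputable def rdim (S : Type) [CommRing S] : WithBot ℕ∞ :=
  Order.krullDim (PrimeSpectrum S)

section EulerCharacteristic

open Function

variable {R : Type} [CommRing R]

/-- The iterated Euler characteristic of a module with respect to a sequence of ring elements: the
alternating sum of the lengths of its iterated cokernels and kernels of multiplication. -/
noncomputable def eulerChar (R : Type) [CommRing R] :
    List R → ∀ (X : Type) [AddCommGroup X] [Module R X], ℤ
  | [], X, _, _ => (Module.length R X).toNat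
  | x :: xs, X, _, _ =>
      eulerChar R xs (QuotSMulTop x X) - eulerChar R xs (Submodule.torsionBy R X x)

/-- Modules for which the iterated Euler characteristic is well behaved. -/
def EulerAdm (J : Ideal R) (xs : List R) (X : Type) [AddCommGroup X] [Module R X] : Prop :=
  (IsNoetherian R X ∨ IsArtinian R X) ∧ ∃ k, J ^ k ≤ Module.annihilator R X ⊔ Ideal.ofList xs

variable {J : Ideal R} {xs : List R} {x : R}
  {X : Type} [AddCommGroup X] [Module R X] {Y : Type} [AddCommGroup Y] [Module R Y]
  {Z : Type} [AddCommGroup Z] [Module R Z]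

lemma EulerAdm.of_injective (h : EulerAdm J xs Y) (f : X →ₗ[R] Y) (hf : Injective f) :
    EulerAdm J xs X := by
  obtain ⟨h1, k, hk⟩ := h
  refine ⟨?_, k, hk.trans (sup_le_sup_right (LinearMap.annihilator_le_of_injective f hf) _)⟩
  rcases h1 with h1 | h1
  · exact Or.inl (isNoetherian_of_injective f hf)
  · exact Or.inr (isArtinian_of_injective f hf)

lemma EulerAdm.of_surjective (h : EulerAdm J xs X) (f : X →ₗ[R] Y) (hf : Surjective f) :
    EulerAdm J xs Y := by
  obtain ⟨h1, k, hk⟩ := h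
  refine ⟨?_, k, hk.trans (sup_le_sup_right (LinearMap.annihilator_le_of_surjective f hf) _)⟩
  rcases h1 with h1 | h1
  · exact Or.inl (isNoetherian_of_surjective f (LinearMap.range_eq_top.2 hf))
  · exact Or.inr (isArtinian_of_surjective X f hf)

lemma EulerAdm.of_annihilator (h : EulerAdm J (x :: xs) X)
    (h2 : Module.annihilator R X ≤ Module.annihilator R Y) (h3 : x ∈ Module.annihilator R Y)
    (h4 : IsNoetherian R X → IsNoetherian R Y) (h5 : IsArtinian R X → IsArtinian R Y) :
    EulerAdm J xs Y := by
  obtain ⟨h1, k, hk⟩ := h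
  refine ⟨h1.imp h4 h5, k, hk.trans ?_⟩
  rw [Ideal.ofList_cons, ← sup_assoc]
  exact sup_le_sup_right (sup_le h2 (by simpa [Ideal.span_le] using h3)) _

lemma EulerAdm.quot (h : EulerAdm J (x :: xs) X) : EulerAdm J xs (QuotSMulTop x X) :=
  h.of_annihilator
    (LinearMap.annihilator_le_of_surjective (Submodule.mkQ _) (Submodule.mkQ_surjective _))
    (QuotSMulTop.mem_annihilator _ _) (fun _ => inferInstance) (fun _ => inferInstance)

lemma EulerAdm.tors (h : EulerAdm J (x :: xs) X) : EulerAdm J xs (Submodule.torsionBy R X x) :=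
  h.of_annihilator
    (LinearMap.annihilator_le_of_injective (Submodule.subtype _) (Submodule.subtype_injective _))
    (by rw [Module.mem_annihilator]; rintro ⟨m, hm⟩; ext; simpa using hm)
    (fun _ => inferInstance) (fun _ => inferInstance)

lemma isFiniteLength_of_pow_le_annihilator [IsNoetherianRing R] (hJ : J.IsMaximal) {k : ℕ}
    (hk : J ^ k ≤ Module.annihilator R X) (h : IsNoetherian R X ∨ IsArtinian R X) :
    IsNoetherian R X ∧ IsArtinian R X := by
  let A := R ⧸ J ^ k
  let : Module A X := Module.IsTorsionBySet.module (I := J ^ k)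
    (by intro m a; exact Module.mem_annihilator.1 (hk a.2) m)
  have : IsScalarTower R A X := Module.IsTorsionBySet.isScalarTower (S := R) _
  have hs : Surjective (algebraMap R A) := Ideal.Quotient.mk_surjective
  have : IsArtinianRing A := by
    rcases Nat.eq_zero_or_pos k with rfl | hk0
    · have : Subsingleton A := by
        simp only [A]; rw [Ideal.Quotient.subsingleton_iff]; simp
      infer_instance
    · have : Ring.KrullDimLE 0 A := by
        refine Ring.KrullDimLE.mk₀ fun p hp => ?_
        have h1 : J ≤ p.comap (algebraMap R A) := by
          have := Ideal.comap_isPrime (algebraMap R A) p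
          refine (Ideal.IsPrime.pow_le_iff (n := k) (by omega)).1 ?_
          intro a ha
          have : algebraMap R A a = 0 := Ideal.Quotient.eq_zero_iff_mem.2 ha
          simp [Ideal.mem_comap, this]
        have h2 : J = p.comap (algebraMap R A) :=
          hJ.eq_of_le (Ideal.comap_isPrime (algebraMap R A) p).ne_top h1
        have : (p.comap (algebraMap R A)).IsMaximal := h2 ▸ hJ
        rw [← Ideal.map_comap_of_surjective _ hs p]
        refine (Ideal.map_eq_top_or_isMaximal_of_surjective _ hs this).resolve_left ?_
        rw [Ideal.map_comap_of_surjective _ hs p]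
        exact hp.ne_top
      exact IsNoetherianRing.isArtinianRing_of_krullDimLE_zero
  have e := IsSemiprimaryRing.isNoetherian_iff_isArtinian (R := A) (M := X)
  rcases h with h | h
  · have := isNoetherian_of_tower R (S := A) (M := X) h
    have := e.1 this
    exact ⟨h, isArtinian_of_surjective_algebraMap hs⟩
  · have := isArtinian_of_tower R (S := A) (M := X) h
    have := e.2 this
    have : Module.Finite R A := inferInstance
    have : Module.Finite R X := Module.Finite.trans A X
    exact ⟨inferInstance, h⟩

lemma EulerAdm.finiteLength [IsNoetherianRing R] (hJ : J.IsMaximal) (h : EulerAdm J [] X) :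
    IsNoetherian R X ∧ IsArtinian R X := by
  obtain ⟨h1, k, hk⟩ := h
  exact isFiniteLength_of_pow_le_annihilator hJ (by simpa using hk) h1

lemma eulerChar_congr (xs : List R) : ∀ {X : Type} [AddCommGroup X] [Module R X] {Y : Type}
    [AddCommGroup Y] [Module R Y], (X ≃ₗ[R] Y) → eulerChar R xs X = eulerChar R xs Y := by
  induction xs with
  | nil => intro X _ _ Y _ _ e; simp only [eulerChar, e.length_eq]
  | cons x xs ih =>
    intro X _ _ Y _ _ e
    simp only [eulerChar]
    rw [ih (QuotSMulTop.congr x e)]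
    refine congrArg _ (ih (e.ofSubmodules _ _ ?_))
    ext y
    simp only [Submodule.mem_map, Submodule.mem_torsionBy_iff]
    constructor
    · rintro ⟨z, hz, rfl⟩
      simpa using congrArg e hz
    · intro hy
      exact ⟨e.symm y, by rw [← map_smul, hy, map_zero], by simp⟩

/-- Additivity of the Euler characteristic along short exact sequences, as a property. -/
def EulerAdditive (J : Ideal R) (xs : List R) : Prop :=
  ∀ {X : Type} [AddCommGroup X] [Module R X] {Y : Type} [AddCommGroup Y] [Module R Y]
  {Z : Type} [AddCommGroup Z] [Module R Z] (f : X →ₗ[R] Y) (g : Y →ₗ[R] Z),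
    Injective f → Exact f g → Surjective g → EulerAdm J xs Y →
    eulerChar R xs Y = eulerChar R xs X + eulerChar R xs Z

lemma EulerAdditive.eq_ker_add_range (hadd : EulerAdditive J xs)
    (f : X →ₗ[R] Y) (hX : EulerAdm J xs X) :
    eulerChar R xs X =
      eulerChar R xs (LinearMap.ker f) + eulerChar R xs (LinearMap.range f) :=
  hadd (LinearMap.ker f).subtype f.rangeRestrict (Submodule.subtype_injective _)
    (by rw [LinearMap.exact_iff]; simp) f.surjective_rangeRestrict hX

lemma eulerChar_range_eq_ker {f : X →ₗ[R] Y} {g : Y →ₗ[R] Z} (h : Exact f g) :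
    eulerChar R xs (LinearMap.range f) = eulerChar R xs (LinearMap.ker g) := by
  rw [← h.linearMap_ker_eq]

lemma EulerAdditive.sixTerm (hadd : EulerAdditive J xs)
    {A : Type} [AddCommGroup A] [Module R A] {B : Type} [AddCommGroup B] [Module R B]
    {C : Type} [AddCommGroup C] [Module R C] {D : Type} [AddCommGroup D] [Module R D]
    {E : Type} [AddCommGroup E] [Module R E] {F : Type} [AddCommGroup F] [Module R F]
    (f₁ : A →ₗ[R] B) (f₂ : B →ₗ[R] C) (f₃ : C →ₗ[R] D) (f₄ : D →ₗ[R] E) (f₅ : E →ₗ[R] F)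
    (h₁ : Injective f₁) (h₁₂ : Exact f₁ f₂) (h₂₃ : Exact f₂ f₃) (h₃₄ : Exact f₃ f₄)
    (h₄₅ : Exact f₄ f₅) (h₅ : Surjective f₅)
    (hB : EulerAdm J xs B) (hC : EulerAdm J xs C) (hD : EulerAdm J xs D) (hE : EulerAdm J xs E) :
    eulerChar R xs B + eulerChar R xs D + eulerChar R xs F =
      eulerChar R xs A + eulerChar R xs C + eulerChar R xs E := by
  have e1 := hadd.eq_ker_add_range f₂ hB
  have e2 := hadd.eq_ker_add_range f₃ hC
  have e3 := hadd.eq_ker_add_range f₄ hD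
  have e4 := hadd.eq_ker_add_range f₅ hE
  rw [← eulerChar_range_eq_ker h₁₂,
    ← eulerChar_congr xs (LinearEquiv.ofInjective f₁ h₁)] at e1
  rw [← eulerChar_range_eq_ker h₂₃] at e2
  rw [← eulerChar_range_eq_ker h₃₄] at e3
  rw [← eulerChar_range_eq_ker h₄₅, LinearMap.range_eq_top.2 h₅,
    eulerChar_congr xs (Submodule.topEquiv (R := R) (M := F))] at e4
  omega

theorem eulerAdditive [IsNoetherianRing R] (hJ : J.IsMaximal) (xs : List R) :
    EulerAdditive J xs := by
  induction xs with
  | nil =>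
    intro X _ _ Y _ _ Z _ _ f g hf hfg hg hY
    obtain ⟨_, _⟩ := hY.finiteLength hJ
    have h := Module.length_eq_add_of_exact f g hf hg hfg
    have hX : Module.length R X ≠ ⊤ := by
      have := isNoetherian_of_injective f hf
      have := isArtinian_of_injective f hf
      exact Module.length_ne_top
    have hZ : Module.length R Z ≠ ⊤ := by
      have := isNoetherian_of_surjective g (LinearMap.range_eq_top.2 hg)
      have := isArtinian_of_surjective Y g hg
      exact Module.length_ne_top
    simp only [eulerChar]
    rw [h, ENat.toNat_add hX hZ]
    push_cast
    rfl
  | cons x xs ih =>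
    intro X _ _ Y _ _ Z _ _ f g hf hfg hg hY
    have hX := hY.of_injective f hf
    have hZ := hY.of_surjective g hg
    let F : Submodule.torsionBy R X x →ₗ[R] Submodule.torsionBy R Y x :=
      f.restrict (fun m hm => by
        rw [Submodule.mem_torsionBy_iff] at *; rw [← map_smul, hm, map_zero])
    let G : Submodule.torsionBy R Y x →ₗ[R] Submodule.torsionBy R Z x :=
      g.restrict (fun m hm => by
        rw [Submodule.mem_torsionBy_iff] at *; rw [← map_smul, hm, map_zero])
    have hι : ∀ (W : Type) [AddCommGroup W] [Module R W],
        Exact (Submodule.torsionBy R W x).subtype (LinearMap.lsmul R W x) := by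
      intro W _ _ w
      simp
    have hπ : ∀ (W : Type) [AddCommGroup W] [Module R W],
        Exact (LinearMap.lsmul R W x) (Submodule.mkQ (x • (⊤ : Submodule R W))) := by
      intro W _ _ w
      simp [Submodule.mem_smul_pointwise_iff_exists]
    have h1 : f.comp (LinearMap.lsmul R X x) = (LinearMap.lsmul R Y x).comp f := by ext; simp
    have h2 : g.comp (LinearMap.lsmul R Y x) = (LinearMap.lsmul R Z x).comp g := by ext; simp
    let δ := SnakeLemma.δ' (LinearMap.lsmul R X x) (LinearMap.lsmul R Y x) (LinearMap.lsmul R Z x)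
      f g hfg f g hfg h1 h2 (Submodule.torsionBy R Z x).subtype (hι Z)
      (Submodule.mkQ (x • (⊤ : Submodule R X))) (hπ X) hg hf
    have hr := SnakeLemma.exact_δ'_right (LinearMap.lsmul R X x) (LinearMap.lsmul R Y x)
      (LinearMap.lsmul R Z x)
      f g hfg f g hfg h1 h2 (Submodule.torsionBy R Y x).subtype (hι Y)
      (Submodule.torsionBy R Z x).subtype (hι Z)
      (Submodule.mkQ (x • (⊤ : Submodule R X))) (hπ X) hg hf G (by ext; rfl)
      (Submodule.subtype_injective _)
    have hl := SnakeLemma.exact_δ'_left (LinearMap.lsmul R X x) (LinearMap.lsmul R Y x)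
      (LinearMap.lsmul R Z x)
      f g hfg f g hfg h1 h2
      (Submodule.torsionBy R Z x).subtype (hι Z)
      (Submodule.mkQ (x • (⊤ : Submodule R X))) (hπ X)
      (Submodule.mkQ (x • (⊤ : Submodule R Y))) (hπ Y) hg hf
      (QuotSMulTop.map x f) (by ext; rfl) (Submodule.mkQ_surjective _)
    have := ih.sixTerm F G δ (QuotSMulTop.map x f) (QuotSMulTop.map x g) ?_ ?_ hr hl
      (QuotSMulTop.map_exact x hfg hg) (QuotSMulTop.map_surjective x hg)
      hY.tors hZ.tors hX.quot hY.quot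
    · simp only [eulerChar]
      linarith
    · intro a b hab
      exact Subtype.ext (hf (congrArg Subtype.val hab))
    · rintro ⟨y, hy⟩
      constructor
      · intro h
        obtain ⟨a, rfl⟩ := (hfg y).1 (congrArg Subtype.val h)
        refine ⟨⟨a, hf ?_⟩, rfl⟩
        simpa using hy
      · rintro ⟨a, ha⟩
        rw [← ha]
        exact Subtype.ext ((hfg _).2 ⟨a.1, rfl⟩)

end EulerCharacteristic

section Dimension

open Function

lemma WithBot.natCast_add_one_le_of_lt {a : WithBot ℕ∞} {n : ℕ} (h : (n : WithBot ℕ∞) < a) :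
    ((n + 1 : ℕ) : WithBot ℕ∞) ≤ a := by
  induction a with
  | bot => simp at h
  | coe a =>
    have h' : (n : ℕ∞) < a := by exact_mod_cast h
    have := Order.add_one_le_of_lt h'
    exact_mod_cast this

variable {R : Type} [CommRing R]

lemma Ideal.exists_mem_forall_notMem {I : Ideal R} {s : Set (Ideal R)} (hs : s.Finite)
    (hp : ∀ p ∈ s, p.IsPrime) (hI : ∀ p ∈ s, ¬ I ≤ p) : ∃ x ∈ I, ∀ p ∈ s, x ∉ p := by
  by_contra! h
  obtain ⟨p, hps, hIp⟩ := (Ideal.subset_union_prime_finite hs (f := id) ⊤ ⊤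
    (fun p hps _ _ => hp p hps) (I := I)).1 (fun x hx => by
      obtain ⟨p, hps, hxp⟩ := h x hx
      exact Set.mem_biUnion hps hxp)
  exact hI p hps hIp

lemma ringKrullDim_quotient_add_one_le_of_lt {p q : Ideal R} [p.IsPrime] (h : p < q) :
    ringKrullDim (R ⧸ q) + 1 ≤ ringKrullDim (R ⧸ p) := by
  obtain ⟨x, hxq, hxp⟩ := Set.exists_of_ssubset h
  refine ringKrullDim_succ_le_of_surjective (Ideal.Quotient.factor h.le)
    (Ideal.Quotient.factor_surjective h.le) (r := Ideal.Quotient.mk p x) ?_ ?_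
  · rw [mem_nonZeroDivisors_iff_ne_zero]
    rwa [Ne, Ideal.Quotient.eq_zero_iff_mem]
  · simpa [Ideal.Quotient.eq_zero_iff_mem] using hxq

lemma ringKrullDim_quotient_mono {I J : Ideal R} (h : I ≤ J) :
    ringKrullDim (R ⧸ J) ≤ ringKrullDim (R ⧸ I) :=
  ringKrullDim_le_of_surjective (Ideal.Quotient.factor h) (Ideal.Quotient.factor_surjective h)

lemma exists_prime_le_ringKrullDim_quotient {I : Ideal R} {n : ℕ}
    (h : (n : WithBot ℕ∞) ≤ ringKrullDim (R ⧸ I)) :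
    ∃ q : Ideal R, q.IsPrime ∧ I ≤ q ∧ (n : WithBot ℕ∞) ≤ ringKrullDim (R ⧸ q) := by
  rw [ringKrullDim_quotient, Order.le_krullDim_iff] at h
  obtain ⟨l, hl⟩ := h
  refine ⟨l.head.1.asIdeal, l.head.1.2, l.head.2, ?_⟩
  rw [ringKrullDim_quotient, Order.le_krullDim_iff]
  refine ⟨⟨l.length, fun i => ⟨(l i).1, LTSeries.head_le l i⟩, l.step⟩, hl⟩

lemma eq_maximalIdeal_of_ringKrullDim_quotient_le_zero [IsLocalRing R] {p : Ideal R} [p.IsPrime]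
    (h : ringKrullDim (R ⧸ p) ≤ 0) : p = maximalIdeal R := by
  by_contra hne
  have hlt : p < maximalIdeal R :=
    lt_of_le_of_ne (IsLocalRing.le_maximalIdeal (Ideal.IsPrime.ne_top inferInstance)) hne
  have h1 := (ringKrullDim_quotient_add_one_le_of_lt hlt).trans h
  have h2 : ringKrullDim (R ⧸ maximalIdeal R) = 0 :=
    ringKrullDim_eq_zero_of_field (ResidueField R)
  rw [h2] at h1
  exact absurd h1 (by decide)

lemma ringKrullDim_quotient_sup_span_le {I : Ideal R} {x : R} {n : ℕ}
    (hI : ringKrullDim (R ⧸ I) ≤ (n + 1 : ℕ))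
    (hx : ∀ p : Ideal R, p.IsPrime → I ≤ p → ringKrullDim (R ⧸ p) = (n + 1 : ℕ) → x ∉ p) :
    ringKrullDim (R ⧸ (I ⊔ Ideal.span {x})) ≤ n := by
  by_contra! h
  have h' : ((n + 1 : ℕ) : WithBot ℕ∞) ≤ ringKrullDim (R ⧸ (I ⊔ Ideal.span {x})) :=
    WithBot.natCast_add_one_le_of_lt h
  obtain ⟨q, hq, hIq, hnq⟩ := exists_prime_le_ringKrullDim_quotient h'
  refine hx q hq (le_sup_left.trans hIq)
    (le_antisymm ((ringKrullDim_quotient_mono (le_sup_left.trans hIq)).trans hI) hnq) ?_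
  exact hIq (Ideal.mem_sup_right (Ideal.mem_span_singleton_self x))

lemma finite_setOf_prime_ringKrullDim_quotient_eq [IsNoetherianRing R] {I : Ideal R} {n : ℕ}
    (hI : ringKrullDim (R ⧸ I) ≤ n) :
    {p : Ideal R | p.IsPrime ∧ I ≤ p ∧ ringKrullDim (R ⧸ p) = n}.Finite := by
  refine (Ideal.finite_minimalPrimes_of_isNoetherianRing R I).subset ?_
  rintro p ⟨hp, hIp, hpn⟩
  refine ⟨⟨hp, hIp⟩, ?_⟩
  rintro q ⟨hq, hIq⟩ hqp
  by_contra hne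
  have h1 := (ringKrullDim_quotient_add_one_le_of_lt (lt_of_le_not_ge hqp hne)).trans
    ((ringKrullDim_quotient_mono hIq).trans hI)
  rw [hpn] at h1
  have h2 : ((n + 1 : ℕ) : WithBot ℕ∞) ≤ (n : ℕ) := by exact_mod_cast h1
  have h3 : n + 1 ≤ n := by exact_mod_cast h2
  omega

lemma exists_maximalIdeal_pow_le_of_ringKrullDim_quotient_le_zero [IsNoetherianRing R]
    [IsLocalRing R] {I : Ideal R} (hI : ringKrullDim (R ⧸ I) ≤ 0) :
    ∃ k, maximalIdeal R ^ k ≤ I := by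
  refine Ideal.exists_pow_le_of_le_radical_of_fg ?_ (IsNoetherian.noetherian _)
  rw [Ideal.radical_eq_sInf]
  refine le_sInf ?_
  rintro p ⟨hIp, hp⟩
  exact (eq_maximalIdeal_of_ringKrullDim_quotient_le_zero
    ((ringKrullDim_quotient_mono hIp).trans hI)).ge

lemma exists_prime_ringKrullDim_quotient_eq_of_sup_span [IsNoetherianRing R] [IsLocalRing R]
    {p : Ideal R} [p.IsPrime] {x : R} (hx : x ∈ maximalIdeal R) (hxp : x ∉ p) {n : ℕ}
    (hp : ringKrullDim (R ⧸ p) = (n + 1 : ℕ)) :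
    ∃ q : Ideal R, q.IsPrime ∧ p ≤ q ∧ x ∈ q ∧ ringKrullDim (R ⧸ q) = n := by
  have h1 : ringKrullDim (R ⧸ p) ≤ ringKrullDim (R ⧸ (p ⊔ Ideal.span {x})) + 1 := by
    have : IsLocalRing (R ⧸ p) := .of_surjective' _ Ideal.Quotient.mk_surjective
    have h := ringKrullDim_quotient_span_singleton_succ_eq_ringKrullDim (R := R ⧸ p)
      (x := Ideal.Quotient.mk p x) ?_ ?_
    · rw [← h]
      gcongr
      have : Ideal.span {Ideal.Quotient.mk p x} = (Ideal.span {x}).map (Ideal.Quotient.mk p) := by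
        rw [Ideal.map_span, Set.image_singleton]
      rw [this]
      exact (ringKrullDim_eq_of_ringEquiv (DoubleQuot.quotQuotEquivQuotSup p _)).le
    · refine IsSMulRegular.of_ne_zero ?_
      rwa [Ne, Ideal.Quotient.eq_zero_iff_mem]
    · rw [mem_maximalIdeal, mem_nonunits_iff] at *
      have := IsLocalHom.of_surjective (Ideal.Quotient.mk p) Ideal.Quotient.mk_surjective
      exact fun h => hx ((isUnit_map_iff (Ideal.Quotient.mk p) x).1 h)
  rw [hp] at h1
  have h2 : (n : WithBot ℕ∞) ≤ ringKrullDim (R ⧸ (p ⊔ Ideal.span {x})) := by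
    by_contra! hc
    have := ENat.WithBot.add_one_le_natCast_iff.2 hc
    have h3 : ((n + 1 : ℕ) : WithBot ℕ∞) ≤ (n : ℕ) := h1.trans this
    have h3 : n + 1 ≤ n := by exact_mod_cast h3
    omega
  obtain ⟨q, hq, hIq, hnq⟩ := exists_prime_le_ringKrullDim_quotient h2
  have hxq : x ∈ q := hIq (Ideal.mem_sup_right (Ideal.mem_span_singleton_self x))
  have hpq : p ≤ q := le_sup_left.trans hIq
  refine ⟨q, hq, hpq, hxq, le_antisymm ?_ hnq⟩
  by_contra! hc
  have h4 := ringKrullDim_quotient_add_one_le_of_lt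
    (lt_of_le_of_ne hpq (by rintro rfl; exact hxp hxq))
  rw [hp] at h4
  have h5 : ((n + 1 : ℕ) : WithBot ℕ∞) ≤ ringKrullDim (R ⧸ q) := WithBot.natCast_add_one_le_of_lt hc
  have h6 : ((n + 1 + 1 : ℕ) : WithBot ℕ∞) ≤ (n + 1 : ℕ) := by
    refine le_trans ?_ h4
    push_cast at h5 ⊢
    gcongr
  have h3 : n + 1 + 1 ≤ n + 1 := by exact_mod_cast h6
  omega

lemma ringKrullDim_quotient_prime_le_length [IsNoetherianRing R] [IsLocalRing R] (ys : List R) :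
    (∀ y ∈ ys, y ∈ maximalIdeal R) → ∀ q : Ideal R, q.IsPrime →
    ∀ k, maximalIdeal R ^ k ≤ q ⊔ Ideal.ofList ys → ringKrullDim (R ⧸ q) ≤ ys.length := by
  induction ys with
  | nil =>
    intro _ q hq k hk
    have : maximalIdeal R = q := (maximalIdeal.isMaximal R).eq_of_le hq.ne_top
      (hq.le_of_pow_le (n := k) (by simpa using hk))
    rw [← this]
    exact (ringKrullDim_eq_zero_of_field (ResidueField R)).le
  | cons y ys ih' =>
    intro hys q hq k hk
    by_contra! hlt
    have h5 : ((ys.length + 1 + 1 : ℕ) : WithBot ℕ∞) ≤ ringKrullDim (R ⧸ q) :=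
      WithBot.natCast_add_one_le_of_lt hlt
    by_cases hy : y ∈ q
    · have := ih' (fun z hz => hys z (by simp [hz])) q hq k (by
        rw [Ideal.ofList_cons, ← sup_assoc] at hk
        rwa [(sup_eq_left.2 (by simpa [Ideal.span_le] using hy) :
          q ⊔ Ideal.span {y} = q)] at hk)
      have := h5.trans this
      have : ys.length + 1 + 1 ≤ ys.length := by exact_mod_cast this
      omega
    · obtain ⟨m, hm⟩ : ∃ m : ℕ, ringKrullDim (R ⧸ q) = (m + 1 : ℕ) := by
        have h6 : ringKrullDim (R ⧸ q) < ⊤ :=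
          (ringKrullDim_quotient_le q).trans_lt ringKrullDim_lt_top
        generalize ringKrullDim (R ⧸ q) = D at *
        induction D with
        | bot => simp at h5
        | coe D =>
          induction D with
          | top => simp at h6
          | coe D =>
            have : ys.length + 1 + 1 ≤ D := by exact_mod_cast h5
            exact ⟨D - 1, by rw [Nat.sub_add_cancel (by omega)]; rfl⟩
      obtain ⟨q', hq', hle, hyq', hd'⟩ := exists_prime_ringKrullDim_quotient_eq_of_sup_span
        (hys y (by simp)) hy hm
      have := ih' (fun z hz => hys z (by simp [hz])) q' hq' k (hk.trans (by
        rw [Ideal.ofList_cons, ← sup_assoc]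
        exact sup_le_sup_right (sup_le hle (by simpa [Ideal.span_le] using hyq')) _))
      rw [hd'] at this
      rw [hm] at h5
      have h7 : m ≤ ys.length := by exact_mod_cast this
      have h8 : ys.length + 1 + 1 ≤ m + 1 := by exact_mod_cast h5
      omega

end Dimension

section EulerCharacteristicPositivity

open Function

variable {R : Type} [CommRing R] {J : Ideal R} {xs : List R} {x : R}
  {X : Type} [AddCommGroup X] [Module R X] {Y : Type} [AddCommGroup Y] [Module R Y]

lemma eulerChar_eq_zero_of_subsingleton (xs : List R) : ∀ (X : Type) [AddCommGroup X] [Module R X]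
    [Subsingleton X], eulerChar R xs X = 0 := by
  induction xs with
  | nil => intro X _ _ _; simp [eulerChar, Module.length_eq_zero]
  | cons x xs ih =>
    intro X _ _ _
    have : Subsingleton (QuotSMulTop x X) := (Submodule.mkQ_surjective _).subsingleton
    simp [eulerChar, ih]

lemma eulerChar_cons_eq_zero_of_mem_annihilator (h : x ∈ Module.annihilator R X) :
    eulerChar R (x :: xs) X = 0 := by
  have h1 : x • (⊤ : Submodule R X) = ⊥ := by
    rw [eq_bot_iff]
    rintro _ ⟨m, -, rfl⟩
    simpa using Module.mem_annihilator.1 h m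
  have h2 : Submodule.torsionBy R X x = ⊤ := by
    rw [eq_top_iff]
    rintro m -
    simpa using Module.mem_annihilator.1 h m
  rw [eulerChar, eulerChar_congr xs (Submodule.quotEquivOfEqBot _ h1),
    eulerChar_congr xs (LinearEquiv.ofTop _ h2), sub_self]

lemma eulerChar_cons_eq_zero_of_pow_mem_annihilator (hadd : EulerAdditive J (x :: xs)) (k : ℕ) :
    ∀ {X : Type} [AddCommGroup X] [Module R X], EulerAdm J (x :: xs) X →
    x ^ k ∈ Module.annihilator R X → eulerChar R (x :: xs) X = 0 := by
  induction k with
  | zero =>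
    intro X _ _ _ h
    have : Subsingleton X := ⟨fun a b => by
      rw [Module.mem_annihilator] at h
      rw [← one_smul R a, ← one_smul R b, ← pow_zero x, h, h]⟩
    exact eulerChar_eq_zero_of_subsingleton _ X
  | succ k ih =>
    intro X _ _ hX h
    rw [hadd.eq_ker_add_range (LinearMap.lsmul R X x) hX,
      eulerChar_cons_eq_zero_of_mem_annihilator, ih, add_zero]
    · exact hX.of_injective (Submodule.subtype _) (Submodule.subtype_injective _)
    · rw [Module.mem_annihilator] at h ⊢
      rintro ⟨_, m, rfl⟩
      ext
      simpa [smul_smul, ← pow_succ] using h m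
    · rw [Module.mem_annihilator]
      rintro ⟨m, hm⟩
      ext
      simpa using hm

lemma eulerChar_eq_zero_of_pow_le_annihilator (hadd : EulerAdditive J xs) (hxs : xs ≠ [])
    (hJ : ∀ x ∈ xs, x ∈ J) {k : ℕ} (hX : EulerAdm J xs X)
    (h : J ^ k ≤ Module.annihilator R X) : eulerChar R xs X = 0 := by
  obtain _ | ⟨x, xs⟩ := xs
  · exact absurd rfl hxs
  · exact eulerChar_cons_eq_zero_of_pow_mem_annihilator hadd k hX
      (h (Ideal.pow_mem_pow (hJ x (by simp)) k))

/-- Multiplication by `x` on the domain `R ⧸ p` with `x ∉ p` computes the Euler characteristic. -/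
lemma eulerChar_cons_quotient_prime {p : Ideal R} [p.IsPrime] (hx : x ∉ p) :
    eulerChar R (x :: xs) (R ⧸ p) = eulerChar R xs (QuotSMulTop x (R ⧸ p)) := by
  have : Subsingleton (Submodule.torsionBy R (R ⧸ p) x) := by
    rw [Submodule.subsingleton_iff_eq_bot, eq_bot_iff]
    intro m hm
    obtain ⟨r, rfl⟩ := Ideal.Quotient.mk_surjective m
    rw [Submodule.mem_torsionBy_iff] at hm
    have hm' : Ideal.Quotient.mk p (x * r) = 0 := hm
    rw [Ideal.Quotient.eq_zero_iff_mem] at hm'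
    rw [Submodule.mem_bot, Ideal.Quotient.eq_zero_iff_mem]
    exact (Ideal.IsPrime.mem_or_mem inferInstance hm').resolve_left hx
  rw [eulerChar, eulerChar_eq_zero_of_subsingleton xs (Submodule.torsionBy R (R ⧸ p) x), sub_zero]

theorem eulerChar_nonneg [IsNoetherianRing R] (hJ : J.IsMaximal) (xs : List R) :
    ∀ {X : Type} [AddCommGroup X] [Module R X] [Module.Finite R X], EulerAdm J xs X →
    0 ≤ eulerChar R xs X := by
  induction xs with
  | nil => intro X _ _ _ _; simp [eulerChar]
  | cons x xs ih =>
    intro X _ _ hfin hX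
    refine IsNoetherianRing.induction_on_isQuotientEquivQuotientPrime R hfin
      (motive := fun N _ _ _ => EulerAdm J (x :: xs) N → 0 ≤ eulerChar R (x :: xs) N)
      ?_ ?_ ?_ hX
    · intro N _ _ _ _ _
      rw [eulerChar_eq_zero_of_subsingleton]
    · intro N _ _ _ p e hN
      have hp := p.2
      by_cases hx : x ∈ p.1
      · rw [eulerChar_cons_eq_zero_of_mem_annihilator]
        rw [e.annihilator_eq, Ideal.annihilator_quotient]
        exact hx
      · have hN' := hN.of_surjective e.toLinearMap e.surjective
        rw [eulerChar_congr _ e, eulerChar_cons_quotient_prime hx]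
        exact ih hN'.quot
    · intro N₁ _ _ _ N₂ _ _ _ N₃ _ _ _ f g hf hg hfg h1 h3 h2
      rw [eulerAdditive hJ _ f g hf hfg hg h2]
      exact add_nonneg (h1 (h2.of_injective f hf)) (h3 (h2.of_surjective g hg))

lemma eulerChar_le_of_injective [IsNoetherianRing R] (hJ : J.IsMaximal) [Module.Finite R Y]
    (hY : EulerAdm J xs Y) (f : X →ₗ[R] Y) (hf : Injective f) :
    eulerChar R xs X ≤ eulerChar R xs Y := by
  have hs := (LinearMap.range f).mkQ_surjective
  rw [eulerAdditive hJ xs f (LinearMap.range f).mkQ hf (LinearMap.exact_map_mkQ_range f) hs hY]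
  have := eulerChar_nonneg hJ xs (hY.of_surjective _ hs)
  omega

lemma eulerChar_le_of_surjective [IsNoetherianRing R] (hJ : J.IsMaximal) [Module.Finite R X]
    (hX : EulerAdm J xs X) (f : X →ₗ[R] Y) (hf : Surjective f) :
    eulerChar R xs Y ≤ eulerChar R xs X := by
  have hi := (LinearMap.ker f).subtype_injective
  rw [eulerAdditive hJ xs (LinearMap.ker f).subtype f hi (LinearMap.exact_subtype_ker_map f) hf hX]
  have := eulerChar_nonneg hJ xs (hX.of_injective _ hi)
  omega

theorem eulerChar_quotient_prime_pos [IsNoetherianRing R] [IsLocalRing R] (xs : List R)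
    (hxs : ∀ x ∈ xs, x ∈ maximalIdeal R) : ∀ (p : Ideal R) [p.IsPrime],
    ringKrullDim (R ⧸ p) = xs.length → EulerAdm (maximalIdeal R) xs (R ⧸ p) →
    0 < eulerChar R xs (R ⧸ p) := by
  have hJ := maximalIdeal.isMaximal R
  induction xs with
  | nil =>
    intro p _ hp h
    obtain ⟨_, _⟩ := h.finiteLength hJ
    have h1 : 0 < Module.length R (R ⧸ p) := Module.length_pos
    have h2 : Module.length R (R ⧸ p) ≠ ⊤ := Module.length_ne_top
    simp only [eulerChar]
    have : Module.length R (R ⧸ p) ≠ 0 := h1.ne'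
    have := (ENat.toNat_eq_zero (n := Module.length R (R ⧸ p))).not.2 (by tauto)
    omega
  | cons x xs ih =>
    intro p hp hdim h
    have hxm := hxs x (by simp)
    by_cases hx : x ∈ p
    · exfalso
      have hadm : EulerAdm (maximalIdeal R) xs (R ⧸ p) :=
        h.of_annihilator le_rfl (by rw [Ideal.annihilator_quotient]; exact hx)
          (fun h => h) (fun h => h)
      obtain ⟨-, k, hk⟩ := hadm
      rw [Ideal.annihilator_quotient] at hk
      have := ringKrullDim_quotient_prime_le_length xs (fun z hz => hxs z (by simp [hz])) p hp k hk
      rw [hdim] at this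
      have h7 : (x :: xs).length ≤ xs.length := by exact_mod_cast this
      simp at h7
    · obtain ⟨q, hq, hpq, hxq, hqdim⟩ := exists_prime_ringKrullDim_quotient_eq_of_sup_span hxm hx
        (n := xs.length) (by simpa using hdim)
      rw [eulerChar_cons_quotient_prime hx]
      let f : QuotSMulTop x (R ⧸ p) →ₗ[R] R ⧸ q :=
        Submodule.liftQ _ (Submodule.factor hpq) (by
          rintro _ ⟨m, -, rfl⟩
          obtain ⟨r, rfl⟩ := Ideal.Quotient.mk_surjective m
          change Ideal.Quotient.mk q (x * r) = 0
          exact Ideal.Quotient.eq_zero_iff_mem.2 (Ideal.mul_mem_right _ _ hxq))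
      have hf : Surjective f := by
        intro m
        obtain ⟨r, rfl⟩ := Ideal.Quotient.mk_surjective m
        exact ⟨Submodule.Quotient.mk (Ideal.Quotient.mk p r), rfl⟩
      exact (ih (fun z hz => hxs z (by simp [hz])) q hqdim (h.quot.of_surjective f hf)).trans_le
        (eulerChar_le_of_surjective hJ h.quot f hf)

end EulerCharacteristicPositivity

section LocalCohomology

open Function Abelian

variable {R : Type} [CommRing R] (J : Ideal R) (i : ℕ)
  {X : Type} [AddCommGroup X] [Module R X] {Y : Type} [AddCommGroup Y] [Module R Y]
  {Z : Type} [AddCommGroup Z] [Module R Z]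

/-- The projection `R ⧸ J ^ n ⟶ R ⧸ J ^ m` for `m ≤ n`. -/
noncomputable def quotPowMap (m n : ℕ) (h : m ≤ n) :
    ModuleCat.of R (R ⧸ J ^ n) ⟶ ModuleCat.of R (R ⧸ J ^ m) :=
  ModuleCat.ofHom (Submodule.mapQ (J ^ n) (J ^ m) LinearMap.id (Ideal.pow_le_pow_right h))

/-- The transition maps of the direct system computing local cohomology. -/
noncomputable def locCohTrans (X : Type) [AddCommGroup X] [Module R X] (m n : ℕ) (h : m ≤ n) :
    Ext (ModuleCat.of R (R ⧸ J ^ m)) (ModuleCat.of R X) i →ₗ[R]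
      Ext (ModuleCat.of R (R ⧸ J ^ n)) (ModuleCat.of R X) i where
  toFun e := (Ext.mk₀ (quotPowMap J m n h)).comp e (zero_add i)
  map_add' _ _ := Ext.comp_add _ _ _ _
  map_smul' _ _ := Ext.comp_smul _ _ _ _

lemma locCohTrans_apply (m n : ℕ) (h : m ≤ n)
    (e : Ext (ModuleCat.of R (R ⧸ J ^ m)) (ModuleCat.of R X) i) :
    locCohTrans J i X m n h e = (Ext.mk₀ (quotPowMap J m n h)).comp e (zero_add i) := rfl

instance locCohTrans_directedSystem :
    DirectedSystem (fun n => Ext (ModuleCat.of R (R ⧸ J ^ n)) (ModuleCat.of R X) i)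
      (fun m n h => locCohTrans J i X m n h) where
  map_self n e := by
    have : quotPowMap J n n le_rfl = 𝟙 _ := by
      exact ModuleCat.hom_ext (LinearMap.ext fun x => by
        obtain ⟨x, rfl⟩ := Ideal.Quotient.mk_surjective x; rfl)
    rw [locCohTrans_apply, this, Ext.mk₀_id_comp]
  map_map n m k h1 h2 e := by
    have : quotPowMap J k n (h1.trans h2) = quotPowMap J m n h2 ≫ quotPowMap J k m h1 := by
      exact ModuleCat.hom_ext (LinearMap.ext fun x => by
        obtain ⟨x, rfl⟩ := Ideal.Quotient.mk_surjective x; rfl)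
    rw [locCohTrans_apply, locCohTrans_apply, locCohTrans_apply, this, Ext.mk₀_comp_mk₀_assoc]

/-- Local cohomology as the direct limit of `Ext (R ⧸ J ^ n) X`. -/
abbrev LocCoh (X : Type) [AddCommGroup X] [Module R X] : Type :=
  Module.DirectLimit (fun n => Ext (ModuleCat.of R (R ⧸ J ^ n)) (ModuleCat.of R X) i)
    (fun m n h => locCohTrans J i X m n h)

namespace LocCoh

variable {i}

/-- The canonical map from the `n`-th stage to local cohomology. -/
noncomputable abbrev of (n : ℕ) (e : Ext (ModuleCat.of R (R ⧸ J ^ n)) (ModuleCat.of R X) i) :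
    LocCoh J i X :=
  Module.DirectLimit.of R ℕ _ _ n e

variable {J}

lemma exists_of (z : LocCoh J i X) : ∃ n e, of J n e = z := Module.DirectLimit.exists_of z

lemma of_trans (m n : ℕ) (h : m ≤ n)
    (e : Ext (ModuleCat.of R (R ⧸ J ^ m)) (ModuleCat.of R X) i) :
    of J n (locCohTrans J i X m n h e) = of J m e := Module.DirectLimit.of_f

@[simp] lemma of_zero (n : ℕ) :
    of J n (0 : Ext (ModuleCat.of R (R ⧸ J ^ n)) (ModuleCat.of R X) i) = 0 :=
  map_zero (Module.DirectLimit.of R ℕ _ _ n)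

lemma exists_trans_eq_zero {n : ℕ} {e : Ext (ModuleCat.of R (R ⧸ J ^ n)) (ModuleCat.of R X) i}
    (h : of J n e = 0) : ∃ m, ∃ hm : n ≤ m, locCohTrans J i X n m hm e = 0 := by
  obtain ⟨m, hm, h⟩ := Module.DirectLimit.of.zero_exact h
  exact ⟨m, hm, h⟩

variable (J i)

/-- Functoriality of local cohomology. -/
noncomputable def map (f : X →ₗ[R] Y) : LocCoh J i X →ₗ[R] LocCoh J i Y :=
  Module.DirectLimit.lift R ℕ _ _
    (fun n => (Module.DirectLimit.of R ℕ
        (fun n => Ext (ModuleCat.of R (R ⧸ J ^ n)) (ModuleCat.of R Y) i)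
        (fun m n h => locCohTrans J i Y m n h) n) ∘ₗ
      { toFun := fun e => e.comp (Ext.mk₀ (ModuleCat.ofHom f)) (add_zero i)
        map_add' := fun _ _ => Ext.add_comp _ _ _ _
        map_smul' := fun _ _ => Ext.smul_comp _ _ _ _ })
    (fun m n h e => by
      simp only [LinearMap.comp_apply, LinearMap.coe_mk, AddHom.coe_mk, locCohTrans_apply]
      rw [Ext.comp_assoc_of_third_deg_zero, ← locCohTrans_apply, Module.DirectLimit.of_f])

@[simp] lemma map_of (f : X →ₗ[R] Y) (n : ℕ)
    (e : Ext (ModuleCat.of R (R ⧸ J ^ n)) (ModuleCat.of R X) i) :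
    map J i f (of J n e) = of J n (e.comp (Ext.mk₀ (ModuleCat.ofHom f)) (add_zero i)) :=
  Module.DirectLimit.lift_of ..

lemma map_id_apply (z : LocCoh J i X) : map J i LinearMap.id z = z := by
  obtain ⟨n, e, rfl⟩ := exists_of z
  rw [map_of]
  congr 1
  exact Ext.comp_mk₀_id e

lemma map_comp_apply (g : Y →ₗ[R] Z) (f : X →ₗ[R] Y) (z : LocCoh J i X) :
    map J i (g ∘ₗ f) z = map J i g (map J i f z) := by
  obtain ⟨n, e, rfl⟩ := exists_of z
  rw [map_of, map_of, map_of, ModuleCat.ofHom_comp, ← Ext.mk₀_comp_mk₀,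
    Ext.comp_assoc_of_third_deg_zero]

lemma map_add_apply (f g : X →ₗ[R] Y) (z : LocCoh J i X) :
    map J i (f + g) z = map J i f z + map J i g z := by
  obtain ⟨n, e, rfl⟩ := exists_of z
  rw [map_of, map_of, map_of, ← map_add, ← Ext.comp_add, ← Ext.mk₀_add]
  rfl

lemma map_smul_apply (a : R) (f : X →ₗ[R] Y) (z : LocCoh J i X) :
    map J i (a • f) z = a • map J i f z := by
  obtain ⟨n, e, rfl⟩ := exists_of z
  rw [map_of, map_of, ← map_smul, ← Ext.comp_smul, ← Ext.mk₀_smul]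
  rfl

lemma map_smul_id_apply (a : R) (z : LocCoh J i X) :
    map J i (a • LinearMap.id) z = a • z := by
  rw [map_smul_apply, map_id_apply]

lemma map_zero_apply (z : LocCoh J i X) : map J i (0 : X →ₗ[R] Y) z = 0 := by
  simpa using map_smul_apply J i (0 : R) (0 : X →ₗ[R] Y) z

lemma map_sum_apply {ι : Type} (s : Finset ι) (f : ι → X →ₗ[R] Y) (z : LocCoh J i X) :
    map J i (∑ k ∈ s, f k) z = ∑ k ∈ s, map J i (f k) z := by
  classical
  induction s using Finset.induction_on with
  | empty => simp [map_zero_apply]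
  | insert k s hk ih => rw [Finset.sum_insert hk, Finset.sum_insert hk, map_add_apply, ih]

/-- Isomorphic modules have isomorphic local cohomology. -/
noncomputable def congr (e : X ≃ₗ[R] Y) : LocCoh J i X ≃ₗ[R] LocCoh J i Y :=
  LinearEquiv.ofLinearMap (map J i e.toLinearMap) (map J i e.symm.toLinearMap)
    (by
      refine LinearMap.ext fun z => ?_
      rw [LinearMap.comp_apply, ← map_comp_apply]
      rw [LinearEquiv.comp_symm, map_id_apply]; rfl)
    (by
      refine LinearMap.ext fun z => ?_
      rw [LinearMap.comp_apply, ← map_comp_apply]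
      rw [LinearEquiv.symm_comp, map_id_apply]; rfl)

variable {f : X →ₗ[R] Y} {g : Y →ₗ[R] Z}

lemma shortExact (hf : Injective f) (h : Exact f g) (hg : Surjective g) :
    (ShortComplex.mk (ModuleCat.ofHom f) (ModuleCat.ofHom g)
      (by ext x; exact h.apply_apply_eq_zero x)).ShortExact where
  exact := (ShortComplex.ShortExact.moduleCat_exact_iff_function_exact _).2 h
  mono_f := (ModuleCat.mono_iff_injective _).2 hf
  epi_g := (ModuleCat.epi_iff_surjective _).2 hg

/-- The connecting map of local cohomology. -/
noncomputable def δ (hf : Injective f) (h : Exact f g) (hg : Surjective g) :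
    LocCoh J i Z →ₗ[R] LocCoh J (i + 1) X :=
  Module.DirectLimit.lift R ℕ _ _
    (fun n => (Module.DirectLimit.of R ℕ
        (fun n => Ext (ModuleCat.of R (R ⧸ J ^ n)) (ModuleCat.of R X) (i + 1))
        (fun m n h => locCohTrans J (i + 1) X m n h) n) ∘ₗ
      { toFun := fun e => e.comp (shortExact hf h hg).extClass rfl
        map_add' := fun _ _ => Ext.add_comp _ _ _ _
        map_smul' := fun _ _ => Ext.smul_comp _ _ _ _ })
    (fun m n h e => by
      simp only [LinearMap.comp_apply, LinearMap.coe_mk, AddHom.coe_mk, locCohTrans_apply]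
      rw [Ext.comp_assoc _ _ _ (zero_add i) rfl (by lia), ← locCohTrans_apply,
        Module.DirectLimit.of_f])

lemma δ_of (hf : Injective f) (h : Exact f g) (hg : Surjective g) (n : ℕ)
    (e : Ext (ModuleCat.of R (R ⧸ J ^ n)) (ModuleCat.of R Z) i) :
    δ J i hf h hg (of J n e) = of J n (e.comp (shortExact hf h hg).extClass rfl) :=
  Module.DirectLimit.lift_of ..

lemma exact_map_map (hf : Injective f) (h : Exact f g) (hg : Surjective g) :
    Exact (map J i f) (map J i g) := by
  intro z
  constructor
  · intro hz
    obtain ⟨n, e, rfl⟩ := exists_of z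
    rw [map_of] at hz
    obtain ⟨m, hm, hz⟩ := exists_trans_eq_zero hz
    rw [locCohTrans_apply, ← Ext.comp_assoc_of_third_deg_zero, ← locCohTrans_apply _ _ _ _ hm] at hz
    obtain ⟨e', he'⟩ := Ext.covariant_sequence_exact₂ _ (shortExact hf h hg) _ hz
    refine ⟨of J m e', ?_⟩
    rw [map_of, ← of_trans n m hm e, ← he']
  · rintro ⟨z, rfl⟩
    rw [← map_comp_apply, h.linearMap_comp_eq_zero, map_zero_apply]

lemma exact_map_δ (hf : Injective f) (h : Exact f g) (hg : Surjective g) :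
    Exact (map J i g) (δ J i hf h hg) := by
  intro z
  constructor
  · intro hz
    obtain ⟨n, e, rfl⟩ := exists_of z
    rw [δ_of] at hz
    obtain ⟨m, hm, hz⟩ := exists_trans_eq_zero hz
    rw [locCohTrans_apply, ← Ext.comp_assoc _ _ _ (zero_add i) rfl (by lia),
      ← locCohTrans_apply _ _ _ _ hm] at hz
    obtain ⟨e', he'⟩ := Ext.covariant_sequence_exact₃ _ (shortExact hf h hg) _ rfl hz
    refine ⟨of J m e', ?_⟩
    rw [map_of, ← of_trans n m hm e, ← he']
  · rintro ⟨z, rfl⟩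
    obtain ⟨n, e, rfl⟩ := exists_of z
    rw [map_of, δ_of]
    have : (e.comp (Ext.mk₀ (ModuleCat.ofHom g)) (add_zero i)).comp
        (shortExact hf h hg).extClass rfl = 0 := by
      rw [Ext.comp_assoc_of_second_deg_zero]
      have := (shortExact hf h hg).comp_extClass
      simp only at this
      rw [this, Ext.comp_zero]
    rw [this, of_zero]

lemma exact_δ_map (hf : Injective f) (h : Exact f g) (hg : Surjective g) :
    Exact (δ J i hf h hg) (map J (i + 1) f) := by
  intro z
  constructor
  · intro hz
    obtain ⟨n, e, rfl⟩ := exists_of z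
    rw [map_of] at hz
    obtain ⟨m, hm, hz⟩ := exists_trans_eq_zero hz
    rw [locCohTrans_apply, ← Ext.comp_assoc_of_third_deg_zero, ← locCohTrans_apply _ _ _ _ hm] at hz
    obtain ⟨e', he'⟩ := Ext.covariant_sequence_exact₁ _ (shortExact hf h hg) _ hz rfl
    refine ⟨of J m e', ?_⟩
    rw [δ_of, ← of_trans n m hm e, ← he']
  · rintro ⟨z, rfl⟩
    obtain ⟨n, e, rfl⟩ := exists_of z
    rw [δ_of, map_of]
    have : (e.comp (shortExact hf h hg).extClass rfl).comp
        (Ext.mk₀ (ModuleCat.ofHom f)) (add_zero (i + 1)) = 0 := by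
      rw [Ext.comp_assoc_of_third_deg_zero]
      have := (shortExact hf h hg).extClass_comp
      simp only at this
      rw [this, Ext.comp_zero]
    rw [this, of_zero]

lemma exists_pow_smul_eq_zero (z : LocCoh J i X) : ∃ n, ∀ r ∈ J ^ n, r • z = 0 := by
  obtain ⟨n, e, rfl⟩ := exists_of z
  refine ⟨n, fun r hr => ?_⟩
  rw [← map_smul]
  have : r • e = 0 := by
    have h : r • 𝟙 (ModuleCat.of R (R ⧸ J ^ n)) = 0 := by
      refine ModuleCat.hom_ext (LinearMap.ext fun x => ?_)
      obtain ⟨x, rfl⟩ := Ideal.Quotient.mk_surjective x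
      change Ideal.Quotient.mk (J ^ n) (r * _) = 0
      exact Ideal.Quotient.eq_zero_iff_mem.2 (Ideal.mul_mem_right _ _ hr)
    rw [← Ext.mk₀_id_comp e, ← Ext.smul_comp, ← Ext.mk₀_smul, h]
    simp
  rw [this, map_zero]

lemma subsingleton_of_injective [Module.Injective R X] : Subsingleton (LocCoh J (i + 1) X) := by
  refine subsingleton_of_forall_eq 0 fun z => ?_
  obtain ⟨n, e, rfl⟩ := exists_of z
  have : CategoryTheory.Injective (ModuleCat.of R X) :=
    Module.injective_object_of_injective_module R X
  rw [Ext.eq_zero_of_injective e, of_zero]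

/-- Evaluation of elements of zeroth local cohomology. -/
noncomputable def eval : LocCoh J 0 X →ₗ[R] X :=
  Module.DirectLimit.lift R ℕ _ _
    (fun n =>
      { toFun := fun e => (Ext.linearEquiv₀ (R := R) e).hom (Ideal.Quotient.mk _ 1)
        map_add' := fun a b => by simp
        map_smul' := fun a b => by simp })
    (fun m n h e => by
      obtain ⟨e, rfl⟩ := (Ext.linearEquiv₀ (R := R)).symm.surjective e
      simp only [LinearMap.coe_mk, AddHom.coe_mk, locCohTrans_apply, LinearEquiv.apply_symm_apply]
      rw [Ext.linearEquiv₀_symm_apply, Ext.mk₀_comp_mk₀, ← Ext.linearEquiv₀_symm_apply (R := R),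
        LinearEquiv.apply_symm_apply]
      rfl)

lemma eval_of_mk₀ (n : ℕ) (e : ModuleCat.of R (R ⧸ J ^ n) ⟶ ModuleCat.of R X) :
    eval J (of J n (Ext.mk₀ e)) = e.hom (Ideal.Quotient.mk _ 1) := by
  refine (Module.DirectLimit.lift_of ..).trans ?_
  simp only [LinearMap.coe_mk, AddHom.coe_mk]
  rw [← Ext.linearEquiv₀_symm_apply (R := R), LinearEquiv.apply_symm_apply]

lemma exists_of_mk₀ (z : LocCoh J 0 X) :
    ∃ n, ∃ e : ModuleCat.of R (R ⧸ J ^ n) ⟶ ModuleCat.of R X, of J n (Ext.mk₀ e) = z := by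
  obtain ⟨n, e, rfl⟩ := exists_of z
  refine ⟨n, Ext.addEquiv₀ e, ?_⟩
  congr 1
  exact Ext.addEquiv₀.symm_apply_apply e

lemma eval_injective : Injective (eval J (X := X)) := by
  rw [injective_iff_map_eq_zero]
  intro z hz
  obtain ⟨n, e, rfl⟩ := exists_of_mk₀ J z
  rw [eval_of_mk₀] at hz
  have : e = 0 := by
    refine ModuleCat.hom_ext (LinearMap.ext fun x => ?_)
    obtain ⟨x, rfl⟩ := Ideal.Quotient.mk_surjective x
    have : Ideal.Quotient.mk (J ^ n) x = x • Ideal.Quotient.mk (J ^ n) 1 := by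
      rw [Algebra.smul_def, map_one, mul_one]; rfl
    rw [this, map_smul, hz, smul_zero]
    simp
  rw [this, Ext.mk₀_zero, of_zero]

lemma eval_map (f : X →ₗ[R] Y) (z : LocCoh J 0 X) : eval J (map J 0 f z) = f (eval J z) := by
  obtain ⟨n, e, rfl⟩ := exists_of_mk₀ J z
  rw [map_of, Ext.mk₀_comp_mk₀, eval_of_mk₀, eval_of_mk₀]
  rfl

lemma exists_eval_eq (x : X) (n : ℕ) (hx : ∀ r ∈ J ^ n, r • x = 0) : ∃ z, eval J z = x := by
  refine ⟨of J n (Ext.mk₀ (ModuleCat.ofHom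
    (Submodule.liftQ (J ^ n) (LinearMap.toSpanSingleton R X x)
      (fun r hr => by simpa using hx r hr)))),
    ?_⟩
  rw [eval_of_mk₀]
  change (LinearMap.toSpanSingleton R X x) 1 = x
  simp

lemma subsingleton [Subsingleton X] : Subsingleton (LocCoh J i X) := by
  refine subsingleton_of_forall_eq 0 fun z => ?_
  have h : (LinearMap.id : X →ₗ[R] X) = 0 := by ext x; exact Subsingleton.elim _ _
  rw [← map_id_apply J i z, h, map_zero_apply]

lemma annihilator_le : Module.annihilator R X ≤ Module.annihilator R (LocCoh J i X) := by
  intro a ha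
  rw [Module.mem_annihilator] at ha ⊢
  intro z
  have h : a • (LinearMap.id : X →ₗ[R] X) = 0 := by ext x; simpa using ha x
  rw [← map_smul_id_apply, h, map_zero_apply]

end LocCoh

end LocalCohomology

section PowTorsion

open Function

variable {R : Type} [CommRing R] (J : Ideal R) (i : ℕ)
  {X : Type} [AddCommGroup X] [Module R X] {Y : Type} [AddCommGroup Y] [Module R Y]

/-- The submodule of elements killed by a power of `J`. -/
def powTorsion (X : Type) [AddCommGroup X] [Module R X] : Submodule R X where
  carrier := {x | ∃ n, ∀ r ∈ J ^ n, r • x = 0}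
  zero_mem' := ⟨0, fun r _ => smul_zero r⟩
  add_mem' := by
    rintro x y ⟨m, hm⟩ ⟨n, hn⟩
    refine ⟨m + n, fun r hr => ?_⟩
    rw [smul_add, hm r (Ideal.pow_le_pow_right (Nat.le_add_right _ _) hr),
      hn r (Ideal.pow_le_pow_right (Nat.le_add_left _ _) hr), add_zero]
  smul_mem' := by
    rintro a x ⟨m, hm⟩
    exact ⟨m, fun r hr => by rw [smul_comm, hm r hr, smul_zero]⟩

/-- Every element is killed by a power of `J`. -/
def IsPowTorsion (X : Type) [AddCommGroup X] [Module R X] : Prop :=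
  ∀ x : X, ∃ n, ∀ r ∈ J ^ n, r • x = 0

variable {J}

lemma isPowTorsion_powTorsion : IsPowTorsion J (powTorsion J X) := by
  rintro ⟨x, n, hn⟩
  exact ⟨n, fun r hr => Subtype.ext (hn r hr)⟩

lemma IsPowTorsion.of_injective (h : IsPowTorsion J Y) (f : X →ₗ[R] Y) (hf : Injective f) :
    IsPowTorsion J X := fun x => by
  obtain ⟨n, hn⟩ := h (f x)
  exact ⟨n, fun r hr => hf (by rw [map_smul, hn r hr, map_zero])⟩

lemma IsPowTorsion.of_surjective (h : IsPowTorsion J X) (f : X →ₗ[R] Y) (hf : Surjective f) :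
    IsPowTorsion J Y := fun y => by
  obtain ⟨x, rfl⟩ := hf y
  obtain ⟨n, hn⟩ := h x
  exact ⟨n, fun r hr => by rw [← map_smul, hn r hr, map_zero]⟩

lemma isPowTorsion_of_pow_le_annihilator {k : ℕ} (h : J ^ k ≤ Module.annihilator R X) :
    IsPowTorsion J X := fun x => ⟨k, fun _ hr => Module.mem_annihilator.1 (h hr) x⟩

lemma IsPowTorsion.exists_pow_le_annihilator [Module.Finite R X] (h : IsPowTorsion J X) :
    ∃ k, J ^ k ≤ Module.annihilator R X := by
  obtain ⟨s, hs⟩ := Module.Finite.fg_top (R := R) (M := X)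
  choose n hn using h
  refine ⟨s.sup n, fun r hr => ?_⟩
  rw [Module.mem_annihilator]
  intro x
  have : (⊤ : Submodule R X) ≤ LinearMap.ker (LinearMap.lsmul R X r) := by
    rw [← hs, Submodule.span_le]
    intro y hy
    simpa using hn y r (Ideal.pow_le_pow_right (Finset.le_sup hy) hr)
  simpa using this (Submodule.mem_top (x := x))

lemma powTorsion_quotient_powTorsion [IsNoetherianRing R] [Module.Finite R X] :
    powTorsion J (X ⧸ powTorsion J X) = ⊥ := by
  rw [eq_bot_iff]
  rintro x ⟨n, hn⟩
  obtain ⟨x, rfl⟩ := Submodule.mkQ_surjective _ x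
  obtain ⟨k, hk⟩ := (isPowTorsion_powTorsion (J := J) (X := X)).exists_pow_le_annihilator
  rw [Submodule.mem_bot, Submodule.mkQ_apply, Submodule.Quotient.mk_eq_zero]
  refine ⟨k + n, fun r hr => ?_⟩
  rw [pow_add] at hr
  refine Submodule.mul_induction_on hr (fun a ha b hb => ?_) (fun a b ha hb => ?_)
  · have h1 := hn b hb
    rw [← map_smul, Submodule.mkQ_apply, Submodule.Quotient.mk_eq_zero] at h1
    have h2 := Module.mem_annihilator.1 (hk ha) ⟨_, h1⟩
    rw [mul_smul]
    exact congrArg Subtype.val h2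
  · rw [add_smul, ha, hb, add_zero]

lemma injective_powTorsion [IsNoetherianRing R] [Module.Injective R X] :
    Module.Injective R (powTorsion J X) := by
  refine Module.Baer.injective fun I g => ?_
  have hfin : Module.Finite R (LinearMap.range g) := inferInstance
  obtain ⟨k, hk⟩ := ((isPowTorsion_powTorsion (J := J) (X := X)).of_injective
    (LinearMap.range g).subtype (Submodule.subtype_injective _)).exists_pow_le_annihilator
  obtain ⟨c, hc⟩ := Ideal.exists_pow_inf_eq_pow_smul J (I : Submodule R R)
  have hn : J ^ (k + c) • (⊤ : Submodule R R) ⊓ I ≤ J ^ k • I := by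
    rw [hc (k + c) (by omega), Nat.add_sub_cancel]
    exact Submodule.smul_mono le_rfl inf_le_right
  have hker : ∀ x : I, (x : R) ∈ J ^ (k + c) → g x = 0 := by
    intro x hx
    have h1 : (x : R) ∈ J ^ k • I := hn ⟨by simpa using hx, x.2⟩
    have h2 : J ^ k • I ≤ (LinearMap.ker g).map I.subtype := by
      rw [Submodule.smul_le]
      intro r hr y hy
      refine ⟨⟨r • y, I.smul_mem r hy⟩, ?_, rfl⟩
      have := Module.mem_annihilator.1 (hk hr) ⟨g ⟨y, hy⟩, LinearMap.mem_range_self _ _⟩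
      have := congrArg Subtype.val this
      simp only [SetLike.mem_coe, LinearMap.mem_ker]
      have h3 : (⟨r • y, I.smul_mem r hy⟩ : I) = r • ⟨y, hy⟩ := rfl
      rw [h3, map_smul]
      exact this
    obtain ⟨y, hy, hxy⟩ := h2 h1
    have : y = x := Subtype.ext hxy
    rw [← this]; exact hy
  let q : I →ₗ[R] R ⧸ J ^ (k + c) := (Submodule.mkQ (J ^ (k + c))) ∘ₗ I.subtype
  have hq : LinearMap.ker q ≤ LinearMap.ker g := by
    intro x hx
    exact hker x ((Submodule.Quotient.mk_eq_zero _).1 hx)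
  obtain ⟨f, hf⟩ := Module.Injective.out (R := R)
    ((LinearMap.ker q).liftQ q le_rfl) (by
      rw [← LinearMap.ker_eq_bot]; exact Submodule.ker_liftQ_eq_bot _ _ _ le_rfl)
    ((powTorsion J X).subtype ∘ₗ (LinearMap.ker q).liftQ g hq)
  refine ⟨(f ∘ₗ (Submodule.mkQ (J ^ (k + c)))).codRestrict (powTorsion J X) (fun a => ?_), ?_⟩
  · refine ⟨k + c, fun r hr => ?_⟩
    rw [LinearMap.comp_apply, ← map_smul, ← map_smul]
    have : (Submodule.mkQ (J ^ (k + c))) (r • a) = 0 := by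
      rw [Submodule.mkQ_apply, Submodule.Quotient.mk_eq_zero]
      exact Ideal.mul_mem_right _ _ hr
    rw [this, map_zero]
  · intro x hx
    apply Subtype.ext
    exact hf (Submodule.Quotient.mk ⟨x, hx⟩)

namespace LocCoh

lemma eval_bijective (h : IsPowTorsion J X) : Bijective (eval J (X := X)) := by
  refine ⟨eval_injective J, fun x => ?_⟩
  obtain ⟨n, hn⟩ := h x
  exact exists_eval_eq J x n hn

lemma range_eval : LinearMap.range (eval J (X := X)) = powTorsion J X := by
  apply le_antisymm
  · rintro _ ⟨z, rfl⟩
    obtain ⟨n, hn⟩ := exists_pow_smul_eq_zero J 0 z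
    exact ⟨n, fun r hr => by rw [← map_smul, hn r hr, map_zero]⟩
  · rintro x ⟨n, hn⟩
    exact exists_eval_eq J x n hn

lemma exists_injective_powTorsion [IsNoetherianRing R] (h : IsPowTorsion J X) :
    ∃ (I : Type) (_ : AddCommGroup I) (_ : Module R I) (f : X →ₗ[R] I), Injective f ∧
      Module.Injective R I ∧ IsPowTorsion J I := by
  let I := CategoryTheory.Injective.under (ModuleCat.of R X)
  have hI : Module.Injective R I := by
    have : CategoryTheory.Injective (ModuleCat.of R I) :=
      inferInstanceAs (CategoryTheory.Injective I)
    exact Module.injective_module_of_injective_object R I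
  have hf : Injective (CategoryTheory.Injective.ι (ModuleCat.of R X)).hom :=
    (ModuleCat.mono_iff_injective _).1 inferInstance
  refine ⟨powTorsion J I, inferInstance, inferInstance,
    (CategoryTheory.Injective.ι (ModuleCat.of R X)).hom.codRestrict _ (fun x => ?_), ?_,
    injective_powTorsion, isPowTorsion_powTorsion⟩
  · obtain ⟨n, hn⟩ := h x
    exact ⟨n, fun r hr => by rw [← map_smul, hn r hr, map_zero]⟩
  · intro x y hxy
    exact hf (congrArg Subtype.val hxy)

lemma subsingleton_of_isPowTorsion [IsNoetherianRing R] : ∀ (i : ℕ) {X : Type} [AddCommGroup X]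
    [Module R X], IsPowTorsion J X → Subsingleton (LocCoh J (i + 1) X) := by
  intro i
  induction i with
  | zero =>
    intro X _ _ h
    obtain ⟨I, _, _, f, hf, hI, hIt⟩ := exists_injective_powTorsion h
    have hex : Exact f (LinearMap.range f).mkQ := LinearMap.exact_map_mkQ_range f
    have hs := Submodule.mkQ_surjective (LinearMap.range f)
    have := subsingleton_of_injective (X := I) J 0
    refine subsingleton_of_forall_eq 0 fun z => ?_
    obtain ⟨y, rfl⟩ := (exact_δ_map J 0 hf hex hs z).1 (Subsingleton.elim _ _)
    obtain ⟨w, hw⟩ := hs (eval J y)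
    obtain ⟨w', rfl⟩ := (eval_bijective hIt).2 w
    rw [← eval_map] at hw
    rw [← eval_injective J hw]
    exact (exact_map_δ J 0 hf hex hs).apply_apply_eq_zero w'
  | succ i ih =>
    intro X _ _ h
    obtain ⟨I, _, _, f, hf, hI, hIt⟩ := exists_injective_powTorsion h
    have hex : Exact f (LinearMap.range f).mkQ := LinearMap.exact_map_mkQ_range f
    have hs := Submodule.mkQ_surjective (LinearMap.range f)
    have := subsingleton_of_injective (X := I) J (i + 1)
    have := ih (hIt.of_surjective _ hs)
    refine subsingleton_of_forall_eq 0 fun z => ?_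
    obtain ⟨y, rfl⟩ := (exact_δ_map J (i + 1) hf hex hs z).1 (Subsingleton.elim _ _)
    rw [Subsingleton.elim y 0, map_zero]

/-- Passing to the quotient by the torsion does not change local cohomology in positive degree. -/
lemma map_mkQ_powTorsion_bijective [IsNoetherianRing R] :
    Bijective (map J (i + 1) (powTorsion J X).mkQ) := by
  have hf := Submodule.subtype_injective (powTorsion J X)
  have hex : Exact (powTorsion J X).subtype (powTorsion J X).mkQ := LinearMap.exact_subtype_mkQ _
  have hs := Submodule.mkQ_surjective (powTorsion J X)
  have h1 := subsingleton_of_isPowTorsion i (isPowTorsion_powTorsion (J := J) (X := X))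
  have h2 := subsingleton_of_isPowTorsion (i + 1) (isPowTorsion_powTorsion (J := J) (X := X))
  constructor
  · rw [injective_iff_map_eq_zero]
    intro z hz
    obtain ⟨y, rfl⟩ := (exact_map_map J (i + 1) hf hex hs z).1 hz
    rw [Subsingleton.elim y 0, map_zero]
  · intro z
    exact (exact_map_δ J (i + 1) hf hex hs z).1 (Subsingleton.elim _ _)

end LocCoh

end PowTorsion

section LocalVanishing

open Function

variable {R : Type} [CommRing R] {N : Type} [AddCommGroup N] [Module R N]

lemma IsSMulRegular.of_forall_associatedPrimes [IsNoetherianRing R] {x : R}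
    (h : ∀ p ∈ associatedPrimes R N, x ∉ p) : IsSMulRegular N x := by
  have h1 := biUnion_associatedPrimes_eq_compl_regular R N
  by_contra hx
  have h2 : x ∈ {r : R | IsSMulRegular N r}ᶜ := hx
  rw [← h1] at h2
  simp only [Set.mem_iUnion] at h2
  obtain ⟨p, hp, hxp⟩ := h2
  exact h p hp hxp

lemma IsSMulRegular.notMem_associatedPrimes [IsNoetherianRing R] {x : R} (h : IsSMulRegular N x) :
    ∀ p ∈ associatedPrimes R N, x ∉ p := by
  intro p hp hx
  have h1 := biUnion_associatedPrimes_eq_compl_regular R N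
  have h2 : x ∈ {r : R | IsSMulRegular N r}ᶜ := by
    rw [← h1]; simp only [Set.mem_iUnion]; exact ⟨p, hp, hx⟩
  exact h2 h

lemma maximalIdeal_notMem_associatedPrimes [IsNoetherianRing R] [IsLocalRing R]
    (h : powTorsion (maximalIdeal R) N = ⊥) : maximalIdeal R ∉ associatedPrimes R N := by
  intro hm
  obtain ⟨hp, y, hy⟩ := isAssociatedPrime_iff.1 hm
  have hy0 : y ∈ powTorsion (maximalIdeal R) N := by
    refine ⟨1, fun r hr => ?_⟩
    rw [pow_one, hy] at hr
    simpa [Submodule.mem_colon_singleton] using hr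
  rw [h, Submodule.mem_bot] at hy0
  rw [hy0] at hy
  apply hp.ne_top
  rw [hy]
  ext; simp

lemma exists_isSMulRegular_forall_notMem [IsNoetherianRing R] [IsLocalRing R] [Module.Finite R N]
    (h : powTorsion (maximalIdeal R) N = ⊥) {s : Set (Ideal R)} (hs : s.Finite)
    (hsp : ∀ p ∈ s, p.IsPrime) (hsm : maximalIdeal R ∉ s) :
    ∃ x ∈ maximalIdeal R, IsSMulRegular N x ∧ ∀ p ∈ s, x ∉ p := by
  have hm := maximalIdeal_notMem_associatedPrimes h
  obtain ⟨x, hxm, hx⟩ := Ideal.exists_mem_forall_notMem (I := maximalIdeal R)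
    ((associatedPrimes.finite R N).union hs)
    (by
      rintro p (hp | hp)
      · exact hp.isPrime
      · exact hsp p hp)
    (by
      rintro p hp hle
      have hpr : p.IsPrime := by
        rcases hp with hp | hp
        · exact hp.isPrime
        · exact hsp p hp
      have : maximalIdeal R = p := (maximalIdeal.isMaximal R).eq_of_le hpr.ne_top hle
      subst this
      rcases hp with hp | hp
      · exact hm hp
      · exact hsm hp)
  exact ⟨x, hxm, IsSMulRegular.of_forall_associatedPrimes (fun p hp => hx p (Or.inl hp)),
    fun p hp => hx p (Or.inr hp)⟩

lemma sup_span_le_annihilator_quotSMulTop {I : Ideal R} (hI : I ≤ Module.annihilator R N) (x : R) :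
    I ⊔ Ideal.span {x} ≤ Module.annihilator R (QuotSMulTop x N) := by
  refine sup_le (hI.trans (LinearMap.annihilator_le_of_surjective (Submodule.mkQ _)
    (Submodule.mkQ_surjective _))) ?_
  rw [Ideal.span_le, Set.singleton_subset_iff]
  exact QuotSMulTop.mem_annihilator _ _

lemma exact_smul_id_mkQ (x : R) :
    Exact (x • (LinearMap.id : N →ₗ[R] N)) (Submodule.mkQ (x • (⊤ : Submodule R N))) := by
  intro y
  simp only [Submodule.mkQ_apply, Submodule.Quotient.mk_eq_zero]
  constructor
  · rintro ⟨z, -, rfl⟩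
    exact ⟨z, rfl⟩
  · rintro ⟨z, rfl⟩
    exact ⟨z, trivial, rfl⟩

lemma injective_smul_id {x : R} (hx : IsSMulRegular N x) :
    Injective (x • (LinearMap.id : N →ₗ[R] N)) := fun _ _ h => hx h

/-- A finite set of primes to avoid in order to decrease the dimension of `R ⧸ I`. -/
lemma exists_isSMulRegular_ringKrullDim_le [IsNoetherianRing R] [IsLocalRing R] [Module.Finite R N]
    (h : powTorsion (maximalIdeal R) N = ⊥) {I : Ideal R} {n : ℕ}
    (hI : ringKrullDim (R ⧸ I) ≤ (n + 1 : ℕ)) :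
    ∃ x ∈ maximalIdeal R, IsSMulRegular N x ∧ ringKrullDim (R ⧸ (I ⊔ Ideal.span {x})) ≤ n := by
  obtain ⟨x, hxm, hx, hxs⟩ := exists_isSMulRegular_forall_notMem h
    (finite_setOf_prime_ringKrullDim_quotient_eq hI) (fun p hp => hp.1) (by
      rintro ⟨-, -, h2⟩
      have h3 : ringKrullDim (R ⧸ maximalIdeal R) = 0 :=
        ringKrullDim_eq_zero_of_field (ResidueField R)
      rw [h3] at h2
      have : 0 = n + 1 := by exact_mod_cast h2
      omega)
  exact ⟨x, hxm, hx, ringKrullDim_quotient_sup_span_le hI (fun p hp h1 h2 => hxs p ⟨hp, h1, h2⟩)⟩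

namespace LocCoh

lemma exists_pow_smul_eq_zero' [IsLocalRing R] {x : R} (hx : x ∈ maximalIdeal R) {i : ℕ}
    (z : LocCoh (maximalIdeal R) i N) :
    ∃ n, x ^ n • z = 0 := by
  obtain ⟨n, hn⟩ := exists_pow_smul_eq_zero (maximalIdeal R) i z
  exact ⟨n, hn _ (Ideal.pow_mem_pow hx n)⟩

/-- Grothendieck vanishing. -/
theorem subsingleton_of_ringKrullDim_lt [IsNoetherianRing R] [IsLocalRing R] (n : ℕ) :
    ∀ (I : Ideal R) (N : Type) [AddCommGroup N] [Module R N] [Module.Finite R N],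
      I ≤ Module.annihilator R N → ringKrullDim (R ⧸ I) ≤ n →
        ∀ i, n < i → Subsingleton (LocCoh (maximalIdeal R) i N) := by
  induction n with
  | zero =>
    intro I N _ _ _ hI hdim i hi
    obtain ⟨i, rfl⟩ := Nat.exists_eq_add_of_lt hi
    obtain ⟨k, hk⟩ := exists_maximalIdeal_pow_le_of_ringKrullDim_quotient_le_zero hdim
    exact subsingleton_of_isPowTorsion _ (isPowTorsion_of_pow_le_annihilator (hk.trans hI))
  | succ n ih =>
    intro I N _ _ _ hI hdim i hi
    obtain ⟨i, rfl⟩ := Nat.exists_eq_add_of_lt hi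
    have hN := powTorsion_quotient_powTorsion (J := (maximalIdeal R)) (X := N)
    obtain ⟨x, hxm, hx, hdim'⟩ := exists_isSMulRegular_ringKrullDim_le hN hdim
    have hI' : I ≤ Module.annihilator R (N ⧸ powTorsion (maximalIdeal R) N) :=
      hI.trans (LinearMap.annihilator_le_of_surjective _ (Submodule.mkQ_surjective _))
    have := ih _ (QuotSMulTop x (N ⧸ powTorsion (maximalIdeal R) N))
      (sup_span_le_annihilator_quotSMulTop hI' x) hdim' (n + 1 + i) (by omega)
    have h1 := exact_δ_map (maximalIdeal R) (n + 1 + i) (injective_smul_id hx) (exact_smul_id_mkQ x)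
      (Submodule.mkQ_surjective _)
    have h2 : Subsingleton (LocCoh (maximalIdeal R) (n + 1 + i + 1)
        (N ⧸ powTorsion (maximalIdeal R) N)) := by
      refine subsingleton_of_forall_eq 0 fun z => ?_
      have hinj : ∀ w : LocCoh (maximalIdeal R) (n + 1 + i + 1)
          (N ⧸ powTorsion (maximalIdeal R) N), x • w = 0 → w = 0 := by
        intro w hw
        rw [← map_smul_id_apply] at hw
        obtain ⟨u, rfl⟩ := (h1 w).1 hw
        rw [Subsingleton.elim u 0, map_zero]
      obtain ⟨k, hk⟩ := exists_pow_smul_eq_zero' hxm z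
      induction k with
      | zero => simpa using hk
      | succ k ihk =>
        exact ihk (hinj _ (by rwa [pow_succ', mul_smul] at hk))
    exact (map_mkQ_powTorsion_bijective (J := maximalIdeal R) (n + 1 + i) (X := N)).injective
      |>.subsingleton

/-- Sharp form of the Melkersson criterion for a single element. -/
theorem _root_.isArtinian_of_torsionBy {R : Type} [CommRing R] {X : Type} [AddCommGroup X]
    [Module R X] (x : R) (h : ∀ z : X, ∃ n : ℕ, x ^ n • z = 0)
    [IsArtinian R (Submodule.torsionBy R X x)] : IsArtinian R X := by
  have hT : ∀ f : ℕ →o (Submodule R (Submodule.torsionBy R X x))ᵒᵈ, ∃ n, ∀ m, n ≤ m → f n = f m :=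
    monotone_stabilizes_iff_artinian.2 inferInstance
  rw [← monotone_stabilizes_iff_artinian]
  intro f
  let P : ℕ → Submodule R X := fun n => OrderDual.ofDual (f n)
  have hP : ∀ m n, m ≤ n → P n ≤ P m := fun m n h => f.monotone h
  let U : ℕ → ℕ → Submodule R (Submodule.torsionBy R X x) := fun k n =>
    ((P n).map (LinearMap.lsmul R X (x ^ k))).comap (Submodule.subtype _)
  have hUn : ∀ k m n, m ≤ n → U k n ≤ U k m := fun k m n h =>
    Submodule.comap_mono (Submodule.map_mono (hP m n h))
  have hUk : ∀ n k l, k ≤ l → U l n ≤ U k n := by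
    rintro n k l hkl w ⟨y, hy, hw⟩
    refine ⟨x ^ (l - k) • y, (P n).smul_mem _ hy, ?_⟩
    rw [← hw]
    simp only [LinearMap.lsmul_apply, smul_smul, ← pow_add]
    congr 2; omega
  obtain ⟨n₀, hn₀⟩ := hT ⟨fun n => OrderDual.toDual (U n n), fun m n h =>
    (hUn n m n h).trans (hUk m m n h)⟩
  have hstab : ∀ k, ∃ n, ∀ m, n ≤ m → U k n = U k m := fun k =>
    hT ⟨fun n => OrderDual.toDual (U k n), fun m n h => hUn k m n h⟩
  choose s hs using hstab
  refine ⟨max n₀ ((Finset.range n₀).sup s), fun m hm => ?_⟩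
  have hU : ∀ k, U k (max n₀ ((Finset.range n₀).sup s)) ≤ U k m := by
    intro k
    rcases lt_or_ge k n₀ with hk | hk
    · have h1 : s k ≤ (Finset.range n₀).sup s := Finset.le_sup (Finset.mem_range.2 hk)
      rw [← hs k _ (h1.trans (le_max_right _ _)), ← hs k m ((h1.trans (le_max_right _ _)).trans hm)]
    · calc U k (max n₀ ((Finset.range n₀).sup s)) ≤ U k n₀ := hUn k _ _ (le_max_left _ _)
        _ ≤ U n₀ n₀ := hUk n₀ n₀ k hk
        _ = U (max k m) (max k m) := hn₀ (max k m) (hk.trans (le_max_left _ _))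
        _ ≤ U k (max k m) := hUk _ _ _ (le_max_left _ _)
        _ ≤ U k m := hUn k _ _ (le_max_right _ _)
  refine le_antisymm (f.monotone hm) ?_
  change P (max n₀ ((Finset.range n₀).sup s)) ≤ P m
  have key : ∀ k, ∀ z ∈ P (max n₀ ((Finset.range n₀).sup s)), x ^ k • z = 0 → z ∈ P m := by
    intro k
    induction k with
    | zero => intro z _ hz; rw [pow_zero, one_smul] at hz; rw [hz]; exact zero_mem _
    | succ k ih =>
      intro z hz hkz
      have h1 : x ^ k • z ∈ Submodule.torsionBy R X x := by
        rw [Submodule.mem_torsionBy_iff, smul_smul, ← pow_succ', hkz]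
      have h2 : (⟨x ^ k • z, h1⟩ : Submodule.torsionBy R X x) ∈
          U k (max n₀ ((Finset.range n₀).sup s)) := ⟨z, hz, rfl⟩
      obtain ⟨y, hy, hyz⟩ := hU k h2
      have h3 := ih (z - y) (sub_mem hz (hP _ _ hm hy))
        (by rw [smul_sub, sub_eq_zero]; exact hyz.symm)
      simpa using add_mem h3 hy
  intro z hz
  obtain ⟨k, hk⟩ := h z
  exact key k z hz hk

theorem isArtinian [IsNoetherianRing R] [IsLocalRing R] (i : ℕ) : ∀ (N : Type) [AddCommGroup N]
    [Module R N] [Module.Finite R N], IsArtinian R (LocCoh (maximalIdeal R) i N) := by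
  induction i with
  | zero =>
    intro N _ _ _
    obtain ⟨k, hk⟩ :=
      (isPowTorsion_powTorsion (J := maximalIdeal R) (X := N)).exists_pow_le_annihilator
    have h1 := (isFiniteLength_of_pow_le_annihilator (maximalIdeal.isMaximal R) hk
      (Or.inl inferInstance)).2
    have h2 : IsArtinian R (LinearMap.range (eval (maximalIdeal R) (X := N))) := by
      rw [range_eval]; exact h1
    exact isArtinian_of_injective (eval (maximalIdeal R) (X := N)).rangeRestrict
      (fun a b h => eval_injective (maximalIdeal R) (congrArg Subtype.val h))
  | succ i ih =>
    intro N _ _ _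
    have hN := powTorsion_quotient_powTorsion (J := (maximalIdeal R)) (X := N)
    obtain ⟨x, hxm, hx, -⟩ := exists_isSMulRegular_forall_notMem hN Set.finite_empty
      (by simp) (by simp)
    have := ih (QuotSMulTop x (N ⧸ powTorsion (maximalIdeal R) N))
    have h1 := exact_δ_map (maximalIdeal R) i (injective_smul_id hx) (exact_smul_id_mkQ x)
      (Submodule.mkQ_surjective _)
    have h3 : IsArtinian R (Submodule.torsionBy R
        (LocCoh (maximalIdeal R) (i + 1) (N ⧸ powTorsion (maximalIdeal R) N)) x) := by
      refine isArtinian_of_surjective _ ((δ (maximalIdeal R) i (injective_smul_id hx)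
        (exact_smul_id_mkQ x) (Submodule.mkQ_surjective _)).codRestrict
          (Submodule.torsionBy R
            (LocCoh (maximalIdeal R) (i + 1) (N ⧸ powTorsion (maximalIdeal R) N)) x)
          (fun z => ?_)) ?_
      · rw [Submodule.mem_torsionBy_iff, ← map_smul_id_apply]
        exact h1.apply_apply_eq_zero z
      · rintro ⟨w, hw⟩
        rw [Submodule.mem_torsionBy_iff, ← map_smul_id_apply] at hw
        obtain ⟨u, rfl⟩ := (h1 w).1 hw
        exact ⟨u, rfl⟩
    have h2 := isArtinian_of_torsionBy
      (X := LocCoh (maximalIdeal R) (i + 1) (N ⧸ powTorsion (maximalIdeal R) N)) x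
      (fun z => exists_pow_smul_eq_zero' hxm z)
    exact isArtinian_of_injective _
      (map_mkQ_powTorsion_bijective (J := maximalIdeal R) i (X := N)).injective

/-- Right exactness of the top local cohomology, applied to cyclic modules. -/
theorem map_factor_surjective_and_ker [IsNoetherianRing R] {J : Ideal R} {i : ℕ} {𝔧 I : Ideal R}
    (h : 𝔧 ≤ I)
    (hvan : ∀ (N : Type) [AddCommGroup N] [Module R N] [Module.Finite R N],
      𝔧 ≤ Module.annihilator R N → Subsingleton (LocCoh J (i + 1) N)) :
    Surjective (map J i (Submodule.factor h : (R ⧸ 𝔧) →ₗ[R] (R ⧸ I))) ∧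
      LinearMap.ker (map J i (Submodule.factor h : (R ⧸ 𝔧) →ₗ[R] (R ⧸ I))) =
        I • (⊤ : Submodule R (LocCoh J i (R ⧸ 𝔧))) := by
  let g : (R ⧸ 𝔧) →ₗ[R] (R ⧸ I) := Submodule.factor h
  have hg : Surjective g := Submodule.factor_surjective h
  have hann : 𝔧 ≤ Module.annihilator R (R ⧸ 𝔧) := by rw [Ideal.annihilator_quotient]
  let K := LinearMap.ker g
  have hK : 𝔧 ≤ Module.annihilator R K :=
    hann.trans (LinearMap.annihilator_le_of_injective K.subtype (Submodule.subtype_injective _))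
  have hKs := hvan K hK
  have hex : Exact K.subtype g := LinearMap.exact_subtype_ker_map g
  have hsurj : Surjective (map J i g) := fun z =>
    (exact_map_δ J i (Submodule.subtype_injective K) hex hg z).1 (Subsingleton.elim _ _)
  refine ⟨hsurj, le_antisymm ?_ ?_⟩
  · intro z hz
    obtain ⟨w, rfl⟩ := (exact_map_map J i (Submodule.subtype_injective K) hex hg z).1 hz
    obtain ⟨n, a, ha⟩ := Submodule.fg_iff_exists_fin_generating_family.1 (IsNoetherian.noetherian I)
    have hmem : ∀ k, a k ∈ I := fun k => ha ▸ Submodule.subset_span ⟨k, rfl⟩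
    let q : (Fin n → R ⧸ 𝔧) →ₗ[R] (R ⧸ 𝔧) := ∑ k, a k • LinearMap.proj k
    have hqK : ∀ v, q v ∈ K := by
      intro v
      simp only [q, LinearMap.sum_apply, LinearMap.smul_apply, LinearMap.proj_apply]
      refine sum_mem fun k _ => ?_
      obtain ⟨r, hr⟩ := Ideal.Quotient.mk_surjective (v k)
      rw [← hr, LinearMap.mem_ker]
      change Ideal.Quotient.mk I (a k * r) = 0
      exact Ideal.Quotient.eq_zero_iff_mem.2 (Ideal.mul_mem_right _ _ (hmem k))
    let q' : (Fin n → R ⧸ 𝔧) →ₗ[R] K := q.codRestrict K hqK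
    have hq' : Surjective q' := by
      rintro ⟨y, hy⟩
      obtain ⟨r, rfl⟩ := Ideal.Quotient.mk_surjective y
      have hr : r ∈ I := Ideal.Quotient.eq_zero_iff_mem.1 hy
      rw [← ha, Submodule.mem_span_range_iff_exists_fun] at hr
      obtain ⟨c, hc⟩ := hr
      refine ⟨fun k => Ideal.Quotient.mk 𝔧 (c k), Subtype.ext ?_⟩
      change q _ = _
      change _ = Ideal.Quotient.mk 𝔧 r
      rw [← hc]
      simp only [q, LinearMap.sum_apply, LinearMap.smul_apply, LinearMap.proj_apply, map_sum]
      refine Finset.sum_congr rfl fun k _ => ?_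
      change Ideal.Quotient.mk 𝔧 (a k * c k) = _
      rw [smul_eq_mul, mul_comm]
    have hann2 : 𝔧 ≤ Module.annihilator R (Fin n → R ⧸ 𝔧) := by
      intro r hr
      rw [Module.mem_annihilator]
      intro v
      funext k
      exact Module.mem_annihilator.1 (hann hr) (v k)
    have hL := hvan (LinearMap.ker q') (hann2.trans (LinearMap.annihilator_le_of_injective
      (LinearMap.ker q').subtype (Submodule.subtype_injective _)))
    obtain ⟨u, rfl⟩ := (exact_map_δ J i (Submodule.subtype_injective (LinearMap.ker q'))
      (LinearMap.exact_subtype_ker_map q') hq' w).1 (Subsingleton.elim _ _)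
    rw [← map_comp_apply]
    have : K.subtype ∘ₗ q' = ∑ k, a k • LinearMap.proj k := rfl
    rw [this, map_sum_apply]
    refine sum_mem fun k _ => ?_
    rw [map_smul_apply]
    exact Submodule.smul_mem_smul (hmem k) trivial
  · rw [Submodule.smul_le]
    intro r hr z _
    rw [LinearMap.mem_ker, map_smul]
    refine Module.mem_annihilator.1 (annihilator_le J i ?_) _
    rw [Ideal.annihilator_quotient]
    exact hr

/-- The torsion in top local cohomology comes from local cohomology of the quotient. -/
theorem exists_surjective_torsionBy [IsNoetherianRing R] {J : Ideal R} {i : ℕ} {x : R}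
    (hvan : ∀ (N : Type) [AddCommGroup N] [Module R N] [Module.Finite R N],
      x ∈ Module.annihilator R N → ∀ j, i < j → Subsingleton (LocCoh J j N)) :
    ∃ f : LocCoh J i (R ⧸ Ideal.span {x}) →ₗ[R] Submodule.torsionBy R (LocCoh J (i + 1) R) x,
      Surjective f := by
  let S : Submodule R R := Ideal.span {x}
  let t : R →ₗ[R] S := (x • LinearMap.id : R →ₗ[R] R).codRestrict S
    (fun r => Ideal.mul_mem_right _ _ (Ideal.mem_span_singleton_self x))
  have ht : Surjective t := by
    rintro ⟨y, hy⟩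
    obtain ⟨r, rfl⟩ := Ideal.mem_span_singleton'.1 hy
    exact ⟨r, Subtype.ext (mul_comm _ _)⟩
  have hx : x ∈ Module.annihilator R (LinearMap.ker t) := by
    rw [Module.mem_annihilator]
    rintro ⟨y, hy⟩
    exact Subtype.ext (congrArg (fun w : S => (w : R)) (LinearMap.mem_ker.1 hy))
  have hker1 := hvan (LinearMap.ker t) hx (i + 1) (by omega)
  have hker2 := hvan (LinearMap.ker t) hx (i + 1 + 1) (by omega)
  have hinj : Injective (map J (i + 1) t) := by
    rw [injective_iff_map_eq_zero]
    intro z hz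
    obtain ⟨y, rfl⟩ := (exact_map_map J (i + 1) (Submodule.subtype_injective (LinearMap.ker t))
      (LinearMap.exact_subtype_ker_map t) ht z).1 hz
    rw [Subsingleton.elim y 0, map_zero]
  have hsur : Surjective (map J (i + 1) t) := fun z =>
    (exact_map_δ J (i + 1) (Submodule.subtype_injective (LinearMap.ker t))
      (LinearMap.exact_subtype_ker_map t) ht z).1 (Subsingleton.elim _ _)
  let e := LinearEquiv.ofBijective (map J (i + 1) t) ⟨hinj, hsur⟩
  have he : ∀ z, map J (i + 1) t (e.symm z) = z := fun z => e.apply_symm_apply z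
  have hmul : ∀ z : LocCoh J (i + 1) R, x • z = map J (i + 1) S.subtype (map J (i + 1) t z) := by
    intro z
    rw [← map_comp_apply, ← map_smul_id_apply]
    rfl
  have hex := exact_δ_map J i (Submodule.subtype_injective S) (LinearMap.exact_subtype_mkQ S)
    (Submodule.mkQ_surjective S)
  let d : LocCoh J i (R ⧸ Ideal.span {x}) →ₗ[R] LocCoh J (i + 1) S :=
    δ J i (Submodule.subtype_injective S) (LinearMap.exact_subtype_mkQ S)
      (Submodule.mkQ_surjective S)
  refine ⟨(e.symm.toLinearMap ∘ₗ d).codRestrict (Submodule.torsionBy R (LocCoh J (i + 1) R) x)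
    (fun z => ?_), ?_⟩
  · rw [Submodule.mem_torsionBy_iff, hmul]
    simp only [LinearMap.comp_apply, LinearEquiv.coe_coe, he]
    exact hex.apply_apply_eq_zero z
  · rintro ⟨w, hw⟩
    rw [Submodule.mem_torsionBy_iff, hmul] at hw
    obtain ⟨u, hu⟩ := (hex _).1 hw
    refine ⟨u, Subtype.ext ?_⟩
    change e.symm (d u) = w
    rw [LinearEquiv.symm_apply_eq]
    exact hu

end LocCoh

end LocalVanishing

section GenericElements

open Function

variable {R : Type} [CommRing R]

/-- A property holding for all elements of the maximal ideal outside of finitely many nonmaximal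
primes. -/
def HoldsGenerically [IsLocalRing R] (P : R → Prop) : Prop :=
  ∃ s : Set (Ideal R), s.Finite ∧ (∀ p ∈ s, p.IsPrime) ∧ maximalIdeal R ∉ s ∧
    ∀ x ∈ maximalIdeal R, (∀ p ∈ s, x ∉ p) → P x

namespace HoldsGenerically

variable [IsLocalRing R] {P Q : R → Prop}

lemma exists_mem (h : HoldsGenerically P) : ∃ x ∈ maximalIdeal R, P x := by
  obtain ⟨s, hs, hsp, hsm, h⟩ := h
  obtain ⟨x, hx, hxs⟩ := Ideal.exists_mem_forall_notMem (I := maximalIdeal R) hs hsp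
    (fun p hp hle => hsm ((maximalIdeal.isMaximal R).eq_of_le (hsp p hp).ne_top hle ▸ hp))
  exact ⟨x, hx, h x hx hxs⟩

lemma mono (h : HoldsGenerically P) (hPQ : ∀ x ∈ maximalIdeal R, P x → Q x) :
    HoldsGenerically Q := by
  obtain ⟨s, hs, hsp, hsm, h⟩ := h
  exact ⟨s, hs, hsp, hsm, fun x hx hxs => hPQ x hx (h x hx hxs)⟩

lemma and (h : HoldsGenerically P) (h' : HoldsGenerically Q) :
    HoldsGenerically (fun x => P x ∧ Q x) := by
  obtain ⟨s, hs, hsp, hsm, h⟩ := h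
  obtain ⟨t, ht, htp, htm, h'⟩ := h'
  refine ⟨s ∪ t, hs.union ht, fun p hp => hp.elim (hsp p) (htp p), fun hp => hp.elim hsm htm,
    fun x hx hxs => ⟨h x hx fun p hp => hxs p (Or.inl hp), h' x hx fun p hp => hxs p (Or.inr hp)⟩⟩

lemma forall_finite {ι : Type} [Finite ι] {P : ι → R → Prop} (h : ∀ i, HoldsGenerically (P i)) :
    HoldsGenerically (fun x => ∀ i, P i x) := by
  choose s hs hsp hsm h using h
  refine ⟨⋃ i, s i, Set.finite_iUnion hs, ?_, ?_, ?_⟩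
  · intro p hp
    obtain ⟨i, hi⟩ := Set.mem_iUnion.1 hp
    exact hsp i p hi
  · intro hp
    obtain ⟨i, hi⟩ := Set.mem_iUnion.1 hp
    exact hsm i hi
  · exact fun x hx hxs i => h i x hx fun p hp => hxs p (Set.mem_iUnion.2 ⟨i, hp⟩)

lemma of_forall (h : ∀ x ∈ maximalIdeal R, P x) : HoldsGenerically P :=
  ⟨∅, Set.finite_empty, by simp, by simp, fun x hx _ => h x hx⟩

lemma ringKrullDim_quotient_sup_span_le [IsNoetherianRing R] {I : Ideal R} {n : ℕ}
    (hI : ringKrullDim (R ⧸ I) ≤ (n + 1 : ℕ)) :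
    HoldsGenerically (fun x => ringKrullDim (R ⧸ (I ⊔ Ideal.span {x})) ≤ n) := by
  refine ⟨_, finite_setOf_prime_ringKrullDim_quotient_eq hI, fun p hp => hp.1, ?_, ?_⟩
  · rintro ⟨-, -, h2⟩
    have h3 : ringKrullDim (R ⧸ maximalIdeal R) = 0 :=
      ringKrullDim_eq_zero_of_field (ResidueField R)
    rw [h3] at h2
    have : 0 = n + 1 := by exact_mod_cast h2
    omega
  · exact fun x _ hxs => _root_.ringKrullDim_quotient_sup_span_le hI
      (fun p hp h1 h2 => hxs p ⟨hp, h1, h2⟩)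

lemma isSMulRegular [IsNoetherianRing R] {N : Type} [AddCommGroup N] [Module R N]
    [Module.Finite R N] (h : powTorsion (maximalIdeal R) N = ⊥) :
    HoldsGenerically (fun x : R => IsSMulRegular N x) :=
  ⟨associatedPrimes R N, associatedPrimes.finite R N, fun _ hp => hp.isPrime,
    maximalIdeal_notMem_associatedPrimes h, fun _ _ hx =>
      IsSMulRegular.of_forall_associatedPrimes hx⟩

variable {X : Type} [AddCommGroup X] [Module R X]

lemma pow_smul_le_smul_submodule [IsNoetherianRing R] [IsArtinian R X] (Z : Submodule R X) :
    HoldsGenerically (fun x : R => ∃ k, (maximalIdeal R) ^ k • Z ≤ x • Z) := by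
  induction Z using WellFoundedLT.induction with
  | _ Z ih =>
  by_cases hZ : ∃ Z₁ Z₂ : Submodule R X, Z₁ < Z ∧ Z₂ < Z ∧ Z₁ ⊔ Z₂ = Z
  · obtain ⟨Z₁, Z₂, h₁, h₂, h₁₂⟩ := hZ
    refine ((ih Z₁ h₁).and (ih Z₂ h₂)).mono ?_
    rintro x hx ⟨⟨k₁, hk₁⟩, k₂, hk₂⟩
    refine ⟨max k₁ k₂, ?_⟩
    rw [← h₁₂, Submodule.smul_sup', Submodule.smul_sup]
    exact sup_le_sup
      ((Submodule.smul_mono_left (Ideal.pow_le_pow_right (le_max_left _ _))).trans hk₁)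
      ((Submodule.smul_mono_left (Ideal.pow_le_pow_right (le_max_right _ _))).trans hk₂)
  have key : ∀ r : R, (∃ n, ∀ z ∈ Z, r ^ n • z = 0) ∨ ∀ z ∈ Z, ∃ w ∈ Z, r • w = z := by
    intro r
    obtain ⟨n, hn, hn0⟩ := ((LinearMap.eventually_codisjoint_ker_pow_range_pow
      (LinearMap.lsmul R Z r)).and (Filter.eventually_ge_atTop 1)).exists
    have hpow : ∀ z : Z, ((LinearMap.lsmul R Z r) ^ n) z = r ^ n • z := by
      intro z
      rw [Module.End.pow_apply]
      exact congrFun (smul_iterate r n) z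
    have h1 := congrArg (Submodule.map Z.subtype) hn.eq_top
    rw [Submodule.map_sup, Submodule.map_subtype_top] at h1
    have h2 := Submodule.map_subtype_le Z (LinearMap.ker ((LinearMap.lsmul R Z r) ^ n))
    have h3 := Submodule.map_subtype_le Z (LinearMap.range ((LinearMap.lsmul R Z r) ^ n))
    rcases h2.lt_or_eq with h2 | h2
    · rcases h3.lt_or_eq with h3 | h3
      · exact absurd ⟨_, _, h2, h3, h1⟩ hZ
      · refine Or.inr fun z hz => ?_
        rw [← h3] at hz
        obtain ⟨_, ⟨w, rfl⟩, rfl⟩ := hz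
        obtain ⟨m, rfl⟩ : ∃ m, n = m + 1 := ⟨n - 1, by omega⟩
        refine ⟨r ^ m • w, Z.smul_mem _ w.2, ?_⟩
        rw [smul_smul, ← pow_succ', Submodule.subtype_apply, hpow]
        rfl
    · refine Or.inl ⟨n, fun z hz => ?_⟩
      rw [← h2] at hz
      obtain ⟨w, hw, rfl⟩ := hz
      rw [SetLike.mem_coe, LinearMap.mem_ker, hpow] at hw
      exact congrArg Subtype.val hw
  by_cases hm : ∃ k, (maximalIdeal R) ^ k • Z = ⊥
  · obtain ⟨k, hk⟩ := hm
    exact of_forall fun x _ => ⟨k, hk ▸ bot_le⟩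
  let P : Ideal R := (Submodule.annihilator Z).radical
  have hP : P.IsPrime := by
    refine ⟨fun h => hm ⟨0, ?_⟩, fun {a b} hab => ?_⟩
    · rw [Ideal.radical_eq_top] at h
      rw [pow_zero, Ideal.one_eq_top, ← h, Submodule.annihilator_smul]
    · obtain ⟨n, hn⟩ := hab
      rcases key a with ⟨k, hk⟩ | ha
      · exact Or.inl ⟨k, Submodule.mem_annihilator.2 hk⟩
      · refine Or.inr ⟨n, Submodule.mem_annihilator.2 fun z hz => ?_⟩
        have : ∀ n : ℕ, ∃ w ∈ Z, a ^ n • w = z := by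
          intro n
          induction n with
          | zero => exact ⟨z, hz, by simp⟩
          | succ n ihn =>
            obtain ⟨w, hw, rfl⟩ := ihn
            obtain ⟨v, hv, rfl⟩ := ha w hw
            exact ⟨v, hv, by rw [smul_smul, pow_succ]⟩
        obtain ⟨w, hw, rfl⟩ := this n
        rw [smul_smul, ← mul_pow, mul_comm]
        exact Submodule.mem_annihilator.1 hn w hw
  refine ⟨{P}, Set.finite_singleton P, by simpa using hP, ?_, ?_⟩
  · intro h
    obtain ⟨k, hk⟩ := Ideal.exists_radical_pow_le_of_fg (Submodule.annihilator Z)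
      (IsNoetherian.noetherian _)
    refine hm ⟨k, ?_⟩
    rw [Set.mem_singleton_iff.1 h, eq_bot_iff, ← Submodule.annihilator_smul Z]
    exact Submodule.smul_mono_left hk
  · intro x _ hx
    have hxP : x ∉ P := hx P rfl
    refine ⟨0, fun z hz => ?_⟩
    rw [pow_zero, Ideal.one_eq_top, Submodule.top_smul] at hz
    rcases key x with ⟨k, hk⟩ | h
    · exact absurd ⟨k, Submodule.mem_annihilator.2 hk⟩ hxP
    · obtain ⟨w, hw, rfl⟩ := h z hz
      exact Submodule.smul_mem_pointwise_smul _ _ _ hw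

/-- A generic element acts surjectively on a cofinite submodule of an Artinian module. -/
lemma exists_surjective_smul [IsNoetherianRing R] [IsArtinian R X] :
    ∃ (Y : Submodule R X) (k : ℕ), (maximalIdeal R) ^ k ≤ Module.annihilator R (X ⧸ Y) ∧
      HoldsGenerically (fun x : R => ∀ y : Y, ∃ z : Y, x • z = y) := by
  obtain ⟨k, hk⟩ := IsArtinian.monotone_stabilizes (R := R) (M := X)
    ⟨fun n => OrderDual.toDual ((maximalIdeal R) ^ n • (⊤ : Submodule R X)), fun a b h =>
      Submodule.smul_mono_left (Ideal.pow_le_pow_right h)⟩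
  have hk' : ∀ n, k ≤ n → (maximalIdeal R) ^ k • (⊤ : Submodule R X) =
    (maximalIdeal R) ^ n • (⊤ : Submodule R X) := hk
  refine ⟨(maximalIdeal R) ^ k • ⊤, k, fun r hr => ?_,
    (pow_smul_le_smul_submodule ((maximalIdeal R) ^ k • (⊤ : Submodule R X))).mono ?_⟩
  · rw [Module.mem_annihilator]
    intro y
    obtain ⟨y, rfl⟩ := Submodule.mkQ_surjective _ y
    rw [← map_smul, Submodule.mkQ_apply, Submodule.Quotient.mk_eq_zero]
    exact Submodule.smul_mem_smul hr trivial
  · rintro x _ ⟨n, hn⟩ ⟨y, hy⟩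
    rw [← Submodule.mul_smul, ← pow_add, ← hk' (n + k) (by omega)] at hn
    obtain ⟨z, hz, rfl⟩ := hn hy
    exact ⟨⟨z, hz⟩, rfl⟩

end HoldsGenerically

end GenericElements

section GenericEulerCharacteristic

open Function

variable {R : Type} [CommRing R] {X : Type} [AddCommGroup X] [Module R X]

lemma EulerAdm.of_le {J : Ideal R} {xs : List R} {I : Ideal R}
    (h : IsNoetherian R X ∨ IsArtinian R X) (hI : I ≤ Module.annihilator R X)
    (hk : ∃ k, J ^ k ≤ I ⊔ Ideal.ofList xs) : EulerAdm J xs X := by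
  obtain ⟨k, hk⟩ := hk
  exact ⟨h, k, hk.trans (sup_le_sup_right hI _)⟩

lemma EulerAdditive.eq_submodule_add_quotient {J : Ideal R} {xs : List R}
    (hadd : EulerAdditive J xs) (Y : Submodule R X) (hX : EulerAdm J xs X) :
    eulerChar R xs X = eulerChar R xs Y + eulerChar R xs (X ⧸ Y) :=
  hadd Y.subtype Y.mkQ (Submodule.subtype_injective Y) (LinearMap.exact_subtype_mkQ Y)
    (Submodule.mkQ_surjective Y) hX

lemma mem_annihilator_torsionBy (x : R) :
    x ∈ Module.annihilator R (Submodule.torsionBy R X x) := by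
  rw [Module.mem_annihilator]
  rintro ⟨m, hm⟩
  ext
  simpa using hm

lemma eulerChar_cons_eq_neg_torsionBy {x : R} {xs : List R} (h : ∀ y : X, ∃ z : X, x • z = y) :
    eulerChar R (x :: xs) X = - eulerChar R xs (Submodule.torsionBy R X x) := by
  have : Subsingleton (QuotSMulTop x X) := by
    rw [Submodule.Quotient.subsingleton_iff, eq_top_iff]
    intro y _
    obtain ⟨z, rfl⟩ := h y
    exact Submodule.smul_mem_pointwise_smul _ _ _ trivial
  rw [eulerChar, eulerChar_eq_zero_of_subsingleton xs (QuotSMulTop x X), zero_sub]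

variable [IsNoetherianRing R] [IsLocalRing R]

/-- Reduction of the Euler characteristic of an Artinian module modulo a generic element. -/
lemma HoldsGenerically.eulerChar_cons_artinian [IsArtinian R X] :
    HoldsGenerically (fun x : R => ∃ Y : Submodule R X, ∀ xs : List R,
      (∀ y ∈ xs, y ∈ maximalIdeal R) → EulerAdm (maximalIdeal R) (x :: xs) X →
      eulerChar R (x :: xs) X = - eulerChar R xs (Submodule.torsionBy R Y x)) := by
  obtain ⟨Y, k, hk, hY⟩ := HoldsGenerically.exists_surjective_smul (R := R) (X := X)
  refine hY.mono fun x hx hxY => ⟨Y, fun xs hxs hadm => ?_⟩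
  have hadd : EulerAdditive (maximalIdeal R) (x :: xs) := eulerAdditive (maximalIdeal.isMaximal R) _
  rw [hadd.eq_submodule_add_quotient Y hadm, eulerChar_eq_zero_of_pow_le_annihilator hadd (by simp)
    (by simpa using ⟨hx, hxs⟩) (hadm.of_surjective (Y := X ⧸ Y) Y.mkQ (Submodule.mkQ_surjective Y))
    hk, add_zero, eulerChar_cons_eq_neg_torsionBy hxY]

/-- The data for reducing the comparison of Euler characteristics of a module and of its top local
cohomology modulo a generic element. -/
lemma HoldsGenerically.eulerChar_locCoh_step [Module.Finite R X] {I : Ideal R} {d : ℕ}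
    (hI : I ≤ Module.annihilator R X) (hdim : ringKrullDim (R ⧸ I) ≤ (d + 1 : ℕ)) :
    HoldsGenerically (fun x : R => ringKrullDim (R ⧸ (I ⊔ Ideal.span {x})) ≤ d ∧
      ∀ xs : List R, xs.length = d → (∀ y ∈ xs, y ∈ maximalIdeal R) →
      (∃ k, (maximalIdeal R) ^ k ≤ (I ⊔ Ideal.span {x}) ⊔ Ideal.ofList xs) →
      eulerChar R (x :: xs) X =
        eulerChar R xs (QuotSMulTop x (X ⧸ powTorsion (maximalIdeal R) X)) ∧
      eulerChar R (x :: xs) (LocCoh (maximalIdeal R) (d + 1) X) =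
        - eulerChar R xs (LocCoh (maximalIdeal R) d
          (QuotSMulTop x (X ⧸ powTorsion (maximalIdeal R) X)))) := by
  let m := maximalIdeal R
  let T := powTorsion m X
  let N := X ⧸ T
  have hm := maximalIdeal.isMaximal R
  have hN : powTorsion m N = ⊥ := powTorsion_quotient_powTorsion
  have hIN : I ≤ Module.annihilator R N :=
    hI.trans (LinearMap.annihilator_le_of_surjective _ (Submodule.mkQ_surjective _))
  have hart := LocCoh.isArtinian (R := R) d N
  refine (((HoldsGenerically.ringKrullDim_quotient_sup_span_le hdim).and
    (HoldsGenerically.isSMulRegular hN)).and (HoldsGenerically.pow_smul_le_smul_submodule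
      (⊤ : Submodule R (LocCoh m d N)))).mono ?_
  rintro x hx ⟨⟨hdim', hxN⟩, k, hk⟩
  refine ⟨hdim', fun xs hlen hxs hadm => ⟨?_, ?_⟩⟩
  · have hadd : EulerAdditive m (x :: xs) := eulerAdditive hm _
    have hadm' : ∃ k, (maximalIdeal R) ^ k ≤ I ⊔ Ideal.ofList (x :: xs) := by
      rwa [Ideal.ofList_cons, ← sup_assoc]
    have hX : EulerAdm m (x :: xs) X := .of_le (Or.inl inferInstance) hI hadm'
    obtain ⟨n, hn⟩ := (isPowTorsion_powTorsion (J := m) (X := X)).exists_pow_le_annihilator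
    rw [hadd.eq_submodule_add_quotient T hX, eulerChar_eq_zero_of_pow_le_annihilator hadd (by simp)
      (by simpa using ⟨hx, hxs⟩)
      (hX.of_injective (X := T) T.subtype (Submodule.subtype_injective T)) hn, zero_add, eulerChar]
    have : Subsingleton (Submodule.torsionBy R N x) := by
      rw [Submodule.subsingleton_iff_eq_bot, eq_bot_iff]
      intro y hy
      exact hxN (by simpa using hy)
    rw [eulerChar_eq_zero_of_subsingleton xs (Submodule.torsionBy R N x), sub_zero]
  · have hadd : EulerAdditive m xs := eulerAdditive hm xs
    rw [eulerChar_congr (x :: xs) (LinearEquiv.ofBijective _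
      (LocCoh.map_mkQ_powTorsion_bijective (J := m) (X := X) d))]
    have hIQ := sup_span_le_annihilator_quotSMulTop hIN x
    have hvan := LocCoh.subsingleton_of_ringKrullDim_lt d _ (QuotSMulTop x N) hIQ hdim' (d + 1)
      (by omega)
    have hex₁ := LocCoh.exact_map_map m d (injective_smul_id hxN) (exact_smul_id_mkQ x)
      (Submodule.mkQ_surjective _)
    have hex₂ := LocCoh.exact_map_δ m d (injective_smul_id hxN) (exact_smul_id_mkQ x)
      (Submodule.mkQ_surjective _)
    have hex₃ := LocCoh.exact_δ_map m d (injective_smul_id hxN) (exact_smul_id_mkQ x)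
      (Submodule.mkQ_surjective _)
    have hex₄ := LocCoh.exact_map_map m (d + 1) (injective_smul_id hxN) (exact_smul_id_mkQ x)
      (Submodule.mkQ_surjective _)
    let π : LocCoh m d N →ₗ[R] LocCoh m d (QuotSMulTop x N) :=
      LocCoh.map m d (Submodule.mkQ (x • (⊤ : Submodule R N)))
    let δ : LocCoh m d (QuotSMulTop x N) →ₗ[R] LocCoh m (d + 1) N :=
      LocCoh.δ m d (injective_smul_id hxN) (exact_smul_id_mkQ x) (Submodule.mkQ_surjective _)
    have hQ : EulerAdm m xs (LocCoh m d (QuotSMulTop x N)) :=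
      .of_le (Or.inr (LocCoh.isArtinian d _)) (hIQ.trans (LocCoh.annihilator_le m d)) hadm
    rw [eulerChar_cons_eq_neg_torsionBy, hadd.eq_ker_add_range δ hQ,
      ← eulerChar_range_eq_ker (f := π) (g := δ) hex₂]
    · have hrange : LinearMap.range δ =
          Submodule.torsionBy R (LocCoh m (d + 1) N) x := by
        ext z
        rw [Submodule.mem_torsionBy_iff, ← LocCoh.map_smul_id_apply m (d + 1) x z]
        exact (hex₃ z).symm
      have hπ : eulerChar R xs (LinearMap.range π) = 0 := by
        have hk' : m ^ k ≤ Module.annihilator R (LinearMap.range π) := by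
          intro r hr
          rw [Module.mem_annihilator]
          rintro ⟨_, z, rfl⟩
          refine Subtype.ext ?_
          change r • π z = 0
          obtain ⟨w, -, hw⟩ := hk (Submodule.smul_mem_smul hr (trivial : z ∈ ⊤))
          rw [← map_smul, ← hw]
          change π (x • w) = 0
          rw [← LocCoh.map_smul_id_apply m d x w]
          exact hex₁.apply_apply_eq_zero w
        rcases d with _ | d
        · have hN0 : Subsingleton (LocCoh m 0 N) := by
            refine ⟨fun a b => LocCoh.eval_injective m ?_⟩
            have h0 : ∀ a, LocCoh.eval m (X := N) a = 0 := fun a => by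
              have := LinearMap.mem_range_self (LocCoh.eval m (X := N)) a
              rw [LocCoh.range_eval] at this
              rwa [hN] at this
            rw [h0, h0]
          have : Subsingleton (LinearMap.range π) :=
            π.surjective_rangeRestrict.subsingleton
          exact eulerChar_eq_zero_of_subsingleton xs _
        · exact eulerChar_eq_zero_of_pow_le_annihilator hadd
            (by rintro rfl; simp at hlen) hxs
            (hQ.of_injective (LinearMap.range π).subtype (Submodule.subtype_injective _)) hk'
      rw [hπ, zero_add, hrange]
    · intro y
      obtain ⟨z, rfl⟩ := (hex₄ y).1 (Subsingleton.elim _ _)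
      exact ⟨z, (LocCoh.map_smul_id_apply m (d + 1) x z).symm⟩

/-- Euler characteristics with respect to a generic sequence: comparison between modules of
dimension at most `d` and their top local cohomology, and positivity for Artinian modules. -/
theorem exists_eulerChar_locCoh (d : ℕ) : ∀ {ι κ : Type} [Finite ι] [Finite κ]
    (I : ι → Ideal R) (N : ι → Type) [∀ j, AddCommGroup (N j)] [∀ j, Module R (N j)]
    [∀ j, Module.Finite R (N j)] (I' : κ → Ideal R) (X : κ → Type) [∀ l, AddCommGroup (X l)]
    [∀ l, Module R (X l)] [∀ l, IsArtinian R (X l)],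
    (∀ j, I j ≤ Module.annihilator R (N j)) → (∀ j, ringKrullDim (R ⧸ I j) ≤ d) →
    (∀ l, I' l ≤ Module.annihilator R (X l)) → (∀ l, ringKrullDim (R ⧸ I' l) ≤ d) →
    ∃ xs : List R, xs.length = d ∧ (∀ x ∈ xs, x ∈ maximalIdeal R) ∧
      (∀ j, (∃ k, (maximalIdeal R) ^ k ≤ I j ⊔ Ideal.ofList xs) ∧
        eulerChar R xs (LocCoh (maximalIdeal R) d (N j)) = (-1) ^ d * eulerChar R xs (N j)) ∧
      (∀ l, (∃ k, (maximalIdeal R) ^ k ≤ I' l ⊔ Ideal.ofList xs) ∧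
        0 ≤ (-1) ^ d * eulerChar R xs (X l)) := by
  induction d with
  | zero =>
    intro ι κ _ _ I N _ _ _ I' X _ _ _ hI hdim hI' hdim'
    refine ⟨[], rfl, by simp, fun j => ?_, fun l => ?_⟩
    · obtain ⟨k, hk⟩ := exists_maximalIdeal_pow_le_of_ringKrullDim_quotient_le_zero (hdim j)
      refine ⟨⟨k, by simpa using hk⟩, ?_⟩
      rw [pow_zero, one_mul]
      exact eulerChar_congr [] (LinearEquiv.ofBijective _
        (LocCoh.eval_bijective (isPowTorsion_of_pow_le_annihilator (hk.trans (hI j)))))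
    · obtain ⟨k, hk⟩ := exists_maximalIdeal_pow_le_of_ringKrullDim_quotient_le_zero (hdim' l)
      exact ⟨⟨k, by simpa using hk⟩, by simp [eulerChar]⟩
  | succ d ih =>
    intro ι κ _ _ I N _ _ _ I' X _ _ _ hI hdim hI' hdim'
    obtain ⟨x, hx, h₁, h₂⟩ := ((HoldsGenerically.forall_finite fun j =>
      HoldsGenerically.eulerChar_locCoh_step (hI j) (hdim j)).and
      (HoldsGenerically.forall_finite fun l =>
      (HoldsGenerically.eulerChar_cons_artinian (R := R) (X := X l)).and
        (HoldsGenerically.ringKrullDim_quotient_sup_span_le (hdim' l)))).exists_mem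
    choose Y hY using fun l => (h₂ l).1
    obtain ⟨xs, hlen, hxs, h₃, h₄⟩ := ih (fun j => I j ⊔ Ideal.span {x})
      (fun j => QuotSMulTop x (N j ⧸ powTorsion (maximalIdeal R) (N j)))
      (fun l => I' l ⊔ Ideal.span {x}) (fun l => Submodule.torsionBy R (Y l) x)
      (fun j => sup_span_le_annihilator_quotSMulTop ((hI j).trans
        (LinearMap.annihilator_le_of_surjective _ (Submodule.mkQ_surjective _))) x)
      (fun j => (h₁ j).1)
      (fun l => sup_le (((hI' l).trans (LinearMap.annihilator_le_of_injective _
          (Submodule.subtype_injective (Y l)))).trans (LinearMap.annihilator_le_of_injective _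
          (Submodule.subtype_injective (Submodule.torsionBy R (Y l) x))))
        (by simpa [Ideal.span_le] using mem_annihilator_torsionBy x))
      (fun l => (h₂ l).2)
    have hassoc : ∀ I : Ideal R, I ⊔ Ideal.ofList (x :: xs) =
        (I ⊔ Ideal.span {x}) ⊔ Ideal.ofList xs := fun I => by
      rw [Ideal.ofList_cons, ← sup_assoc]
    refine ⟨x :: xs, by simp [hlen], by simpa using ⟨hx, hxs⟩, fun j => ⟨?_, ?_⟩,
      fun l => ⟨?_, ?_⟩⟩
    · rw [hassoc]; exact (h₃ j).1
    · obtain ⟨e₁, e₂⟩ := (h₁ j).2 xs hlen hxs (h₃ j).1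
      rw [e₁, e₂, (h₃ j).2, pow_succ]
      ring
    · rw [hassoc]; exact (h₄ l).1
    · rw [hY l xs hxs (.of_le (Or.inr inferInstance) (hI' l) (by rw [hassoc]; exact (h₄ l).1))]
      have := (h₄ l).2
      rw [pow_succ]
      linarith

end GenericEulerCharacteristic

section DerivedExt

variable {R : Type} [CommRing R]

noncomputable section

/-- The complex computing `Ext (X, Y)` from a projective resolution of `X`, in the opposite
category of modules. -/
abbrev extComplex {X : ModuleCat.{0} R} (P : ProjectiveResolution X) (Y : ModuleCat.{0} R) :
    ChainComplex (ModuleCat.{0} R)ᵒᵖ ℕ :=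
  (((linearYoneda R (ModuleCat.{0} R)).obj Y).rightOp.mapHomologicalComplex _).obj P.complex

/-- The inclusion of the cocycles in the cochains. -/
def extCocycleι {X : ModuleCat.{0} R} (P : ProjectiveResolution X) (Y : ModuleCat.{0} R) (n : ℕ) :
    ((extComplex P Y).opcycles n).unop →ₗ[R] (P.complex.X n ⟶ Y) :=
  ((extComplex P Y).pOpcycles n).unop.hom

/-- The projection from the cocycles to `Ext`. -/
def extCocycleπ {X : ModuleCat.{0} R} (P : ProjectiveResolution X) (Y : ModuleCat.{0} R) (n : ℕ) :
    ((extComplex P Y).opcycles n).unop →ₗ[R]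
      ((Ext R (ModuleCat.{0} R) n).obj (Opposite.op X)).obj Y :=
  (((extComplex P Y).homologyι n).unop ≫
    (P.isoLeftDerivedObj ((linearYoneda R (ModuleCat.{0} R)).obj Y).rightOp n).hom.unop).hom

variable {X : ModuleCat.{0} R} (P : ProjectiveResolution X) (Y : ModuleCat.{0} R) (n : ℕ)

theorem extCocycleι_injective : Function.Injective (extCocycleι P Y n) :=
  (ModuleCat.mono_iff_injective _).1 inferInstance

theorem extCocycleπ_surjective : Function.Surjective (extCocycleπ P Y n) := by
  have h1 : Function.Surjective ((extComplex P Y).homologyι n).unop.hom :=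
    (ModuleCat.epi_iff_surjective _).1 inferInstance
  have h2 : Function.Surjective
      (P.isoLeftDerivedObj ((linearYoneda R (ModuleCat.{0} R)).obj Y).rightOp n).hom.unop.hom :=
    (ModuleCat.epi_iff_surjective _).1 inferInstance
  exact h2.comp h1

theorem exists_extCocycleι_eq {f : P.complex.X n ⟶ Y} (hf : P.complex.d (n + 1) n ≫ f = 0) :
    ∃ z, extCocycleι P Y n z = f := by
  have h := (ShortComplex.exact_of_g_is_cokernel
    (ShortComplex.mk _ _ ((extComplex P Y).d_pOpcycles (n + 1) n))
    ((extComplex P Y).opcyclesIsCokernel (n + 1) n (by simp))).unop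
  exact (ShortComplex.moduleCat_exact_iff _).1 h f hf

theorem d_comp_extCocycleι (z) : P.complex.d (n + 1) n ≫ extCocycleι P Y n z = 0 := by
  have := congrArg (fun g => g.unop.hom z) ((extComplex P Y).d_pOpcycles (n + 1) n)
  exact this

theorem extCocycleπ_eq_zero_iff (m : ℕ) (hm : (ComplexShape.down ℕ).next n = m) (z) :
    extCocycleπ P Y n z = 0 ↔
      ∃ g : P.complex.X m ⟶ Y, P.complex.d n m ≫ g = extCocycleι P Y n z := by
  have h := (ShortComplex.exact_of_f_is_kernel
    (ShortComplex.mk _ _ ((extComplex P Y).homologyι_comp_fromOpcycles n m))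
    ((extComplex P Y).homologyIsKernel n m hm)).unop
  have h1 : ∀ g : P.complex.X m ⟶ Y,
      extCocycleι P Y n (((extComplex P Y).fromOpcycles n m).unop.hom g) = P.complex.d n m ≫ g :=
    fun g => congrArg (fun u => u.unop.hom g) ((extComplex P Y).p_fromOpcycles n m)
  have h2 : extCocycleπ P Y n z = 0 ↔ ((extComplex P Y).homologyι n).unop.hom z = 0 := by
    have hinj : Function.Injective
      (P.isoLeftDerivedObj ((linearYoneda R (ModuleCat.{0} R)).obj Y).rightOp n).hom.unop.hom :=
      (ModuleCat.mono_iff_injective _).1 inferInstance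
    exact map_eq_zero_iff _ hinj
  rw [h2]
  constructor
  · intro hz
    obtain ⟨g, hg⟩ := (ShortComplex.moduleCat_exact_iff _).1 h z hz
    exact ⟨g, (h1 g).symm.trans (congrArg _ hg)⟩
  · rintro ⟨g, hg⟩
    rw [← h1] at hg
    rw [← extCocycleι_injective P Y n hg]
    exact congrArg (fun u => u.unop.hom g) ((extComplex P Y).homologyι_comp_fromOpcycles n m)

/-- The map induced on cocycles by a morphism of projective resolutions. -/
def extCocycleMap {X' : ModuleCat.{0} R} {P : ProjectiveResolution X}
    {Q : ProjectiveResolution X'} {f : X ⟶ X'} (φ : ProjectiveResolution.Hom P Q f) :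
    ((extComplex Q Y).opcycles n).unop →ₗ[R] ((extComplex P Y).opcycles n).unop :=
  (HomologicalComplex.opcyclesMap
    ((((linearYoneda R (ModuleCat.{0} R)).obj Y).rightOp.mapHomologicalComplex _).map φ.hom)
      n).unop.hom

theorem extCocycleι_map {X' : ModuleCat.{0} R} {P : ProjectiveResolution X}
    {Q : ProjectiveResolution X'} {f : X ⟶ X'} (φ : ProjectiveResolution.Hom P Q f) (z) :
    extCocycleι P Y n (extCocycleMap Y n φ z) = φ.hom.f n ≫ extCocycleι Q Y n z :=
  congrArg (fun u => u.unop.hom z) (HomologicalComplex.p_opcyclesMap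
    ((((linearYoneda R (ModuleCat.{0} R)).obj Y).rightOp.mapHomologicalComplex _).map φ.hom) n)

theorem extCocycleπ_map {X' : ModuleCat.{0} R} {P : ProjectiveResolution X}
    {Q : ProjectiveResolution X'} {f : X ⟶ X'} (φ : ProjectiveResolution.Hom P Q f) (z) :
    extCocycleπ P Y n (extCocycleMap Y n φ z) =
      (((Ext R (ModuleCat.{0} R) n).map f.op).app Y).hom (extCocycleπ Q Y n z) := by
  have h1 := congrArg (fun u => u.unop.hom z) (HomologicalComplex.homologyι_naturality
    ((((linearYoneda R (ModuleCat.{0} R)).obj Y).rightOp.mapHomologicalComplex _).map φ.hom) n)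
  have h2 := congrArg (fun u => u.unop.hom (((extComplex Q Y).homologyι n).unop.hom z))
    (ProjectiveResolution.isoLeftDerivedObj_hom_naturality f P Q φ.hom
      (by simpa using φ.hom_f_zero_comp_π_f_zero)
      ((linearYoneda R (ModuleCat.{0} R)).obj Y).rightOp n)
  refine Eq.trans ?_ h2.symm
  exact congrArg ((P.isoLeftDerivedObj
    ((linearYoneda R (ModuleCat.{0} R)).obj Y).rightOp n).hom.unop.hom) h1.symm

theorem extMk_eq_zero_iff' (f : P.complex.X n ⟶ Y) (hf : P.complex.d (n + 1) n ≫ f = 0)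
    (m : ℕ) (hm : (ComplexShape.down ℕ).next n = m) :
    P.extMk f (n + 1) rfl hf = 0 ↔ ∃ g : P.complex.X m ⟶ Y, P.complex.d n m ≫ g = f := by
  cases n with
  | succ n =>
    obtain rfl : n = m := by simpa using hm
    exact P.extMk_eq_zero_iff f _ rfl hf _ rfl
  | zero =>
    obtain rfl : 0 = m := by simpa using hm
    have hd : P.complex.d 0 0 = 0 := P.complex.shape _ _ (by simp)
    simp only [hd, Limits.zero_comp, exists_const]
    rw [← P.extEquivCohomologyClass.apply_eq_iff_eq]
    simp only [ProjectiveResolution.extEquivCohomologyClass_extMk,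
      ProjectiveResolution.extEquivCohomologyClass_zero,
      CochainComplex.HomComplex.CohomologyClass.mk_eq_zero_iff]
    rw [CochainComplex.HomComplex.Cocycle.toSingleMk_mem_coboundaries_iff _ _ _ _ _ 1 (by lia)]
    have hz : Limits.IsZero (P.cochainComplex.X 1) :=
      P.cochainComplex.isZero_of_isStrictlyLE 0 1 (by simp)
    constructor
    · rintro ⟨g, hg⟩
      rw [hz.eq_of_src g 0, Limits.comp_zero] at hg
      have := (cancel_epi (P.cochainComplexXIso (-((0 : ℕ) : ℤ)) 0 rfl).hom).1
        (hg.symm.trans Limits.comp_zero.symm)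
      exact this.symm
    · rintro rfl
      exact ⟨0, by simp⟩

end

end DerivedExt

section LocalCohomologyComparison

variable {R : Type} [CommRing R]

noncomputable section

variable {X : ModuleCat.{0} R} (P : ProjectiveResolution X) (Y : ModuleCat.{0} R) (n : ℕ)

theorem extMk_smul (r : R) (f : P.complex.X n ⟶ Y) (hf : P.complex.d (n + 1) n ≫ f = 0)
    (hf' : P.complex.d (n + 1) n ≫ (r • f) = 0) :
    P.extMk (r • f) (n + 1) rfl hf' = r • P.extMk f (n + 1) rfl hf := by
  have h := P.extMk_comp_mk₀ f (n + 1) rfl hf (r • 𝟙 Y)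
  rw [Abelian.Ext.mk₀_smul, Abelian.Ext.comp_smul, Abelian.Ext.comp_mk₀_id] at h
  rw [h]
  simp only [Linear.comp_smul, Category.comp_id]

/-- The map from cocycles to the `Ext` groups defined using the derived category. -/
def extCocycleMk :
    ((extComplex P Y).opcycles n).unop →ₗ[R] Abelian.Ext X Y n where
  toFun z := P.extMk (extCocycleι P Y n z) (n + 1) rfl (d_comp_extCocycleι P Y n z)
  map_add' z w := by
    rw [P.add_extMk]
    congr 1
    rw [map_add]
  map_smul' r z := by
    rw [RingHom.id_apply, ← extMk_smul]
    · congr 1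
      rw [map_smul]
    · rw [Linear.comp_smul, d_comp_extCocycleι, smul_zero]

theorem extCocycleMk_surjective : Function.Surjective (extCocycleMk P Y n) := by
  intro e
  obtain ⟨f, hf, rfl⟩ := P.extMk_surjective e (n + 1) rfl
  obtain ⟨z, rfl⟩ := exists_extCocycleι_eq P Y n hf
  exact ⟨z, rfl⟩

theorem ker_extCocycleMk :
    LinearMap.ker (extCocycleMk P Y n) = LinearMap.ker (extCocycleπ P Y n) := by
  ext z
  rw [LinearMap.mem_ker, LinearMap.mem_ker, extCocycleπ_eq_zero_iff P Y n _ rfl]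
  exact extMk_eq_zero_iff' P Y n _ (d_comp_extCocycleι P Y n z) _ rfl

/-- The derived functors of `Hom` agree with the `Ext` groups defined using the derived
category. -/
def extEquiv : ((Ext R (ModuleCat.{0} R) n).obj (Opposite.op X)).obj Y ≃ₗ[R] Abelian.Ext X Y n :=
  ((extCocycleπ P Y n).quotKerEquivOfSurjective (extCocycleπ_surjective P Y n)).symm.trans
    ((Submodule.quotEquivOfEq _ _ (ker_extCocycleMk P Y n).symm).trans
      ((extCocycleMk P Y n).quotKerEquivOfSurjective (extCocycleMk_surjective P Y n)))

theorem extEquiv_extCocycleπ (z) : extEquiv P Y n (extCocycleπ P Y n z) = extCocycleMk P Y n z := by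
  simp only [extEquiv, LinearEquiv.trans_apply]
  rw [LinearMap.quotKerEquivOfSurjective_symm_apply]
  rfl

theorem extEquiv_map {X' : ModuleCat.{0} R} (Q : ProjectiveResolution X') (f : X ⟶ X')
    (h : ((Ext R (ModuleCat.{0} R) n).obj (Opposite.op X')).obj Y) :
    extEquiv P Y n ((((Ext R (ModuleCat.{0} R) n).map f.op).app Y).hom h) =
      (Abelian.Ext.mk₀ f).comp (extEquiv Q Y n h) (zero_add n) := by
  obtain ⟨z, rfl⟩ := extCocycleπ_surjective Q Y n h
  let φ : ProjectiveResolution.Hom P Q f :=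
    { hom := ProjectiveResolution.lift f P Q
      hom_f_zero_comp_π_f_zero := ProjectiveResolution.lift_commutes_zero f P Q }
  rw [← extCocycleπ_map Y n φ, extEquiv_extCocycleπ, extEquiv_extCocycleπ]
  refine Eq.trans ?_ (ProjectiveResolution.mk₀_comp_extMk (extCocycleι Q Y n z) _ rfl
    (d_comp_extCocycleι Q Y n z) φ).symm
  change P.extMk (extCocycleι P Y n (extCocycleMap Y n φ z)) _ rfl
    (d_comp_extCocycleι P Y n _) = _
  congr 1
  exact extCocycleι_map Y n φ z

namespace LocCoh

open Opposite

variable (J : Ideal R) (i : ℕ) (M : Type) [AddCommGroup M] [Module R M]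

/-- The comparison map from `Ext (R / J ^ n, M)` to local cohomology. -/
def ofDerived (n : ℕ) : ((Ext R (ModuleCat.{0} R) i).obj
      (op (ModuleCat.of R (R ⧸ J ^ n)))).obj (ModuleCat.of R M) →ₗ[R] LocCoh J i M :=
  Module.DirectLimit.of R ℕ _ _ n ∘ₗ (extEquiv (projectiveResolution (ModuleCat.of R (R ⧸ J ^ n)))
    (ModuleCat.of R M) i).toLinearMap

theorem ofDerived_apply (n : ℕ) (x) : ofDerived J i M n x =
    of J n (extEquiv (projectiveResolution (ModuleCat.of R (R ⧸ J ^ n)))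
      (ModuleCat.of R M) i x) := rfl

theorem ofDerived_map {m n : ℕ} (h : m ≤ n) (x) :
    ofDerived J i M n ((((Ext R (ModuleCat.{0} R) i).map (quotPowMap J m n h).op).app
      (ModuleCat.of R M)).hom x) = ofDerived J i M m x := by
  rw [ofDerived_apply, extEquiv_map _ _ _ (projectiveResolution (ModuleCat.of R (R ⧸ J ^ m)))]
  exact of_trans m n h _

/-- The diagram of derived functors whose colimit is local cohomology. -/
abbrev derivedDiagram : ℕᵒᵖᵒᵖ ⥤ ModuleCat.{0} R :=
  localCohomology.diagram (localCohomology.idealPowersDiagram J) i ⋙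
    (evaluation _ _).obj (ModuleCat.of R M)

/-- The local cohomology modules as a cocone over the diagram of derived functors. -/
def derivedCocone : Limits.Cocone (derivedDiagram J i M) where
  pt := ModuleCat.of R (LocCoh J i M)
  ι :=
    { app := fun n => ModuleCat.ofHom (ofDerived J i M n.unop.unop)
      naturality := fun m n f => by
        refine ModuleCat.hom_ext (LinearMap.ext fun x => ?_)
        exact ofDerived_map J i M f.unop.unop.down.down x }

/-- A component of `LocCoh.derivedDesc`. -/
def derivedDescAux (s : Limits.Cocone (derivedDiagram J i M)) (n : ℕ) :
    Abelian.Ext (ModuleCat.of R (R ⧸ J ^ n)) (ModuleCat.of R M) i →ₗ[R] s.pt where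
  toFun e := (s.ι.app (op (op n))).hom
    ((extEquiv (projectiveResolution (ModuleCat.of R (R ⧸ J ^ n))) (ModuleCat.of R M) i).symm e)
  map_add' e e' := by rw [map_add]; exact map_add _ _ _
  map_smul' r e := by rw [map_smul]; exact map_smul _ _ _

theorem derivedDescAux_extEquiv (s : Limits.Cocone (derivedDiagram J i M)) (n : ℕ) (x) :
    derivedDescAux J i M s n (extEquiv (projectiveResolution (ModuleCat.of R (R ⧸ J ^ n)))
      (ModuleCat.of R M) i x) = (s.ι.app (op (op n))).hom x :=
  congrArg (s.ι.app (op (op n))).hom (LinearEquiv.symm_apply_apply _ x)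

/-- The map out of local cohomology induced by a cocone over the diagram of derived functors. -/
def derivedDesc (s : Limits.Cocone (derivedDiagram J i M)) : LocCoh J i M →ₗ[R] s.pt :=
  Module.DirectLimit.lift R ℕ _ _ (derivedDescAux J i M s)
    (fun m n h e => by
      obtain ⟨x, rfl⟩ := (extEquiv (projectiveResolution (ModuleCat.of R (R ⧸ J ^ m)))
        (ModuleCat.of R M) i).surjective e
      rw [locCohTrans_apply, ← extEquiv_map (projectiveResolution (ModuleCat.of R (R ⧸ J ^ n))),
        derivedDescAux_extEquiv, derivedDescAux_extEquiv]
      exact congrArg (fun g => g.hom x) (s.w (j := op (op n)) (j' := op (op m))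
        (homOfLE h).op.op))

theorem derivedDesc_ofDerived (s : Limits.Cocone (derivedDiagram J i M)) (n : ℕ) (x) :
    derivedDesc J i M s (ofDerived J i M n x) = (s.ι.app (op (op n))).hom x :=
  (Module.DirectLimit.lift_of _ _ _).trans (derivedDescAux_extEquiv J i M s n x)

/-- Local cohomology is the colimit of the diagram of derived functors. -/
def derivedIsColimit : Limits.IsColimit (derivedCocone J i M) where
  desc s := ModuleCat.ofHom (derivedDesc J i M s)
  fac s n := ModuleCat.hom_ext (LinearMap.ext fun x =>
    derivedDesc_ofDerived J i M s n.unop.unop x)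
  uniq s g hg := by
    refine ModuleCat.hom_ext (LinearMap.ext fun z => ?_)
    obtain ⟨n, e, rfl⟩ := exists_of z
    obtain ⟨x, rfl⟩ := (extEquiv (projectiveResolution (ModuleCat.of R (R ⧸ J ^ n)))
        (ModuleCat.of R M) i).surjective e
    have h := (congrArg (fun u => u.hom x) (hg (op (op n)))).trans
      (derivedDesc_ofDerived J i M s n x).symm
    exact h

/-- The comparison of the two definitions of local cohomology. -/
theorem nonempty_linearEquiv_localCohomology :
    Nonempty (LocCoh J i M ≃ₗ[R] ((localCohomology J i).obj (ModuleCat.of R M) : Type)) := by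
  have h := Limits.isColimitOfPreserves ((evaluation _ _).obj (ModuleCat.of R M))
    (Limits.colimit.isColimit
      (localCohomology.diagram (localCohomology.idealPowersDiagram J) i))
  exact ⟨((derivedIsColimit J i M).coconePointUniqueUpToIso h).toLinearEquiv⟩

end LocCoh

end

end LocalCohomologyComparison

section MatlisDual

open Function

variable {R : Type} [CommRing R]
  {E : Type} [AddCommGroup E] [Module R E] {X Y Z : Type} [AddCommGroup X] [Module R X]
  [AddCommGroup Y] [Module R Y] [AddCommGroup Z] [Module R Z]

lemma LinearMap.lcomp_injective {f : X →ₗ[R] Y} (hf : Surjective f) :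
    Injective (LinearMap.lcomp R E f) :=
  fun _ _ h => (LinearMap.cancel_right hf).mp h

/-- The Matlis dual of `X ⧸ xX` is the `x`-torsion of the Matlis dual of `X`. -/
noncomputable def dualQuotSMulTopEquiv (E : Type) [AddCommGroup E] [Module R E] (x : R) :
    (QuotSMulTop x X →ₗ[R] E) ≃ₗ[R] Submodule.torsionBy R (X →ₗ[R] E) x := by
  refine LinearEquiv.ofBijective ((LinearMap.lcomp R E
    (x • (⊤ : Submodule R X)).mkQ).codRestrict _ ?_) ⟨?_, ?_⟩
  · intro h
    rw [Submodule.mem_torsionBy_iff]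
    ext y
    simp only [LinearMap.smul_apply, LinearMap.lcomp_apply, ← map_smul, LinearMap.zero_apply]
    rw [Submodule.mkQ_apply, (Submodule.Quotient.mk_eq_zero _).mpr
      (Submodule.smul_mem_pointwise_smul _ _ _ Submodule.mem_top), map_zero]
  · intro g h hgh
    exact LinearMap.lcomp_injective (Submodule.mkQ_surjective _) (congrArg Subtype.val hgh)
  · rintro ⟨h, hh⟩
    rw [Submodule.mem_torsionBy_iff] at hh
    refine ⟨(x • (⊤ : Submodule R X)).liftQ h ?_, Subtype.ext (LinearMap.ext fun y => rfl)⟩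
    rintro _ ⟨y, -, rfl⟩
    have := LinearMap.congr_fun hh y
    simpa using this

namespace IsInjHull

lemma exists_extension {J : Ideal R} (hE : IsInjHull R J E) {f : X →ₗ[R] Y} (hf : Injective f)
    (g : X →ₗ[R] E) : ∃ h : Y →ₗ[R] E, h ∘ₗ f = g := by
  obtain ⟨h, hh⟩ := hE.1.out f hf g
  exact ⟨h, LinearMap.ext hh⟩

lemma lcomp_surjective {J : Ideal R} (hE : IsInjHull R J E) {f : X →ₗ[R] Y} (hf : Injective f) :
    Surjective (LinearMap.lcomp R E f) :=
  fun g => hE.exists_extension hf g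

lemma exact_lcomp {J : Ideal R} (hE : IsInjHull R J E) {f : X →ₗ[R] Y} {g : Y →ₗ[R] Z}
    (h : Exact f g) : Exact (LinearMap.lcomp R E g) (LinearMap.lcomp R E f) := by
  intro b
  constructor
  · intro hb
    have hle : LinearMap.ker g ≤ LinearMap.ker b := by
      intro y hy
      obtain ⟨x, rfl⟩ := (h y).mp hy
      exact LinearMap.congr_fun hb x
    obtain ⟨c, hc⟩ := hE.exists_extension (f := (LinearMap.ker g).liftQ g le_rfl)
      (LinearMap.ker_eq_bot.mp (Submodule.ker_liftQ_eq_bot' _ _ rfl))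
      ((LinearMap.ker g).liftQ b hle)
    refine ⟨c, LinearMap.ext fun y => ?_⟩
    exact LinearMap.congr_fun hc (Submodule.Quotient.mk y)
  · rintro ⟨c, rfl⟩
    ext x
    have : g (f x) = 0 := (h _).mpr ⟨x, rfl⟩
    simp [this]

/-- Restriction to the `I`-torsion identifies its Matlis dual with the reduction mod `I`. -/
lemma exact_restrict_torsion [IsNoetherianRing R] {J : Ideal R} (hE : IsInjHull R J E) (I : Ideal R)
    {T : Submodule R X} (hT : ∀ y, y ∈ T ↔ ∀ r ∈ I, r • y = 0) :
    LinearMap.ker (LinearMap.lcomp R E T.subtype) = I • (⊤ : Submodule R (X →ₗ[R] E)) := by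
  apply le_antisymm
  · intro h hh
    obtain ⟨n, s, hs⟩ := Submodule.fg_iff_exists_fin_generating_family.mp
      ((inferInstance : IsNoetherian R R).noetherian I)
    let φ : X →ₗ[R] (Fin n → X) := LinearMap.pi fun i => s i • LinearMap.id
    have hex : Exact T.subtype φ := by
      intro y
      constructor
      · intro hy
        refine ⟨⟨y, (hT y).mpr ?_⟩, rfl⟩
        intro r hr
        rw [← hs] at hr
        induction hr using Submodule.span_induction with
        | mem x hx => obtain ⟨i, rfl⟩ := hx; exact congrFun hy i
        | zero => simp
        | add a b _ _ ha hb => rw [add_smul, ha, hb, add_zero]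
        | smul c a _ ha => rw [smul_assoc, ha, smul_zero]
      · rintro ⟨y, rfl⟩
        ext i
        exact (hT y).mp y.2 (s i) (hs ▸ Submodule.subset_span ⟨i, rfl⟩)
    obtain ⟨c, rfl⟩ := (hE.exact_lcomp hex h).mp hh
    have : LinearMap.lcomp R E φ c = ∑ i, s i • (c ∘ₗ LinearMap.single R (fun _ => X) i) := by
      ext y
      simp only [LinearMap.lcomp_apply, LinearMap.sum_apply, LinearMap.smul_apply,
        LinearMap.comp_apply, ← map_smul, ← map_sum]
      congr 1
      ext i
      simp [φ, Finset.sum_apply, Pi.single_apply]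
    rw [this]
    exact Submodule.sum_mem _ fun i _ =>
      Submodule.smul_mem_smul (hs ▸ Submodule.subset_span ⟨i, rfl⟩) trivial
  · rw [Submodule.smul_le]
    intro r hr h _
    ext y
    have : r • (y : X) = 0 := (hT y).mp y.2 r hr
    rw [LinearMap.lcomp_apply, LinearMap.smul_apply, Submodule.subtype_apply, ← map_smul, this,
      map_zero, LinearMap.zero_apply]

end IsInjHull

variable [IsLocalRing R]

namespace IsInjHull

lemma mem_range_of_forall_smul_eq_zero {f : (R ⧸ maximalIdeal R) →ₗ[R] E}
    (hess : ∀ N : Submodule R E, N ≠ ⊥ → N ⊓ LinearMap.range f ≠ ⊥) {y : E}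
    (hy : ∀ r ∈ maximalIdeal R, r • y = 0) : y ∈ LinearMap.range f := by
  by_cases h0 : y = 0
  · rw [h0]; exact Submodule.zero_mem _
  have := hess (Submodule.span R {y}) (by simpa using h0)
  obtain ⟨z, ⟨hz1, hz2⟩, hz⟩ := Submodule.exists_mem_ne_zero_of_ne_bot this
  obtain ⟨r, rfl⟩ := Submodule.mem_span_singleton.mp hz1
  have hr : IsUnit r := by
    by_contra hr
    exact hz (hy r hr)
  obtain ⟨u, rfl⟩ := hr
  have := Submodule.smul_mem _ (↑u⁻¹ : R) hz2
  rwa [smul_smul, Units.inv_mul, one_smul] at this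

lemma exists_apply_ne_zero (hE : IsInjHull R (maximalIdeal R) E) {y : X} (hy : y ≠ 0) :
    ∃ h : X →ₗ[R] E, h y ≠ 0 := by
  obtain ⟨f, hf, -⟩ := hE.2
  have hle : LinearMap.ker (LinearMap.toSpanSingleton R X y) ≤ maximalIdeal R := by
    apply le_maximalIdeal
    intro h
    apply hy
    have : (1 : R) ∈ LinearMap.ker (LinearMap.toSpanSingleton R X y) := h ▸ trivial
    simpa using this
  obtain ⟨h, hh⟩ := hE.exists_extension
    (f := (LinearMap.ker (LinearMap.toSpanSingleton R X y)).liftQ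
      (LinearMap.toSpanSingleton R X y) le_rfl)
    (LinearMap.ker_eq_bot.mp (Submodule.ker_liftQ_eq_bot' _ _ rfl))
    (f ∘ₗ Submodule.factor hle)
  refine ⟨h, ?_⟩
  have h1 := LinearMap.congr_fun hh (Submodule.Quotient.mk 1)
  simp only [LinearMap.comp_apply, Submodule.liftQ_apply, LinearMap.toSpanSingleton_apply,
    one_smul] at h1
  rw [h1, ← map_zero f]
  intro h2
  have := hf h2
  exact one_ne_zero (α := R ⧸ maximalIdeal R) this

lemma length_dual (hE : IsInjHull R (maximalIdeal R) E) (h : IsFiniteLength R X) :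
    Module.length R (X →ₗ[R] E) = Module.length R X := by
  induction h with
  | of_subsingleton => rw [Module.length_eq_zero, Module.length_eq_zero]
  | @of_simple_quotient M _ _ N _ _ ih =>
    have hex : Exact N.subtype N.mkQ := LinearMap.exact_subtype_mkQ N
    rw [Module.length_eq_add_of_exact _ _ (LinearMap.lcomp_injective N.mkQ_surjective)
      (hE.lcomp_surjective N.subtype_injective) (hE.exact_lcomp hex),
      Module.length_eq_add_of_exact _ _ N.subtype_injective N.mkQ_surjective hex, ih, add_comm]
    congr 1
    obtain ⟨f, hf, hess⟩ := hE.2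
    have : IsSimpleModule R (R ⧸ maximalIdeal R) :=
      isSimpleModule_iff_isCoatom.mpr (maximalIdeal.isMaximal R).out
    rw [Module.length_eq_one R (M ⧸ N)]
    obtain ⟨I, hI, ⟨e⟩⟩ := isSimpleModule_iff_quot_maximal.mp
      (inferInstance : IsSimpleModule R (M ⧸ N))
    obtain rfl := eq_maximalIdeal hI
    apply le_antisymm
    · rw [← Module.length_eq_one R (R ⧸ maximalIdeal R),
        ← (LinearEquiv.ofInjective f hf).symm.length_eq]
      have hmem : ∀ h : (M ⧸ N) →ₗ[R] E, h (e.symm 1) ∈ LinearMap.range f := fun h => by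
        apply mem_range_of_forall_smul_eq_zero hess
        intro r hr
        rw [← map_smul, ← map_smul]
        have : r • (1 : R ⧸ maximalIdeal R) = 0 := by
          rw [Algebra.smul_def, mul_one]
          exact Ideal.Quotient.eq_zero_iff_mem.mpr hr
        rw [this, map_zero, map_zero]
      refine Module.length_le_of_injective
        ((LinearMap.applyₗ (e.symm 1)).codRestrict (LinearMap.range f) hmem) ?_
      intro g h hgh
      have h1 : g (e.symm 1) = h (e.symm 1) := congrArg Subtype.val hgh
      ext z
      obtain ⟨r, hr⟩ := Ideal.Quotient.mk_surjective (e (Submodule.Quotient.mk z))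
      have h2 : (Submodule.Quotient.mk z : M ⧸ N) = r • e.symm 1 := by
        rw [← map_smul, LinearEquiv.eq_symm_apply, Algebra.smul_def, mul_one]
        exact hr.symm
      simp [h2, h1]
    · rw [Order.one_le_iff_ne_zero, Ne, Module.length_eq_zero_iff, not_subsingleton_iff_nontrivial]
      have : Nontrivial (M ⧸ N) := IsSimpleModule.nontrivial R _
      obtain ⟨y, hy⟩ := exists_ne (0 : M ⧸ N)
      obtain ⟨h, hh⟩ := hE.exists_apply_ne_zero hy
      exact ⟨h, 0, fun h0 => hh (by rw [h0]; rfl)⟩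

end IsInjHull

variable [IsNoetherianRing R]

namespace IsInjHull

lemma eulerChar_dual (hE : IsInjHull R (maximalIdeal R) E) (xs : List R) :
    ∀ (X : Type) [AddCommGroup X] [Module R X] [Module.Finite R X],
    EulerAdm (maximalIdeal R) xs X →
    eulerChar R xs (X →ₗ[R] E) = (-1) ^ xs.length * eulerChar R xs X := by
  induction xs with
  | nil =>
    intro X _ _ _ h
    simp [eulerChar, hE.length_dual (isFiniteLength_iff_isNoetherian_isArtinian.mpr
      (h.finiteLength (maximalIdeal.isMaximal R)))]
  | cons x xs ih =>
    intro X _ _ _ h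
    have e2 : QuotSMulTop x (X →ₗ[R] E) ≃ₗ[R] (Submodule.torsionBy R X x →ₗ[R] E) := by
      have hk := hE.exact_restrict_torsion (Ideal.span {x}) (T := Submodule.torsionBy R X x)
        (fun y => by
          rw [Submodule.mem_torsionBy_iff]
          constructor
          · intro hy r hr
            obtain ⟨a, rfl⟩ := Ideal.mem_span_singleton'.mp hr
            rw [mul_smul, hy, smul_zero]
          · exact fun hy => hy x (Ideal.mem_span_singleton_self x))
      rw [Submodule.ideal_span_singleton_smul] at hk
      exact (Submodule.quotEquivOfEq _ _ hk.symm).trans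
        (LinearMap.quotKerEquivOfSurjective _ (hE.lcomp_surjective (Submodule.subtype_injective _)))
    rw [eulerChar, eulerChar, eulerChar_congr xs e2,
      ← eulerChar_congr xs (dualQuotSMulTopEquiv E x), ih _ h.tors,
      ih _ h.quot, List.length_cons, pow_succ]
    ring

end IsInjHull

end MatlisDual

section CanonicalModule

open Function

variable {R : Type} [CommRing R]

lemma LinearMap.exists_surjective_of_ker_le {A B C : Type} [AddCommGroup A] [Module R A]
    [AddCommGroup B] [Module R B] [AddCommGroup C] [Module R C] {f : A →ₗ[R] B} {g : A →ₗ[R] C}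
    (hf : Surjective f) (hg : Surjective g) (h : LinearMap.ker f ≤ LinearMap.ker g) :
    ∃ k : B →ₗ[R] C, Surjective k := by
  let e := f.quotKerEquivOfSurjective hf
  refine ⟨((LinearMap.ker f).liftQ g h) ∘ₗ e.symm.toLinearMap, ?_⟩
  rw [LinearMap.coe_comp]
  refine Surjective.comp (fun c => ?_) e.symm.surjective
  obtain ⟨a, rfl⟩ := hg c
  exact ⟨Submodule.Quotient.mk a, rfl⟩

variable {E : Type} [AddCommGroup E] [Module R E]
  {V : Type} [AddCommGroup V] [Module R V] {M : Type} [AddCommGroup M] [Module R M]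

lemma Submodule.le_annihilator_torsionBySet (I : Ideal R) :
    I ≤ Module.annihilator R (Submodule.torsionBySet R M I) := fun r hr => by
  rw [Module.mem_annihilator]
  rintro ⟨y, hy⟩
  exact Subtype.ext ((Submodule.mem_torsionBySet_iff _ _).mp hy ⟨r, hr⟩)

variable [IsLocalRing R]

namespace IsInjHull

lemma subsingleton_of_subsingleton_dual (hE : IsInjHull R (maximalIdeal R) E)
    [Subsingleton (V →ₗ[R] E)] : Subsingleton V := by
  refine subsingleton_of_forall_eq 0 fun y => ?_
  by_contra hy
  obtain ⟨h, hh⟩ := hE.exists_apply_ne_zero hy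
  exact hh (by rw [Subsingleton.elim h 0]; rfl)

variable [IsNoetherianRing R]

lemma subsingleton_of_surjective_locCoh (hE : IsInjHull R (maximalIdeal R) E) {p : Ideal R} {e : ℕ}
    (hdim : ringKrullDim (R ⧸ p) < e)
    {φ : LocCoh (maximalIdeal R) e (R ⧸ p) →ₗ[R] (V →ₗ[R] E)} (hφ : Surjective φ) :
    Subsingleton V := by
  have : Subsingleton (LocCoh (maximalIdeal R) e (R ⧸ p)) := by
    cases e with
    | zero =>
      have : Subsingleton (R ⧸ p) := by
        rw [← not_nontrivial_iff_subsingleton]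
        intro h
        exact not_le.mpr hdim (by exact_mod_cast ringKrullDim_nonneg_of_nontrivial)
      exact LocCoh.subsingleton _ _
    | succ n =>
      refine LocCoh.subsingleton_of_ringKrullDim_lt n p (R ⧸ p) ?_ ?_ _ (Nat.lt_succ_self n)
      · rw [Ideal.annihilator_quotient]
      · by_contra! h
        exact absurd (WithBot.natCast_add_one_le_of_lt h) (not_le.mpr hdim)
  have : Subsingleton (V →ₗ[R] E) := hφ.subsingleton
  exact hE.subsingleton_of_subsingleton_dual

lemma exists_relation_of_surjective_locCoh [Module.Finite R V]
    (hE : IsInjHull R (maximalIdeal R) E) {p : Ideal R} [p.IsPrime] {e : ℕ}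
    (hpV : p ≤ Module.annihilator R V) (hdim : ringKrullDim (R ⧸ p) ≤ e)
    {φ : LocCoh (maximalIdeal R) e (R ⧸ p) →ₗ[R] (V →ₗ[R] E)} (hφ : Surjective φ) (y z : V) :
    ∃ a b : R, ¬ (a ∈ p ∧ b ∈ p) ∧ a • y + b • z = 0 := by
  have hm := maximalIdeal.isMaximal R
  rcases hdim.lt_or_eq with hdim | hdim
  · have := hE.subsingleton_of_surjective_locCoh hdim hφ
    exact ⟨1, 0, fun h => Ideal.IsPrime.ne_top' ((Ideal.eq_top_iff_one p).mpr h.1),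
      Subsingleton.elim _ _⟩
  by_contra! hcon
  have hpp : p ≤ Module.annihilator R (R ⧸ p) := by rw [Ideal.annihilator_quotient]
  have hpL : p ≤ Module.annihilator R (LocCoh (maximalIdeal R) e (R ⧸ p)) :=
    hpp.trans (LocCoh.annihilator_le _ _)
  have : IsArtinian R (LocCoh (maximalIdeal R) e (R ⧸ p)) := LocCoh.isArtinian (R := R) e (R ⧸ p)
  obtain ⟨xs, hlen, hxs, h1, h2⟩ := exists_eulerChar_locCoh e (ι := Unit) (κ := Unit)
    (fun _ => p) (fun _ => R ⧸ p) (fun _ => p) (fun _ => LinearMap.ker φ) (fun _ => hpp)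
    (fun _ => hdim.le)
    (fun _ => hpL.trans (LinearMap.annihilator_le_of_injective _ (Submodule.subtype_injective _)))
    (fun _ => hdim.le)
  obtain ⟨hk, h1⟩ := h1 ()
  obtain ⟨-, h2⟩ := h2 ()
  have hadd : EulerAdditive (maximalIdeal R) xs := eulerAdditive hm xs
  have h3 := hadd (LinearMap.ker φ).subtype φ (Submodule.subtype_injective _)
    (LinearMap.exact_subtype_ker_map φ) hφ (EulerAdm.of_le (Or.inr inferInstance) hpL hk)
  have hV : EulerAdm (maximalIdeal R) xs V := EulerAdm.of_le (Or.inl inferInstance) hpV hk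
  rw [h1, hE.eulerChar_dual xs V hV, hlen] at h3
  let ψ : ((R ⧸ p) × (R ⧸ p)) →ₗ[R] V := LinearMap.coprod
    (Submodule.liftQ p (LinearMap.toSpanSingleton R V y) fun r hr => by
      simpa using Module.mem_annihilator.mp (hpV hr) y)
    (Submodule.liftQ p (LinearMap.toSpanSingleton R V z) fun r hr => by
      simpa using Module.mem_annihilator.mp (hpV hr) z)
  have hψ : Injective ψ := by
    rw [injective_iff_map_eq_zero]
    rintro ⟨a, b⟩ hab
    obtain ⟨a, rfl⟩ := Submodule.mkQ_surjective _ a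
    obtain ⟨b, rfl⟩ := Submodule.mkQ_surjective _ b
    have h0 : a • y + b • z = 0 := hab
    have hab' : a ∈ p ∧ b ∈ p := by
      by_contra h
      exact hcon a b (fun ha hb => h ⟨ha, hb⟩) h0
    exact Prod.ext ((Submodule.Quotient.mk_eq_zero p).mpr hab'.1)
      ((Submodule.Quotient.mk_eq_zero p).mpr hab'.2)
  have h4 := eulerChar_le_of_injective hm hV ψ hψ
  have h5 := hadd (LinearMap.inl R (R ⧸ p) (R ⧸ p)) (LinearMap.snd R (R ⧸ p) (R ⧸ p))
    LinearMap.inl_injective .inl_snd LinearMap.snd_surjective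
    (hV.of_injective ψ hψ)
  have h6 := eulerChar_quotient_prime_pos xs hxs p (hdim.trans (by rw [hlen]))
    (EulerAdm.of_le (Or.inl inferInstance) hpp hk)
  rcases neg_one_pow_eq_or ℤ e with h | h <;> rw [h] at h2 h3 <;> linarith

lemma exists_surjective_dual_torsionBySet (hE : IsInjHull R (maximalIdeal R) E) {e : ℕ}
    {J I : Ideal R} (hJ : ringKrullDim (R ⧸ J) ≤ e) (hJI : J ≤ I)
    {φ : LocCoh (maximalIdeal R) e (R ⧸ J) →ₗ[R] (M →ₗ[R] E)} (hφ : Surjective φ) :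
    ∃ ψ : LocCoh (maximalIdeal R) e (R ⧸ I) →ₗ[R] (Submodule.torsionBySet R M I →ₗ[R] E),
      Surjective ψ := by
  obtain ⟨hs, hk⟩ := LocCoh.map_factor_surjective_and_ker (J := maximalIdeal R) (i := e) hJI
    (fun N _ _ _ hN => LocCoh.subsingleton_of_ringKrullDim_lt e J N hN hJ _ (Nat.lt_succ_self e))
  have h1 := hE.lcomp_surjective (Submodule.subtype_injective (Submodule.torsionBySet R M I))
  refine LinearMap.exists_surjective_of_ker_le hs (g := LinearMap.lcomp R E
    (Submodule.torsionBySet R M I).subtype ∘ₗ φ) ?_ ?_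
  · rw [LinearMap.coe_comp]
    exact h1.comp hφ
  · rw [hk, Submodule.smul_le]
    intro r hr w _
    rw [LinearMap.mem_ker, LinearMap.comp_apply, map_smul, ← LinearMap.mem_ker,
      hE.exact_restrict_torsion I (T := Submodule.torsionBySet R M I) (fun y => by simp)]
    exact Submodule.smul_mem_smul hr trivial

end IsInjHull

end CanonicalModule

section CanonicalModuleDual

open Function

variable {R : Type} [CommRing R] [IsLocalRing R]
  {E : Type} [AddCommGroup E] [Module R E] {M : Type} [AddCommGroup M] [Module R M] {d : ℕ}

namespace IsInjHull

lemma exists_surjective_quotient_bot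
    (hM : Nonempty ((M →ₗ[R] E) ≃ₗ[R] LocCoh (maximalIdeal R) d R)) :
    ∃ φ : LocCoh (maximalIdeal R) d (R ⧸ (⊥ : Ideal R)) →ₗ[R] (M →ₗ[R] E), Surjective φ := by
  obtain ⟨e⟩ := hM
  exact ⟨((LocCoh.congr (maximalIdeal R) d (Submodule.quotEquivOfEqBot (⊥ : Ideal R) rfl)).trans
    e.symm).toLinearMap, LinearEquiv.surjective _⟩

variable [IsNoetherianRing R]

lemma eq_zero_of_surjective_locCoh
    (hE : IsInjHull R (maximalIdeal R) E) {e : ℕ} {J p : Ideal R}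
    (hJ : ringKrullDim (R ⧸ J) ≤ e) (hJI : J ≤ p)
    {φ : LocCoh (maximalIdeal R) e (R ⧸ J) →ₗ[R] (M →ₗ[R] E)} (hφ : Surjective φ)
    (hp : ringKrullDim (R ⧸ p) < e) {y : M} (hy : ∀ r ∈ p, r • y = 0) : y = 0 := by
  obtain ⟨ψ, hψ⟩ := hE.exists_surjective_dual_torsionBySet hJ hJI hφ
  have := hE.subsingleton_of_surjective_locCoh hp hψ
  exact congrArg Subtype.val (Subsingleton.elim (⟨y, by simpa using hy⟩ :
    Submodule.torsionBySet R M p) 0)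

lemma exists_relation_of_forall_smul_eq_zero [Module.Finite R M]
    (hE : IsInjHull R (maximalIdeal R) E) {e : ℕ} {J p : Ideal R} [p.IsPrime]
    (hJ : ringKrullDim (R ⧸ J) ≤ e) (hJI : J ≤ p)
    {φ : LocCoh (maximalIdeal R) e (R ⧸ J) →ₗ[R] (M →ₗ[R] E)} (hφ : Surjective φ)
    {y z : M} (hy : ∀ r ∈ p, r • y = 0) (hz : ∀ r ∈ p, r • z = 0) :
    ∃ a b : R, ¬ (a ∈ p ∧ b ∈ p) ∧ a • y + b • z = 0 := by
  obtain ⟨ψ, hψ⟩ := hE.exists_surjective_dual_torsionBySet hJ hJI hφ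
  obtain ⟨a, b, hab, h⟩ := hE.exists_relation_of_surjective_locCoh
    (Submodule.le_annihilator_torsionBySet p) ((ringKrullDim_quotient_mono hJI).trans hJ) hψ
    ⟨y, by simpa using hy⟩ ⟨z, by simpa using hz⟩
  exact ⟨a, b, hab, congrArg Subtype.val h⟩

lemma exists_surjective_quotient_span {x : R} {e : ℕ}
    (hM : Nonempty ((M →ₗ[R] E) ≃ₗ[R] LocCoh (maximalIdeal R) (e + 1) R))
    (hx : ringKrullDim (R ⧸ Ideal.span {x}) ≤ e) :
    ∃ φ : LocCoh (maximalIdeal R) e (R ⧸ Ideal.span {x}) →ₗ[R] (QuotSMulTop x M →ₗ[R] E),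
      Surjective φ := by
  obtain ⟨f⟩ := hM
  obtain ⟨φ, hφ⟩ := LocCoh.exists_surjective_torsionBy (J := maximalIdeal R) (i := e) (x := x)
    (fun N _ _ _ hN j hj => LocCoh.subsingleton_of_ringKrullDim_lt e (Ideal.span {x}) N
      ((Ideal.span_singleton_le_iff_mem _).mpr hN) hx j hj)
  let g : Submodule.torsionBy R (LocCoh (maximalIdeal R) (e + 1) R) x →ₗ[R]
      Submodule.torsionBy R (M →ₗ[R] E) x :=
    (f.symm.toLinearMap ∘ₗ Submodule.subtype _).codRestrict _ fun z => by
      rw [Submodule.mem_torsionBy_iff, LinearMap.comp_apply, ← map_smul, ← map_smul]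
      have : x • z = 0 := Subtype.ext z.2
      rw [this, map_zero, map_zero]
  have hg : Surjective g := by
    rintro ⟨h, hh⟩
    rw [Submodule.mem_torsionBy_iff] at hh
    refine ⟨⟨f h, ?_⟩, Subtype.ext (f.symm_apply_apply h)⟩
    rw [Submodule.mem_torsionBy_iff, ← map_smul, hh, map_zero]
  refine ⟨(dualQuotSMulTopEquiv E x).symm.toLinearMap ∘ₗ g ∘ₗ φ, ?_⟩
  rw [LinearMap.coe_comp, LinearMap.coe_comp]
  exact (LinearEquiv.surjective _).comp (hg.comp hφ)

/-- The annihilator of the canonical module is supported in codimension at least one. -/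
theorem ringKrullDim_quotient_lt_of_annihilator_annihilator_le
    (hd : ringKrullDim R = d)
    (hM : Nonempty ((M →ₗ[R] E) ≃ₗ[R] LocCoh (maximalIdeal R) d R)) (p : Ideal R) [p.IsPrime]
    (hp : Module.annihilator R (Module.annihilator R M) ≤ p) : ringKrullDim (R ⧸ p) < d := by
  have hm := maximalIdeal.isMaximal R
  have hle (I : Ideal R) : ringKrullDim (R ⧸ I) ≤ d :=
    (ringKrullDim_le_of_surjective _ Ideal.Quotient.mk_surjective).trans hd.le
  by_contra! hdp
  have hdp := le_antisymm (hle p) hdp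
  set K := Module.annihilator R M with hK
  have hpK : p ∈ associatedPrimes R K := by
    apply Module.associatedPrimes.minimalPrimes_annihilator_subset_associatedPrimes
    refine ⟨⟨inferInstance, hp⟩, fun q hq hqp => ?_⟩
    by_contra hpq
    have := hq.1
    have h1 := (ringKrullDim_quotient_add_one_le_of_lt (lt_of_le_not_ge hqp hpq)).trans (hle q)
    rw [hdp] at h1
    have h2 : ((d + 1 : ℕ) : WithBot ℕ∞) ≤ (d : ℕ) := by exact_mod_cast h1
    have h3 : d + 1 ≤ d := by exact_mod_cast h2
    omega
  obtain ⟨f, hf⟩ := ((isAssociatedPrime_iff_exists_injective_linearMap _ _).mp hpK).2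
  let I : Bool → Ideal R := fun b => if b then K else ⊥
  obtain ⟨xs, hlen, hxs, h1, -⟩ := exists_eulerChar_locCoh d (ι := Bool) (κ := Empty)
    I (fun i => R ⧸ I i) (fun _ => ⊥) (fun _ => PUnit) (fun b => by rw [Ideal.annihilator_quotient])
    (fun _ => hle _) (fun l => l.elim) (fun l => l.elim)
  obtain ⟨⟨k, hk⟩, h2⟩ := h1 false
  obtain ⟨-, h3⟩ := h1 true
  have hadd : EulerAdditive (maximalIdeal R) xs := eulerAdditive hm xs
  have hadm (N : Type) [AddCommGroup N] [Module R N] [Module.Finite R N] :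
      EulerAdm (maximalIdeal R) xs N :=
    EulerAdm.of_le (Or.inl inferInstance) bot_le ⟨k, hk⟩
  have hLK : ∀ r ∈ K, ∀ z : LocCoh (maximalIdeal R) d (R ⧸ (⊥ : Ideal R)), r • z = 0 := by
    intro r hr z
    let e := (LocCoh.congr (maximalIdeal R) d
      (Submodule.quotEquivOfEqBot (⊥ : Ideal R) rfl)).trans hM.some.symm
    apply e.injective
    rw [map_smul, map_zero]
    ext y
    rw [LinearMap.smul_apply, ← map_smul, Module.mem_annihilator.mp hr, map_zero,
      LinearMap.zero_apply]
  obtain ⟨hs, hker⟩ := LocCoh.map_factor_surjective_and_ker (J := maximalIdeal R) (i := d)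
    (bot_le (a := K)) (fun N _ _ _ hN =>
      LocCoh.subsingleton_of_ringKrullDim_lt d ⊥ N hN (hle ⊥) _ (Nat.lt_succ_self d))
  have hbot : K • (⊤ : Submodule R (LocCoh (maximalIdeal R) d (R ⧸ (⊥ : Ideal R)))) = ⊥ := by
    rw [eq_bot_iff, Submodule.smul_le]
    exact fun r hr z _ => hLK r hr z
  have h4 : eulerChar R xs (R ⧸ (⊥ : Ideal R)) = eulerChar R xs (R ⧸ K) := by
    have h5 := eulerChar_congr xs (LinearEquiv.ofBijective _
      ⟨LinearMap.ker_eq_bot.mp (hker.trans hbot), hs⟩)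
    have h6 : (-1 : ℤ) ^ d * eulerChar R xs (R ⧸ (⊥ : Ideal R)) =
      (-1) ^ d * eulerChar R xs (R ⧸ K) := h2.symm.trans (h5.trans h3)
    exact mul_left_cancel₀ (pow_ne_zero d (by norm_num)) h6
  have h5 := hadd.eq_submodule_add_quotient K (hadm R)
  rw [← h4, eulerChar_congr xs (Submodule.quotEquivOfEqBot (⊥ : Ideal R) rfl)] at h5
  have h6 := eulerChar_le_of_injective hm (hadm K) f hf
  have h7 := eulerChar_quotient_prime_pos xs hxs p (hdp.trans (by rw [hlen])) (hadm _)
  linarith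

end IsInjHull

end CanonicalModuleDual

section ExtVanishing

open Function

variable {A : Type} [CommRing A] {X G N Y : Type} [AddCommGroup X] [Module A X] [AddCommGroup G]
  [Module A G] [AddCommGroup N] [Module A N] [AddCommGroup Y] [Module A Y]

/-- The vanishing of `Ext A X Y i`. -/
def ExtVan (A : Type) [CommRing A] (X Y : Type) [AddCommGroup X] [Module A X] [AddCommGroup Y]
    [Module A Y] (i : ℕ) : Prop :=
  Subsingleton (Abelian.Ext (ModuleCat.of A X) (ModuleCat.of A Y) i)

lemma ExtVan.congr {i : ℕ} (h : ExtVan A X Y i) (e : X ≃ₗ[A] G) : ExtVan A G Y i := by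
  have : Subsingleton (Abelian.Ext (ModuleCat.of A X) (ModuleCat.of A Y) i) := h
  refine subsingleton_of_forall_eq 0 fun z => ?_
  rw [← Abelian.Ext.mk₀_id_comp z, ← e.toModuleIso.inv_hom_id, ← Abelian.Ext.mk₀_comp_mk₀,
    Abelian.Ext.comp_assoc_of_second_deg_zero,
    Subsingleton.elim ((Abelian.Ext.mk₀ e.toModuleIso.hom).comp z (zero_add i)) 0,
    Abelian.Ext.comp_zero]

lemma ExtVan.of_projective [Module.Projective A X] (i : ℕ) : ExtVan A X Y (i + 1) := by
  have : Projective (ModuleCat.of A X) := ModuleCat.projective_of_categoryTheory_projective _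
  exact Abelian.Ext.subsingleton_of_projective _ _ _

section LongExactSequence

variable {f : X →ₗ[A] G} {g : G →ₗ[A] N} (hf : Injective f) (h : Exact f g) (hg : Surjective g)

include hf h hg

lemma ExtVan.succ_of_exact {i : ℕ} (hX : ExtVan A X Y i) (hG : ExtVan A G Y (i + 1)) :
    ExtVan A N Y (i + 1) := by
  have : Subsingleton (Abelian.Ext (ModuleCat.of A X) (ModuleCat.of A Y) i) := hX
  have : Subsingleton (Abelian.Ext (ModuleCat.of A G) (ModuleCat.of A Y) (i + 1)) := hG
  refine subsingleton_of_forall_eq 0 fun z => ?_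
  obtain ⟨w, rfl⟩ := Abelian.Ext.contravariant_sequence_exact₃ (LocCoh.shortExact hf h hg) _ z
    (@Subsingleton.elim _ hG _ 0) (add_comm 1 i)
  rw [@Subsingleton.elim _ hX w 0, Abelian.Ext.comp_zero]

lemma ExtVan.of_exact {i : ℕ} (hG : ExtVan A G Y i) (hN : ExtVan A N Y (i + 1)) :
    ExtVan A X Y i := by
  refine subsingleton_of_forall_eq 0 fun z => ?_
  obtain ⟨w, rfl⟩ := Abelian.Ext.contravariant_sequence_exact₁ (LocCoh.shortExact hf h hg) _ z
    (add_comm 1 i) (@Subsingleton.elim _ hN _ 0)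
  rw [@Subsingleton.elim _ hG w 0, Abelian.Ext.comp_zero]

lemma ExtVan.exists_extension (hN : ExtVan A N Y 1) (a : X →ₗ[A] Y) :
    ∃ b : G →ₗ[A] Y, b ∘ₗ f = a := by
  obtain ⟨w, hw⟩ := Abelian.Ext.contravariant_sequence_exact₁ (LocCoh.shortExact hf h hg)
    (ModuleCat.of A Y) (Abelian.Ext.mk₀ (ModuleCat.ofHom a)) (add_comm 1 0)
    (@Subsingleton.elim _ hN _ 0)
  obtain ⟨b, rfl⟩ := (Abelian.Ext.mk₀_bijective _ _).surjective w
  rw [Abelian.Ext.mk₀_comp_mk₀] at hw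
  have := (Abelian.Ext.mk₀_bijective _ _).injective hw
  exact ⟨b.hom, congrArg ModuleCat.Hom.hom this⟩

lemma ExtVan.one_of_exists_extension (hG : ExtVan A G Y 1)
    (hext : ∀ a : X →ₗ[A] Y, ∃ b : G →ₗ[A] Y, b ∘ₗ f = a) : ExtVan A N Y 1 := by
  refine subsingleton_of_forall_eq 0 fun z => ?_
  obtain ⟨w, rfl⟩ := Abelian.Ext.contravariant_sequence_exact₃ (LocCoh.shortExact hf h hg) _ z
    (@Subsingleton.elim _ hG _ 0) (add_comm 1 0)
  obtain ⟨a, rfl⟩ := (Abelian.Ext.mk₀_bijective _ _).surjective w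
  obtain ⟨b, hb⟩ := hext a.hom
  have : a = ModuleCat.ofHom f ≫ ModuleCat.ofHom b := by
    ext x; exact (LinearMap.congr_fun hb x).symm
  rw [this, ← Abelian.Ext.mk₀_comp_mk₀]
  exact (LocCoh.shortExact hf h hg).extClass_comp_assoc _

end LongExactSequence

end ExtVanishing

section MatrixAction

open Function

variable {A : Type} [CommRing A] {l m n q : ℕ}

/-- The action of a matrix on column vectors with entries in a module. -/
def mact (M : Matrix (Fin m) (Fin n) A) (Y : Type) [AddCommGroup Y] [Module A Y] :
    (Fin n → Y) →ₗ[A] (Fin m → Y) :=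
  LinearMap.pi fun i => ∑ j, M i j • LinearMap.proj j

/-- Exactness of `Y ^ q → Y ^ n → Y ^ m`, where the maps are given by `K` and `M`. -/
def MExact (Y : Type) [AddCommGroup Y] [Module A Y] (M : Matrix (Fin m) (Fin n) A)
    (K : Matrix (Fin n) (Fin q) A) : Prop :=
  Exact (mact K Y) (mact M Y)

/-- The cokernel of a matrix. -/
abbrev Cok (M : Matrix (Fin m) (Fin n) A) : Type :=
  (Fin m → A) ⧸ LinearMap.range (mact M A)

variable {Y Z : Type} [AddCommGroup Y] [Module A Y] [AddCommGroup Z] [Module A Z]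

lemma mact_apply (M : Matrix (Fin m) (Fin n) A) (v : Fin n → Y) (i : Fin m) :
    mact M Y v i = ∑ j, M i j • v j := by
  simp [mact, LinearMap.sum_apply]

lemma mact_map (M : Matrix (Fin m) (Fin n) A) (f : Y →ₗ[A] Z) (v : Fin n → Y) :
    mact M Z (f ∘ v) = f ∘ mact M Y v := by
  ext i; simp [mact_apply]

lemma linearCombination_mact (M : Matrix (Fin m) (Fin n) A) (v : Fin m → Y) (u : Fin n → A) :
    Fintype.linearCombination A v (mact M A u) =
      Fintype.linearCombination A (mact M.transpose Y v) u := by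
  simp only [Fintype.linearCombination_apply, mact_apply, Finset.smul_sum, Finset.sum_smul,
    Matrix.transpose_apply, smul_eq_mul, smul_smul]
  rw [Finset.sum_comm]
  simp [mul_comm]

lemma linearCombination_eq_zero_iff {v : Fin n → Y} :
    Fintype.linearCombination A v = 0 ↔ v = 0 := by
  refine ⟨fun h => ?_, fun h => ?_⟩
  · ext i
    simpa [Fintype.linearCombination_apply] using LinearMap.congr_fun h (Pi.single i 1)
  · ext; simp [h]

lemma exists_eq_linearCombination (f : (Fin n → A) →ₗ[A] Y) :
    ∃ v : Fin n → Y, f = Fintype.linearCombination A v :=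
  ⟨fun i => f (Pi.single i 1), by ext i; simp [Fintype.linearCombination_apply]⟩

lemma mact_mact_transpose {M : Matrix (Fin m) (Fin n) A} {K : Matrix (Fin n) (Fin q) A}
    (h : MExact A M K) (v : Fin m → Y) : mact K.transpose Y (mact M.transpose Y v) = 0 := by
  rw [← linearCombination_eq_zero_iff (A := A)]
  ext1 u
  ext1
  rw [LinearMap.comp_apply, ← linearCombination_mact, ← linearCombination_mact,
    h.apply_apply_eq_zero]
  simp

lemma MExact.of_forall_mem_range {M : Matrix (Fin m) (Fin n) A} {K : Matrix (Fin n) (Fin q) A}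
    (h : ∀ v, mact M Y (mact K Y v) = 0) (h' : ∀ v, mact M Y v = 0 → ∃ u, mact K Y u = v) :
    MExact Y M K :=
  fun v => ⟨h' v, by rintro ⟨u, rfl⟩; exact h u⟩

/-- Every matrix over a Noetherian ring has a successor. -/
lemma exists_mexact [IsNoetherianRing A] (M : Matrix (Fin m) (Fin n) A) :
    ∃ (q : ℕ) (K : Matrix (Fin n) (Fin q) A), MExact A M K := by
  obtain ⟨q, g, hg⟩ := Submodule.fg_iff_exists_fin_generating_family.mp
    (IsNoetherian.noetherian (LinearMap.ker (mact M A)))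
  have key : ∀ u, mact (Matrix.of fun i j => g j i) A u = ∑ j, u j • g j := by
    intro u
    ext i
    simp [mact_apply, mul_comm]
  refine ⟨q, Matrix.of fun i j => g j i, fun v => ?_⟩
  rw [← LinearMap.mem_ker, ← hg, Submodule.mem_span_range_iff_exists_fun]
  exact exists_congr fun u => by rw [key]

section Successor

variable {K : Matrix (Fin m) (Fin n) A} {L : Matrix (Fin n) (Fin q) A} (h : MExact A K L)

/-- The embedding of the cokernel of a successor. -/
def MExact.cokMap : Cok L →ₗ[A] (Fin m → A) :=
  (LinearMap.range (mact L A)).liftQ (mact K A) (by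
    rintro _ ⟨u, rfl⟩
    exact h.apply_apply_eq_zero u)

lemma MExact.cokMap_injective : Injective h.cokMap := by
  rw [← LinearMap.ker_eq_bot, MExact.cokMap, Submodule.ker_liftQ_eq_bot]
  exact fun v hv => (h v).mp hv

lemma MExact.cokMap_exact : Exact h.cokMap (LinearMap.range (mact K A)).mkQ := by
  intro v
  rw [← LinearMap.mem_ker, Submodule.ker_mkQ]
  refine ⟨?_, ?_⟩
  · rintro ⟨u, rfl⟩
    exact ⟨Submodule.Quotient.mk u, rfl⟩
  · rintro ⟨u, rfl⟩
    obtain ⟨u, rfl⟩ := Submodule.mkQ_surjective _ u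
    exact ⟨u, rfl⟩

include h

lemma MExact.extVan_succ {i : ℕ} (hi : ExtVan A (Cok L) Y i) : ExtVan A (Cok K) Y (i + 1) :=
  ExtVan.succ_of_exact h.cokMap_injective h.cokMap_exact (Submodule.mkQ_surjective _) hi
    (ExtVan.of_projective i)

lemma MExact.extVan_of_succ {i : ℕ} (hi : ExtVan A (Cok K) Y (i + 2)) :
    ExtVan A (Cok L) Y (i + 1) :=
  ExtVan.of_exact h.cokMap_injective h.cokMap_exact (Submodule.mkQ_surjective _)
    (ExtVan.of_projective i) hi

lemma MExact.transpose_of_extVan_one (hY : ExtVan A (Cok K) Y 1) :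
    MExact Y L.transpose K.transpose := by
  refine .of_forall_mem_range (mact_mact_transpose h) fun v hv => ?_
  obtain ⟨b, hb⟩ := ExtVan.exists_extension h.cokMap_injective h.cokMap_exact
    (Submodule.mkQ_surjective _) hY
    ((LinearMap.range (mact L A)).liftQ (Fintype.linearCombination A v) (by
      rintro _ ⟨u, rfl⟩
      rw [LinearMap.mem_ker, linearCombination_mact, hv, linearCombination_eq_zero_iff.mpr rfl,
        LinearMap.zero_apply]))
  obtain ⟨u, rfl⟩ := exists_eq_linearCombination b
  refine ⟨u, ?_⟩
  rw [← sub_eq_zero, ← linearCombination_eq_zero_iff (A := A)]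
  ext1 j
  ext1
  have := LinearMap.congr_fun hb (Submodule.Quotient.mk (Pi.single j 1))
  replace this : Fintype.linearCombination A u (mact K A (Pi.single j 1)) =
    Fintype.linearCombination A v (Pi.single j 1) := this
  rw [linearCombination_mact] at this
  rw [Fintype.linearCombination_apply_single, Fintype.linearCombination_apply_single, one_smul,
    one_smul] at this
  simp [Fintype.linearCombination_apply_single, this]

lemma MExact.extVan_one (hY : MExact Y L.transpose K.transpose) : ExtVan A (Cok K) Y 1 := by
  refine ExtVan.one_of_exists_extension h.cokMap_injective h.cokMap_exact
    (Submodule.mkQ_surjective _) (ExtVan.of_projective 0) fun a => ?_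
  obtain ⟨v, hv⟩ := exists_eq_linearCombination (a ∘ₗ (LinearMap.range (mact L A)).mkQ)
  obtain ⟨u, rfl⟩ := (hY v).mp (by
    rw [← linearCombination_eq_zero_iff (A := A)]
    ext1 j
    ext1
    rw [LinearMap.comp_apply, ← linearCombination_mact, ← hv, LinearMap.comp_apply,
      Submodule.mkQ_apply, (Submodule.Quotient.mk_eq_zero _).mpr (LinearMap.mem_range_self _ _)]
    simp)
  refine ⟨Fintype.linearCombination A u, Submodule.linearMap_qext _ ?_⟩
  rw [hv]
  ext1 j
  ext1
  exact linearCombination_mact K u _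

end Successor

end MatrixAction

section TotallyAcyclic

open Function
open scoped Matrix

variable {A : Type} [CommRing A] {l m n q : ℕ}

/-- A class of matrices which is closed under transposition and in which every matrix can be
continued by an exact sequence with exact dual; every such matrix belongs to a totally acyclic
complex of free modules. -/
structure IsTotallyAcyclic (𝒮 : ∀ m n : ℕ, Matrix (Fin m) (Fin n) A → Prop) : Prop where
  transpose : ∀ {m n : ℕ} {M : Matrix (Fin m) (Fin n) A}, 𝒮 m n M → 𝒮 n m Mᵀ
  succ : ∀ {m n : ℕ} {M : Matrix (Fin m) (Fin n) A}, 𝒮 m n M →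
    ∃ (q : ℕ) (K : Matrix (Fin n) (Fin q) A), 𝒮 n q K ∧ MExact A M K ∧ MExact A Kᵀ Mᵀ

/-- `M` is a matrix of relations for the family of generators `g`. -/
structure IsPresentation {G : Type} [AddCommGroup G] [Module A G] (M : Matrix (Fin m) (Fin n) A)
    (g : Fin m → G) : Prop where
  exact : Exact (mact M A) (Fintype.linearCombination A g)
  surjective : Surjective (Fintype.linearCombination A g)

/-- Modules presented by a matrix in a totally acyclic complex. -/
def TRc (A : Type) [CommRing A] (G : Type) [AddCommGroup G] [Module A G] : Prop :=
  ∃ 𝒮 : ∀ m n : ℕ, Matrix (Fin m) (Fin n) A → Prop, IsTotallyAcyclic 𝒮 ∧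
    ∃ (m n : ℕ) (M : Matrix (Fin m) (Fin n) A) (g : Fin m → G), 𝒮 m n M ∧ IsPresentation M g

/-- Modules with a resolution of length `n` by modules satisfying `TRc`. -/
def GDc (A : Type) [CommRing A] : ℕ → ∀ (N : Type) [AddCommGroup N] [Module A N], Prop
  | 0, N, _, _ => TRc A N
  | n + 1, N, _, _ => ∃ (X G : Type) (_ : AddCommGroup X) (_ : Module A X) (_ : AddCommGroup G)
      (_ : Module A G) (f : X →ₗ[A] G) (g : G →ₗ[A] N), Injective f ∧ Exact f g ∧ Surjective g ∧
        TRc A G ∧ GDc A n X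

lemma IsTotallyAcyclic.pred {𝒮 : ∀ m n : ℕ, Matrix (Fin m) (Fin n) A → Prop}
    (hS : IsTotallyAcyclic 𝒮) {M : Matrix (Fin m) (Fin n) A} (hM : 𝒮 m n M) :
    ∃ (l : ℕ) (P : Matrix (Fin l) (Fin m) A), 𝒮 l m P ∧ MExact A P M ∧ MExact A Mᵀ Pᵀ := by
  obtain ⟨l, K, hK, h₁, h₂⟩ := hS.succ (hS.transpose hM)
  exact ⟨l, Kᵀ, hS.transpose hK, h₂, h₁⟩

lemma IsTotallyAcyclic.extVan {𝒮 : ∀ m n : ℕ, Matrix (Fin m) (Fin n) A → Prop}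
    (hS : IsTotallyAcyclic 𝒮) {M : Matrix (Fin m) (Fin n) A} (hM : 𝒮 m n M) (i : ℕ) :
    ExtVan A (Cok M) A (i + 1) := by
  induction i generalizing m n M with
  | zero =>
    obtain ⟨q, K, -, h₁, h₂⟩ := hS.succ hM
    exact h₁.extVan_one h₂
  | succ i ih =>
    obtain ⟨q, K, hK, h₁, -⟩ := hS.succ hM
    exact h₁.extVan_succ (ih hK)

/-- The class of matrices whose cokernels and transposed cokernels have no extensions by the
ring. -/
lemma isTotallyAcyclic_extVan [IsNoetherianRing A] :
    IsTotallyAcyclic fun (m n : ℕ) (M : Matrix (Fin m) (Fin n) A) =>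
      ∀ i : ℕ, ExtVan A (Cok M) A (i + 1) ∧ ExtVan A (Cok Mᵀ) A (i + 1) where
  transpose h i := (h i).symm
  succ {m n M} h := by
    obtain ⟨q, K, hK⟩ := exists_mexact M
    have hK' : MExact A Kᵀ Mᵀ := hK.transpose_of_extVan_one (h 0).1
    refine ⟨q, K, fun i => ⟨hK.extVan_of_succ (h (i + 1)).1, ?_⟩, hK, hK'⟩
    cases i with
    | zero => exact hK'.extVan_one hK
    | succ i => exact hK'.extVan_succ (h i).2

section Presentation

variable {G Y : Type} [AddCommGroup G] [Module A G] [AddCommGroup Y] [Module A Y]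
  {M : Matrix (Fin m) (Fin n) A} {g : Fin m → G} (hM : IsPresentation M g)

include hM

lemma IsPresentation.span_eq_top : Submodule.span A (Set.range g) = ⊤ := by
  rw [← Fintype.range_linearCombination, LinearMap.range_eq_top]
  exact hM.surjective

lemma IsPresentation.hom_ext {φ ψ : G →ₗ[A] Y} (h : ∀ i, φ (g i) = ψ (g i)) : φ = ψ :=
  LinearMap.ext_on_range hM.span_eq_top h

lemma IsPresentation.nonempty_equiv : Nonempty (Cok M ≃ₗ[A] G) := by
  have h : LinearMap.range (mact M A) = LinearMap.ker (Fintype.linearCombination A g) := by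
    ext v
    rw [LinearMap.mem_ker]
    exact (hM.exact v).symm
  exact ⟨(Submodule.quotEquivOfEq _ _ h).trans
    ((Fintype.linearCombination A g).quotKerEquivOfSurjective hM.surjective)⟩

lemma IsPresentation.exists_hom {y : Fin m → Y} (hy : mact Mᵀ Y y = 0) :
    ∃ φ : G →ₗ[A] Y, ∀ i, φ (g i) = y i := by
  have : LinearMap.ker (Fintype.linearCombination A g) ≤
      LinearMap.ker (Fintype.linearCombination A y) := by
    intro v hv
    obtain ⟨u, rfl⟩ := (hM.exact v).mp hv
    rw [LinearMap.mem_ker, linearCombination_mact, hy, linearCombination_eq_zero_iff.mpr rfl,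
      LinearMap.zero_apply]
  refine ⟨((LinearMap.ker (Fintype.linearCombination A g)).liftQ _ this) ∘ₗ
    ((Fintype.linearCombination A g).quotKerEquivOfSurjective hM.surjective).symm.toLinearMap,
    fun i => ?_⟩
  have hg : g i = (Fintype.linearCombination A g).quotKerEquivOfSurjective hM.surjective
      (Submodule.Quotient.mk (Pi.single i 1)) := by
    simp [LinearMap.quotKerEquivOfSurjective]
  rw [LinearMap.comp_apply, hg, LinearEquiv.coe_coe, LinearEquiv.symm_apply_apply,
    Submodule.liftQ_apply]
  simp

lemma IsPresentation.mact_transpose_apply (φ : G →ₗ[A] Y) : mact Mᵀ Y (φ ∘ g) = 0 := by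
  rw [← linearCombination_eq_zero_iff (A := A)]
  ext1 j
  ext1
  rw [LinearMap.comp_apply, ← linearCombination_mact]
  have := hM.exact.apply_apply_eq_zero (LinearMap.single A (fun _ => A) j 1)
  simp only [Fintype.linearCombination_apply, comp_apply, ← map_smul, ← map_sum] at this ⊢
  rw [this]
  simp

lemma IsPresentation.exists_dual {L : Matrix (Fin m) (Fin l) A} {L' : Matrix (Fin l) (Fin q) A}
    (hL : MExact A Mᵀ L) (hL' : MExact A L L') :
    ∃ φ : Fin l → Module.Dual A G, IsPresentation L' φ ∧ ∀ i j, φ j (g i) = L i j := by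
  have hcol : ∀ j, mact Mᵀ A (fun i => L i j) = 0 := by
    intro j
    rw [show (fun i => L i j) = mact L A (Pi.single j 1) by
      ext i; simp [mact_apply, Pi.single_apply]]
    exact hL.apply_apply_eq_zero _
  choose φ hφ using fun j => hM.exists_hom (hcol j)
  have key : ∀ u i, Fintype.linearCombination A φ u (g i) = mact L A u i := by
    intro u i
    simp [Fintype.linearCombination_apply, mact_apply, hφ, mul_comm, LinearMap.sum_apply]
  refine ⟨φ, ⟨fun u => ?_, fun ψ => ?_⟩, fun i j => hφ j i⟩
  · refine Iff.trans ⟨fun hu => ?_, fun hu => ?_⟩ (hL' u)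
    · ext i
      rw [← key, hu]
      rfl
    · refine hM.hom_ext fun i => ?_
      rw [key, hu]
      rfl
  · obtain ⟨u, hu⟩ := (hL (ψ ∘ g)).mp (hM.mact_transpose_apply ψ)
    refine ⟨u, hM.hom_ext fun i => ?_⟩
    rw [key, hu]
    rfl

end Presentation

lemma exists_isPresentation [IsNoetherianRing A] (G : Type) [AddCommGroup G] [Module A G]
    [Module.Finite A G] :
    ∃ (m n : ℕ) (M : Matrix (Fin m) (Fin n) A) (g : Fin m → G), IsPresentation M g := by
  obtain ⟨m, g, hg⟩ := Module.Finite.exists_fin (R := A) (M := G)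
  have hsurj : Surjective (Fintype.linearCombination A g) := by
    rw [← LinearMap.range_eq_top, Fintype.range_linearCombination, hg]
  obtain ⟨n, r, hr⟩ := Submodule.fg_iff_exists_fin_generating_family.mp
    (IsNoetherian.noetherian (LinearMap.ker (Fintype.linearCombination A g)))
  refine ⟨m, n, Matrix.of fun i j => r j i, g, fun v => ?_, hsurj⟩
  rw [← LinearMap.mem_ker, ← hr, Submodule.mem_span_range_iff_exists_fun]
  refine exists_congr fun u => ?_
  rw [show mact (Matrix.of fun i j => r j i) A u = ∑ j, u j • r j by
    ext i; simp [mact_apply, mul_comm]]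

lemma trc_of_isReflexive [IsNoetherianRing A] (G : Type) [AddCommGroup G] [Module A G]
    [Module.Finite A G] [Module.IsReflexive A G] (h₁ : ∀ i, ExtVan A G A (i + 1))
    (h₂ : ∀ i, ExtVan A (Module.Dual A G) A (i + 1)) : TRc A G := by
  obtain ⟨m, n, M, g, hM⟩ := exists_isPresentation (A := A) G
  obtain ⟨l, L, hL⟩ := exists_mexact Mᵀ
  obtain ⟨q, L', hL'⟩ := exists_mexact L
  obtain ⟨φ, hφ, hφL⟩ := hM.exists_dual hL hL'
  have hbij := Module.bijective_dual_eval A G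
  have hlc : ∀ v j, φ j (Fintype.linearCombination A g v) = mact Lᵀ A v j := by
    intro v j
    simp [Fintype.linearCombination_apply, mact_apply, hφL, mul_comm]
  have ha : MExact A Lᵀ M := by
    refine .of_forall_mem_range (mact_mact_transpose hL) fun v hv => ?_
    refine (hM.exact v).mp (hbij.1 ?_)
    rw [map_zero]
    refine hφ.hom_ext fun j => ?_
    rw [Module.Dual.eval_apply, hlc, hv]
    rfl
  have hb : MExact A L'ᵀ Lᵀ := by
    refine .of_forall_mem_range (mact_mact_transpose hL') fun w hw => ?_
    obtain ⟨Φ, hΦ⟩ := hφ.exists_hom hw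
    obtain ⟨x, hx⟩ := hbij.2 Φ
    obtain ⟨v, rfl⟩ := hM.surjective x
    refine ⟨v, funext fun j => ?_⟩
    rw [← hlc, ← hΦ, ← hx, Module.Dual.eval_apply]
  refine ⟨_, isTotallyAcyclic_extVan, m, n, M, g, fun i => ⟨?_, ?_⟩, hM⟩
  · exact (h₁ i).congr hM.nonempty_equiv.some.symm
  · match i with
    | 0 => exact hL.extVan_one ha
    | 1 => exact hL.extVan_succ (hL'.extVan_one hb)
    | i + 2 => exact hL.extVan_succ (hL'.extVan_succ ((h₂ i).congr hφ.nonempty_equiv.some.symm))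

lemma TotallyReflexive.trc [IsNoetherianRing A] {G : ModuleCat.{0} A} (h : TotallyReflexive A G) :
    TRc A G := by
  obtain ⟨h₀, h₁, h₂⟩ := h
  refine trc_of_isReflexive G (fun i => ?_) fun i => ?_
  · have := (h₂ (i + 1) i.succ_pos).1
    exact (extEquiv (projectiveResolution G) (ModuleCat.of A A) (i + 1)).symm.subsingleton
  · have := (h₂ (i + 1) i.succ_pos).2
    exact (extEquiv (projectiveResolution _) (ModuleCat.of A A) (i + 1)).symm.subsingleton

lemma GdimLE.gdc [IsNoetherianRing A] {n : ℕ} {N : ModuleCat.{0} A} (h : GdimLE A n N) :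
    GDc A n N := by
  induction n generalizing N with
  | zero => exact TotallyReflexive.trc h
  | succ n ih =>
    obtain ⟨G, f, hf, hG, hX⟩ := h
    exact ⟨LinearMap.ker f, G, inferInstance, inferInstance, inferInstance, inferInstance,
      (LinearMap.ker f).subtype, f, Subtype.val_injective, LinearMap.exact_subtype_ker_map f, hf,
      hG.trc, ih hX⟩

end TotallyAcyclic

section DepthZero

open Function
open scoped Matrix

variable {A : Type} [CommRing A]

lemma TRc.finite {G : Type} [AddCommGroup G] [Module A G] (hG : TRc A G) : Module.Finite A G := by
  obtain ⟨-, -, m, n, M, g, -, hM⟩ := hG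
  exact Module.Finite.of_surjective _ hM.surjective

lemma TRc.bijective_dual_eval_and_extVan {G : Type} [AddCommGroup G] [Module A G]
    (hG : TRc A G) : Bijective (Module.Dual.eval A G) ∧
      ∀ i, ExtVan A (Module.Dual A G) A (i + 1) := by
  obtain ⟨𝒮, hS, m, n, M, g, hMS, hM⟩ := hG
  obtain ⟨l, P, hPS, hP, hP'⟩ := hS.pred hMS
  obtain ⟨q, Q, hQS, hQ, hQ'⟩ := hS.pred hPS
  obtain ⟨φ, hφ, hφP⟩ := hM.exists_dual hP' hQ'
  have hlc : ∀ v j, φ j (Fintype.linearCombination A g v) = mact P A v j := by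
    intro v j
    simp [Fintype.linearCombination_apply, mact_apply, hφP, mul_comm]
  refine ⟨⟨?_, fun Φ => ?_⟩,
    fun i => (hS.extVan (hS.transpose hQS) i).congr hφ.nonempty_equiv.some⟩
  · rw [injective_iff_map_eq_zero]
    intro x hx
    obtain ⟨v, rfl⟩ := hM.surjective x
    refine (hM.exact v).mpr ((hP v).mp (funext fun j => ?_))
    rw [← hlc, ← Module.Dual.eval_apply, hx]
    rfl
  · obtain ⟨v, hv⟩ := (hQ (Φ ∘ φ)).mp (hφ.mact_transpose_apply Φ)
    refine ⟨Fintype.linearCombination A g v, hφ.hom_ext fun j => ?_⟩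
    rw [Module.Dual.eval_apply, hlc, hv]
    rfl

/-- A finite module all of whose maximal submodules agree is cyclic. -/
lemma exists_span_singleton_eq_top {T : Type} [AddCommGroup T] [Module A T] [Module.Finite A T]
    (h : ∀ K L : Submodule A T, IsCoatom K → IsCoatom L → K = L) :
    ∃ t : T, Submodule.span A {t} = ⊤ := by
  rcases eq_top_or_exists_le_coatom (⊥ : Submodule A T) with h₀ | ⟨K, hK, -⟩
  · exact ⟨0, by rw [Submodule.span_zero_singleton, h₀]⟩
  · obtain ⟨t, -, ht⟩ := SetLike.exists_of_lt (lt_top_iff_ne_top.mpr hK.1)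
    refine ⟨t, (eq_top_or_exists_le_coatom _).resolve_right ?_⟩
    rintro ⟨L, hL, htL⟩
    exact ht (h L K hL hK ▸ htL (Submodule.mem_span_singleton_self t))

variable [IsLocalRing A]

/-- Elements killed by the maximal ideal as maps from the residue field. -/
def socHom (Y : Type) [AddCommGroup Y] [Module A Y] :
    Submodule.torsionBySet A Y (maximalIdeal A) →ₗ[A] ((A ⧸ maximalIdeal A) →ₗ[A] Y) where
  toFun y := (maximalIdeal A).liftQ (LinearMap.toSpanSingleton A Y y) fun r hr =>
    (Submodule.mem_torsionBySet_iff _ _).mp y.2 ⟨r, hr⟩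
  map_add' y z := by
    refine Submodule.linearMap_qext _ (LinearMap.ext fun r => ?_)
    exact smul_add r (y : Y) z
  map_smul' c y := by
    refine Submodule.linearMap_qext _ (LinearMap.ext fun r => ?_)
    exact smul_comm r c (y : Y)

lemma socHom_apply_mk {Y : Type} [AddCommGroup Y] [Module A Y]
    (y : Submodule.torsionBySet A Y (maximalIdeal A)) (r : A) :
    socHom Y y (Ideal.Quotient.mk _ r) = r • (y : Y) := rfl

lemma exists_ker_eq_of_isCoatom {T : Type} [AddCommGroup T] [Module A T] {K : Submodule A T}
    (hK : IsCoatom K) : ∃ θ : T →ₗ[A] A ⧸ maximalIdeal A, LinearMap.ker θ = K ∧ Surjective θ := by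
  obtain ⟨I, hI, ⟨e⟩⟩ := isSimpleModule_iff_quot_maximal.mp (isSimpleModule_iff_isCoatom.mpr hK)
  obtain rfl := eq_maximalIdeal hI
  refine ⟨e.toLinearMap ∘ₗ K.mkQ, ?_, e.surjective.comp K.mkQ_surjective⟩
  rw [LinearMap.ker_comp, LinearEquiv.ker, ← LinearMap.ker, Submodule.ker_mkQ]

lemma exists_surjective_residue (T : Type) [AddCommGroup T] [Module A T] [Module.Finite A T]
    [Nontrivial T] : ∃ θ : T →ₗ[A] A ⧸ maximalIdeal A, Surjective θ := by
  obtain ⟨K, hK, -⟩ := (eq_top_or_exists_le_coatom (⊥ : Submodule A T)).resolve_left bot_ne_top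
  obtain ⟨θ, -, hθ⟩ := exists_ker_eq_of_isCoatom hK
  exact ⟨θ, hθ⟩

lemma exists_socHom_apply_eq {T Y : Type} [AddCommGroup T] [Module A T] [AddCommGroup Y]
    [Module A Y] {θ : T →ₗ[A] A ⧸ maximalIdeal A} (hθ : Surjective θ) :
    ∃ t, ∀ y, (socHom Y y) (θ t) = y := by
  obtain ⟨t, ht⟩ := hθ (Ideal.Quotient.mk _ 1)
  exact ⟨t, fun y => by rw [ht, socHom_apply_mk, one_smul]⟩

lemma smul_residue_eq_zero {r : A} (hr : r ∈ maximalIdeal A) (t : A ⧸ maximalIdeal A) :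
    r • t = 0 := by
  obtain ⟨s, rfl⟩ := Ideal.Quotient.mk_surjective t
  exact Ideal.Quotient.eq_zero_iff_mem.mpr (Ideal.mul_mem_right _ _ hr)

variable {N : Type} [AddCommGroup N] [Module A N] (hN : Bijective (Module.Dual.eval A N))

include hN

/-- Over a ring with non-zero socle, elements of the socle of the dual of a module come from maps
to the residue field. -/
lemma exists_eval_eq_socHom (θ : Module.Dual A N →ₗ[A] A ⧸ maximalIdeal A)
    (b : Submodule.torsionBySet A A (maximalIdeal A)) :
    ∃ y : N, (∀ r ∈ maximalIdeal A, r • y = 0) ∧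
      Module.Dual.eval A N y = socHom A b ∘ₗ θ := by
  obtain ⟨y, hy⟩ := hN.2 (socHom A b ∘ₗ θ)
  refine ⟨y, fun r hr => hN.1 ?_, hy⟩
  rw [map_smul, hy, map_zero]
  ext ν
  rw [LinearMap.smul_apply, LinearMap.comp_apply, ← map_smul, smul_residue_eq_zero hr, map_zero,
    LinearMap.zero_apply]

lemma exists_socle_ne_zero [Module.Finite A (Module.Dual A N)] [Nontrivial N]
    {b : A} (hb : b ≠ 0) (hb' : ∀ r ∈ maximalIdeal A, r * b = 0) :
    ∃ y : N, y ≠ 0 ∧ ∀ r ∈ maximalIdeal A, r • y = 0 := by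
  have : Nontrivial (Module.Dual A N) := by
    by_contra h
    rw [not_nontrivial_iff_subsingleton] at h
    obtain ⟨y, hy⟩ := exists_ne (0 : N)
    refine hy (hN.1 (LinearMap.ext fun ν => ?_))
    rw [Subsingleton.elim ν 0, map_zero, map_zero]
  obtain ⟨θ, hθ⟩ := exists_surjective_residue (A := A) (Module.Dual A N)
  obtain ⟨y, hy, hy'⟩ := exists_eval_eq_socHom hN θ
    ⟨b, (Submodule.mem_torsionBySet_iff _ _).mpr fun r => hb' r r.2⟩
  obtain ⟨ν, hν⟩ := exists_socHom_apply_eq (Y := A) hθ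
  refine ⟨y, ?_, hy⟩
  rintro rfl
  refine hb ?_
  have := LinearMap.congr_fun hy' ν
  rw [LinearMap.comp_apply, hν, map_zero] at this
  exact this.symm

/-- If the socle of a reflexive module is one-dimensional, then every endomorphism is a
homothety. -/
lemma exists_forall_apply_eq_smul [Module.Finite A (Module.Dual A N)]
    {b : A} (hb : b ≠ 0) (hb' : ∀ r ∈ maximalIdeal A, r * b = 0)
    (hsoc : ∀ y z : N, (∀ r ∈ maximalIdeal A, r • y = 0) → (∀ r ∈ maximalIdeal A, r • z = 0) →
      ∃ a c : A, ¬ (a ∈ maximalIdeal A ∧ c ∈ maximalIdeal A) ∧ a • y + c • z = 0)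
    (f : N →ₗ[A] N) : ∃ c : A, ∀ y, f y = c • y := by
  have hb'' : b ∈ Submodule.torsionBySet A A (maximalIdeal A) :=
    (Submodule.mem_torsionBySet_iff _ _).mpr fun r => hb' r r.2
  have key : ∀ K L : Submodule A (Module.Dual A N), IsCoatom K → IsCoatom L → ∀ a c : A,
      c ∉ maximalIdeal A → ∀ y z : N, ∀ θ η : Module.Dual A N →ₗ[A] A ⧸ maximalIdeal A,
      LinearMap.ker θ = K → LinearMap.ker η = L →
      Module.Dual.eval A N y = socHom A ⟨b, hb''⟩ ∘ₗ θ →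
      Module.Dual.eval A N z = socHom A ⟨b, hb''⟩ ∘ₗ η → a • y + c • z = 0 → K ≤ L := by
    rintro K L hK hL a c hc y z θ η rfl rfl hy hz h ν hν
    rw [LinearMap.mem_ker] at hν ⊢
    have h₁ := LinearMap.congr_fun hy ν
    have h₂ := LinearMap.congr_fun hz ν
    rw [Module.Dual.eval_apply, LinearMap.comp_apply] at h₁ h₂
    rw [hν, map_zero] at h₁
    have h₃ := congrArg ν h
    rw [map_add, map_smul, map_smul, h₁, h₂, smul_zero, zero_add, map_zero,
      (notMem_maximalIdeal.mp hc).smul_eq_zero] at h₃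
    obtain ⟨s, hs⟩ := Ideal.Quotient.mk_surjective (η ν)
    rw [← hs, socHom_apply_mk] at h₃
    rw [← hs, Ideal.Quotient.eq_zero_iff_mem]
    by_contra hs'
    exact hb ((notMem_maximalIdeal.mp hs').smul_eq_zero.mp h₃)
  obtain ⟨ν, hν⟩ := exists_span_singleton_eq_top (A := A) (T := Module.Dual A N) (by
    intro K L hK hL
    obtain ⟨θ, hθ, -⟩ := exists_ker_eq_of_isCoatom hK
    obtain ⟨η, hη, -⟩ := exists_ker_eq_of_isCoatom hL
    obtain ⟨y, hy, hy'⟩ := exists_eval_eq_socHom hN θ ⟨b, hb''⟩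
    obtain ⟨z, hz, hz'⟩ := exists_eval_eq_socHom hN η ⟨b, hb''⟩
    obtain ⟨a, c, hac, h⟩ := hsoc y z hy hz
    by_cases hc : c ∈ maximalIdeal A
    · have ha : a ∉ maximalIdeal A := fun ha => hac ⟨ha, hc⟩
      have := key L K hL hK c a ha z y η θ hη hθ hz' hy' (by rw [add_comm, h])
      exact (hL.le_iff_eq hK.1).mp this
    · have := key K L hK hL a c hc y z θ η hθ hη hy' hz' h
      exact ((hK.le_iff_eq hL.1).mp this).symm)
  obtain ⟨c, hc⟩ := Submodule.mem_span_singleton.mp (hν ▸ Submodule.mem_top : ν ∘ₗ f ∈ _)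
  refine ⟨c, fun y => hN.1 (LinearMap.ext fun μ => ?_)⟩
  obtain ⟨s, rfl⟩ := Submodule.mem_span_singleton.mp (hν ▸ Submodule.mem_top : μ ∈ _)
  have := LinearMap.congr_fun hc y
  rw [LinearMap.comp_apply, LinearMap.smul_apply] at this
  rw [Module.Dual.eval_apply, Module.Dual.eval_apply, LinearMap.smul_apply, ← this, map_smul,
    LinearMap.smul_apply, smul_comm]

end DepthZero

section DepthZeroResolution

open Function
open scoped Matrix

variable {A : Type} [CommRing A]

lemma GDc.finite {n : ℕ} {N : Type} [AddCommGroup N] [Module A N] (hN : GDc A n N) :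
    Module.Finite A N := by
  cases n with
  | zero => exact TRc.finite hN
  | succ n =>
    obtain ⟨X, G, _, _, _, _, f, g, -, -, hg, hG, -⟩ := hN
    have := hG.finite
    exact Module.Finite.of_surjective g hg


lemma finite_dual [IsNoetherianRing A] (N : Type) [AddCommGroup N] [Module A N]
    [Module.Finite A N] : Module.Finite A (Module.Dual A N) := by
  obtain ⟨m, n, M, g, hM⟩ := exists_isPresentation (A := A) N
  obtain ⟨l, L, hL⟩ := exists_mexact Mᵀ
  obtain ⟨q, L', hL'⟩ := exists_mexact L
  obtain ⟨φ, hφ, -⟩ := hM.exists_dual hL hL'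
  exact Module.Finite.of_surjective _ hφ.surjective

variable [IsLocalRing A]

lemma eq_zero_of_socHom_apply_eq_zero {Y : Type} [AddCommGroup Y] [Module A Y]
    {y : Submodule.torsionBySet A Y (maximalIdeal A)} {t : A ⧸ maximalIdeal A} (ht : t ≠ 0)
    (h : socHom Y y t = 0) : y = 0 := by
  obtain ⟨s, rfl⟩ := Ideal.Quotient.mk_surjective t
  rw [socHom_apply_mk] at h
  rw [Ne, Ideal.Quotient.eq_zero_iff_mem] at ht
  exact Subtype.ext ((notMem_maximalIdeal.mp ht).smul_eq_zero.mp h)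

variable [IsNoetherianRing A]

/-- Over a local ring of depth zero, modules of finite G-dimension are reflexive, and their duals
have no extensions by the ring. -/
lemma GDc.bijective_dual_eval_and_extVan {b : A} (hb : b ≠ 0)
    (hb' : ∀ r ∈ maximalIdeal A, r * b = 0) {n : ℕ} {N : Type} [AddCommGroup N] [Module A N]
    (hN : GDc A n N) : Bijective (Module.Dual.eval A N) ∧
      ∀ i, ExtVan A (Module.Dual A N) A (i + 1) := by
  induction n generalizing N with
  | zero => exact TRc.bijective_dual_eval_and_extVan hN
  | succ n ih =>
    obtain ⟨X, G, _, _, _, _, f, g, hf, hfg, hg, hG, hX⟩ := hN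
    obtain ⟨hX₁, hX₂⟩ := ih hX
    obtain ⟨hG₁, hG₂⟩ := hG.bijective_dual_eval_and_extVan
    have := hX.finite
    have := finite_dual (A := A) X
    have hg' : Injective g.dualMap := LinearMap.dualMap_injective_of_surjective hg
    have hgf : Exact g.dualMap f.dualMap := by
      refine fun γ => ⟨fun hγ => ?_, ?_⟩
      · have hle : LinearMap.ker g ≤ LinearMap.ker γ := by
          intro y hy
          obtain ⟨x, rfl⟩ := (hfg y).mp hy
          exact LinearMap.congr_fun hγ x
        refine ⟨((LinearMap.ker g).liftQ γ hle) ∘ₗ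
          (g.quotKerEquivOfSurjective hg).symm.toLinearMap, LinearMap.ext fun y => ?_⟩
        have : g y = g.quotKerEquivOfSurjective hg (Submodule.Quotient.mk y) := rfl
        rw [LinearMap.dualMap_apply, this, LinearMap.comp_apply, LinearEquiv.coe_coe,
          LinearEquiv.symm_apply_apply, Submodule.liftQ_apply]
      · rintro ⟨ν, rfl⟩
        refine LinearMap.ext fun x => ?_
        rw [LinearMap.dualMap_apply, LinearMap.dualMap_apply, hfg.apply_apply_eq_zero, map_zero,
          LinearMap.zero_apply]
    have hf' : Surjective f.dualMap := by
      rw [← LinearMap.range_eq_top]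
      by_contra hT
      have : Nontrivial (Module.Dual A X ⧸ LinearMap.range f.dualMap) :=
        Submodule.Quotient.nontrivial_iff.mpr hT
      obtain ⟨θ, hθ⟩ :=
        exists_surjective_residue (A := A) (Module.Dual A X ⧸ LinearMap.range f.dualMap)
      obtain ⟨t, ht⟩ := exists_socHom_apply_eq (Y := A) hθ
      obtain ⟨t, rfl⟩ := Submodule.mkQ_surjective _ t
      obtain ⟨x, hx⟩ := hX₁.2 (socHom A ⟨b, (Submodule.mem_torsionBySet_iff _ _).mpr
        fun r => hb' r r.2⟩ ∘ₗ θ ∘ₗ (LinearMap.range f.dualMap).mkQ)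
      have hx₀ : f x = 0 := by
        refine hG₁.1 (LinearMap.ext fun γ => ?_)
        have := LinearMap.congr_fun hx (f.dualMap γ)
        rw [LinearMap.comp_apply, LinearMap.comp_apply, Submodule.mkQ_apply,
          (Submodule.Quotient.mk_eq_zero _).mpr (LinearMap.mem_range_self _ _), map_zero,
          map_zero] at this
        rw [map_zero]
        exact this
      have := LinearMap.congr_fun hx t
      rw [LinearMap.comp_apply, LinearMap.comp_apply, ht,
        (map_eq_zero_iff f hf).mp hx₀, map_zero] at this
      exact hb this.symm
    refine ⟨⟨?_, fun Φ => ?_⟩,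
      fun i => ExtVan.of_exact hg' hgf hf' (hG₂ i) (hX₂ (i + 1))⟩
    · rw [injective_iff_map_eq_zero]
      intro z hz
      obtain ⟨y, rfl⟩ := hg z
      have hle : LinearMap.ker f.dualMap ≤ LinearMap.ker (Module.Dual.eval A G y) := by
        intro γ hγ
        obtain ⟨ν, rfl⟩ := (hgf γ).mp hγ
        exact LinearMap.congr_fun hz ν
      obtain ⟨x, hx⟩ := hX₁.2 (((LinearMap.ker f.dualMap).liftQ _ hle) ∘ₗ
          (f.dualMap.quotKerEquivOfSurjective hf').symm.toLinearMap)
      have : y = f x := by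
        refine hG₁.1 (LinearMap.ext fun γ => ?_)
        have h := LinearMap.congr_fun hx (f.dualMap γ)
        have h' : f.dualMap γ =
          f.dualMap.quotKerEquivOfSurjective hf' (Submodule.Quotient.mk γ) := rfl
        nth_rw 2 [h'] at h
        rw [LinearMap.comp_apply, LinearEquiv.coe_coe,
          LinearEquiv.symm_apply_apply, Submodule.liftQ_apply] at h
        exact h.symm
      rw [this, hfg.apply_apply_eq_zero]
    · obtain ⟨β, hβ⟩ := ExtVan.exists_extension hg' hgf hf' (hX₂ 0) Φ
      obtain ⟨y, rfl⟩ := hG₁.2 β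
      exact ⟨g y, hβ⟩

/-- A finite reflexive module with non-zero socle over a local ring such that all its endomorphisms
are homotheties is cyclic. -/
lemma exists_span_singleton_eq_top_of_forall_end {N : Type} [AddCommGroup N] [Module A N]
    [Module.Finite A N] (hN : Bijective (Module.Dual.eval A N))
    (hend : ∀ f : N →ₗ[A] N, ∃ c : A, ∀ y, f y = c • y)
    (hfaith : ∀ c : A, (∀ y : N, c • y = 0) → c = 0) {z : N} (hz : z ≠ 0)
    (hz' : ∀ r ∈ maximalIdeal A, r • z = 0) : ∃ t : N, Submodule.span A {t} = ⊤ := by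
  let soc : ∀ Y : Type, [AddCommGroup Y] → [Module A Y] → Submodule A Y :=
    fun Y _ _ => Submodule.torsionBySet A Y (maximalIdeal A)
  have hsoc : ∀ {Y : Type} [AddCommGroup Y] [Module A Y] {y : Y},
      y ∈ soc Y ↔ ∀ r ∈ maximalIdeal A, r • y = 0 := by
    intro Y _ _ y
    exact (Submodule.mem_torsionBySet_iff _ _).trans ⟨fun h r hr => h ⟨r, hr⟩, fun h r => h r r.2⟩
  have hlsmul : Bijective (LinearMap.lsmul A N) := by
    refine ⟨(injective_iff_map_eq_zero _).mpr fun c hc => hfaith c (LinearMap.congr_fun hc),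
      fun f => ?_⟩
    obtain ⟨c, hc⟩ := hend f
    exact ⟨c, LinearMap.ext fun y => (hc y).symm⟩
  let e := LinearEquiv.ofBijective _ hlsmul
  let σ : (N →ₗ[A] A ⧸ maximalIdeal A) → (soc N →ₗ[A] soc A) := fun θ =>
    (e.symm.toLinearMap ∘ₗ LinearMap.lcomp A N θ ∘ₗ socHom N).codRestrict (soc A) fun y => by
      refine hsoc.mpr fun r hr => ?_
      rw [← map_smul, show r • y = 0 from Subtype.ext (hsoc.mp y.2 r hr), map_zero]
  have hσ : ∀ θ y, e (σ θ y) = socHom N y ∘ₗ θ := fun θ y => e.apply_symm_apply _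
  have : Nontrivial N := ⟨z, 0, hz⟩
  obtain ⟨θ₀, hθ₀⟩ := exists_surjective_residue (A := A) N
  have hS : Nontrivial (soc A) := by
    refine ⟨σ θ₀ ⟨z, hsoc.mpr hz'⟩, 0, fun h => hz ?_⟩
    have := hσ θ₀ ⟨z, hsoc.mpr hz'⟩
    obtain ⟨t, ht⟩ := exists_socHom_apply_eq (Y := N) hθ₀
    rw [h, ZeroMemClass.coe_zero, map_zero] at this
    exact (ht _).symm.trans (LinearMap.congr_fun this t).symm
  have := finite_dual (A := A) N
  have : Nontrivial (Module.Dual A N) := by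
    by_contra h
    rw [not_nontrivial_iff_subsingleton] at h
    refine hz (hN.1 (LinearMap.ext fun ν => ?_))
    rw [Subsingleton.elim ν 0, map_zero, map_zero]
  obtain ⟨τ, hτ⟩ := exists_surjective_residue (A := A) (Module.Dual A N)
  let E := LinearEquiv.ofBijective _ hN
  let α : soc A →ₗ[A] soc N :=
    (E.symm.toLinearMap ∘ₗ LinearMap.lcomp A A τ ∘ₗ socHom A).codRestrict (soc N) fun y => by
      refine hsoc.mpr fun r hr => ?_
      rw [← map_smul, show r • y = 0 from Subtype.ext (hsoc.mp y.2 r hr), map_zero]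
  have hα : ∀ b, α b = 0 → b = 0 := by
    intro b hb
    have h : E (α b) = socHom A b ∘ₗ τ := E.apply_symm_apply _
    obtain ⟨ν, hν⟩ := exists_socHom_apply_eq (Y := A) hτ
    rw [hb, ZeroMemClass.coe_zero, map_zero] at h
    exact Subtype.ext ((hν b).symm.trans (LinearMap.congr_fun h ν).symm)
  refine exists_span_singleton_eq_top fun K L hK hL => ?_
  by_contra hKL
  obtain ⟨θ, rfl, -⟩ := exists_ker_eq_of_isCoatom hK
  obtain ⟨η, rfl, -⟩ := exists_ker_eq_of_isCoatom hL
  refine not_subsingleton (soc A) (IsNoetherian.subsingleton_of_prod_injective (R := A)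
    (LinearMap.coprod (σ θ ∘ₗ α) (σ η ∘ₗ α)) ((injective_iff_map_eq_zero _).mpr ?_))
  rintro ⟨b, c⟩ hbc
  have h : socHom N (α b) ∘ₗ θ + socHom N (α c) ∘ₗ η = 0 := by
    rw [← hσ, ← hσ, ← map_add, ← Submodule.coe_add]
    exact (congrArg (fun x : soc A => e x) hbc).trans (map_zero e)
  obtain ⟨μ, hμ, hμ'⟩ := SetLike.not_le_iff_exists.mp fun hle =>
    hKL ((hK.le_iff_eq hL.1).mp hle).symm
  obtain ⟨ν, hν, hν'⟩ := SetLike.not_le_iff_exists.mp fun hle =>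
    hKL ((hL.le_iff_eq hK.1).mp hle)
  have h₁ := LinearMap.congr_fun h μ
  have h₂ := LinearMap.congr_fun h ν
  rw [LinearMap.add_apply, LinearMap.comp_apply, LinearMap.comp_apply,
    LinearMap.zero_apply] at h₁ h₂
  rw [LinearMap.mem_ker.mp hμ, map_zero, zero_add] at h₁
  rw [LinearMap.mem_ker.mp hν, map_zero, add_zero] at h₂
  exact Prod.ext (hα b (eq_zero_of_socHom_apply_eq_zero hν' h₂))
    (hα c (eq_zero_of_socHom_apply_eq_zero hμ' h₁))

end DepthZeroResolution

section BaseChange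

open Function
open scoped Matrix

variable {A : Type} [CommRing A] {l m n q : ℕ}

lemma mact_map_algebraMap {B : Type} [CommRing B] [Algebra A B] {Y : Type} [AddCommGroup Y]
    [Module A Y] [Module B Y] [IsScalarTower A B Y] (M : Matrix (Fin m) (Fin n) A)
    (v : Fin n → Y) : mact (M.map (algebraMap A B)) Y v = mact M Y v := by
  ext i; simp [mact_apply]

lemma mexact_map_algebraMap_iff {B : Type} [CommRing B] [Algebra A B] {Y : Type} [AddCommGroup Y]
    [Module A Y] [Module B Y] [IsScalarTower A B Y] {M : Matrix (Fin m) (Fin n) A}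
    {K : Matrix (Fin n) (Fin q) A} :
    MExact Y (M.map (algebraMap A B)) (K.map (algebraMap A B)) ↔ MExact Y M K := by
  simp only [MExact, Exact, mact_map_algebraMap, Set.mem_range]

lemma IsTotallyAcyclic.baseChange {B : Type} [CommRing B] [Algebra A B]
    {𝒮 : ∀ m n : ℕ, Matrix (Fin m) (Fin n) A → Prop} (hS : IsTotallyAcyclic 𝒮)
    (h : ∀ {m n q : ℕ} {M : Matrix (Fin m) (Fin n) A} {K : Matrix (Fin n) (Fin q) A}, 𝒮 m n M →
      MExact A M K → MExact B M K) :
    IsTotallyAcyclic fun (m n : ℕ) (M' : Matrix (Fin m) (Fin n) B) =>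
      ∃ M : Matrix (Fin m) (Fin n) A, 𝒮 m n M ∧ M' = M.map (algebraMap A B) where
  transpose := by
    rintro m n _ ⟨M, hM, rfl⟩
    exact ⟨Mᵀ, hS.transpose hM, Matrix.transpose_map.symm⟩
  succ := by
    rintro m n _ ⟨M, hM, rfl⟩
    obtain ⟨q, K, hK, h₁, h₂⟩ := hS.succ hM
    refine ⟨q, K.map (algebraMap A B), ⟨K, hK, rfl⟩, mexact_map_algebraMap_iff.mpr (h hM h₁), ?_⟩
    rw [← Matrix.transpose_map, ← Matrix.transpose_map]
    exact mexact_map_algebraMap_iff.mpr (h (hS.transpose hK) h₂)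

section Localization

variable (S : Submonoid A)

lemma map_mact_localizedModule {Y Y' : Type} [AddCommGroup Y] [Module A Y] [AddCommGroup Y']
    [Module A Y'] (f : Y →ₗ[A] Y') [IsLocalizedModule S f] (M : Matrix (Fin m) (Fin n) A) :
    IsLocalizedModule.map S (.pi fun i : Fin n => f ∘ₗ .proj i) (.pi fun i : Fin m => f ∘ₗ .proj i)
      (mact M Y) = mact M Y' := by
  refine IsLocalizedModule.ext S (.pi fun i : Fin n => f ∘ₗ .proj i)
    (IsLocalizedModule.map_units (.pi fun i : Fin m => f ∘ₗ .proj i)) ?_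
  rw [IsLocalizedModule.map_comp]
  ext1 j
  ext1 y
  exact (mact_map M f _).symm

lemma MExact.of_isLocalizedModule {Y Y' : Type} [AddCommGroup Y] [Module A Y] [AddCommGroup Y']
    [Module A Y'] (f : Y →ₗ[A] Y') [IsLocalizedModule S f] {M : Matrix (Fin m) (Fin n) A}
    {K : Matrix (Fin n) (Fin q) A} (h : MExact Y M K) : MExact Y' M K := by
  have := IsLocalizedModule.map_exact S (.pi fun i : Fin q => f ∘ₗ .proj i)
    (.pi fun i : Fin n => f ∘ₗ .proj i) (.pi fun i : Fin m => f ∘ₗ .proj i) _ _ h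
  rwa [map_mact_localizedModule, map_mact_localizedModule] at this

lemma IsPresentation.localization {G : Type} [AddCommGroup G] [Module A G]
    {M : Matrix (Fin m) (Fin n) A} {g : Fin m → G} (hM : IsPresentation M g) :
    IsPresentation (M.map (algebraMap A (Localization S)))
      (fun i => LocalizedModule.mkLinearMap S G (g i)) := by
  let π (k : ℕ) : (Fin k → A) →ₗ[A] (Fin k → Localization S) :=
    .pi fun i : Fin k => (Algebra.linearMap A (Localization S)) ∘ₗ .proj i
  have hπ (k : ℕ) : IsLocalizedModule S (π k) := by infer_instance
  have hlc : IsLocalizedModule.map S (π m) (LocalizedModule.mkLinearMap S G)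
      (Fintype.linearCombination A g) = (Fintype.linearCombination (Localization S)
        fun i => LocalizedModule.mkLinearMap S G (g i)).restrictScalars A := by
    refine IsLocalizedModule.ext S (π m)
      (IsLocalizedModule.map_units (LocalizedModule.mkLinearMap S G)) ?_
    rw [IsLocalizedModule.map_comp]
    ext1 j
    ext1
    simp [π, Fintype.linearCombination_apply]
  refine ⟨fun v => ?_, fun y => ?_⟩
  · have := IsLocalizedModule.map_exact S (π n) (π m) (LocalizedModule.mkLinearMap S G) _ _ hM.exact
    rw [hlc, map_mact_localizedModule] at this
    refine (this v).trans ?_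
    simp only [Set.mem_range, mact_map_algebraMap]
  · have := IsLocalizedModule.map_surjective S (π m) (LocalizedModule.mkLinearMap S G) _
      hM.surjective
    rw [hlc] at this
    exact this y

lemma TRc.localization {G : Type} [AddCommGroup G] [Module A G] (hG : TRc A G) :
    TRc (Localization S) (LocalizedModule S G) := by
  obtain ⟨𝒮, hS, m, n, M, g, hMS, hM⟩ := hG
  exact ⟨_, hS.baseChange fun _ h =>
      h.of_isLocalizedModule S (Algebra.linearMap A (Localization S)),
    m, n, _, _, ⟨M, hMS, rfl⟩, hM.localization S⟩

lemma GDc.localization {n : ℕ} {N : Type} [AddCommGroup N] [Module A N] (hN : GDc A n N) :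
    GDc (Localization S) n (LocalizedModule S N) := by
  induction n generalizing N with
  | zero => exact TRc.localization S hN
  | succ n ih =>
    obtain ⟨X, G, _, _, _, _, f, g, hf, hfg, hg, hG, hX⟩ := hN
    exact ⟨LocalizedModule S X, LocalizedModule S G, inferInstance, inferInstance, inferInstance,
      inferInstance, LocalizedModule.map S f, LocalizedModule.map S g,
      LocalizedModule.map_injective S f hf, LocalizedModule.map_exact S f g hfg,
      LocalizedModule.map_surjective S g hg, hG.localization S, ih hX⟩

end Localization

section Quotient

variable {x : A}

lemma exists_smul_eq_of_mem_smul_top {Y : Type} [AddCommGroup Y] [Module A Y] {y : Y}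
    (hy : y ∈ x • (⊤ : Submodule A Y)) : ∃ y', x • y' = y := by
  obtain ⟨y', -, h⟩ := (Submodule.mem_smul_pointwise_iff_exists _ _ _).mp hy
  exact ⟨y', h⟩

lemma MExact.of_surjective {Y Y' : Type} [AddCommGroup Y] [Module A Y] [AddCommGroup Y']
    [Module A Y'] {π : Y →ₗ[A] Y'} (hπ : Surjective π)
    (hker : ∀ y, π y = 0 ↔ ∃ y', x • y' = y) {M : Matrix (Fin m) (Fin n) A}
    {K : Matrix (Fin n) (Fin q) A} (h : MExact Y M K)
    (hsat : ∀ (v : Fin n → Y) (w : Fin m → Y), mact M Y v = x • w → ∃ v', w = mact M Y v') :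
    MExact Y' M K := by
  have hlift : ∀ {k : ℕ} (v : Fin k → Y'), ∃ u : Fin k → Y, π ∘ u = v := by
    intro k v
    choose u hu using fun i => hπ (v i)
    exact ⟨u, funext hu⟩
  refine .of_forall_mem_range (fun v => ?_) fun v hv => ?_
  · obtain ⟨u, rfl⟩ := hlift v
    rw [mact_map, mact_map, h.apply_apply_eq_zero]
    ext; simp
  · obtain ⟨u, rfl⟩ := hlift v
    rw [mact_map] at hv
    choose w hw using fun i => (hker _).mp (congrFun hv i)
    obtain ⟨v', hv'⟩ := hsat u w (funext fun i => (hw i).symm)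
    obtain ⟨z, hz⟩ := (h (u - x • v')).mp (by
      rw [map_sub, map_smul, ← hv']
      ext i
      simp [hw])
    refine ⟨π ∘ z, ?_⟩
    rw [mact_map, hz]
    ext i
    simp only [comp_apply, Pi.sub_apply, Pi.smul_apply, map_sub, sub_eq_self]
    exact (hker _).mpr ⟨_, rfl⟩

lemma MExact.exists_eq_mact_of_eq_smul {Y : Type} [AddCommGroup Y] [Module A Y]
    {P : Matrix (Fin l) (Fin m) A} {M : Matrix (Fin m) (Fin n) A} (h : MExact Y P M)
    (hx : IsSMulRegular Y x) (v : Fin n → Y) (w : Fin m → Y) (hv : mact M Y v = x • w) :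
    ∃ v', w = mact M Y v' := by
  have : mact P Y w = 0 := by
    have h' := h.apply_apply_eq_zero v
    rw [hv, map_smul] at h'
    ext i
    exact hx (by simpa using congrFun h' i)
  obtain ⟨v', hv'⟩ := (h w).mp this
  exact ⟨v', hv'.symm⟩

lemma algebraMap_quotient_eq_zero_iff (a : A) :
    Algebra.linearMap A (A ⧸ Ideal.span {x}) a = 0 ↔ ∃ b, x • b = a := by
  rw [Algebra.linearMap_apply, Ideal.Quotient.algebraMap_eq, Ideal.Quotient.eq_zero_iff_mem,
    Ideal.mem_span_singleton]
  exact exists_congr fun b => eq_comm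

lemma mkQ_smul_top_eq_zero_iff {Y : Type} [AddCommGroup Y] [Module A Y] (y : Y) :
    (x • (⊤ : Submodule A Y)).mkQ y = 0 ↔ ∃ y', x • y' = y := by
  rw [Submodule.mkQ_apply, Submodule.Quotient.mk_eq_zero]
  refine ⟨exists_smul_eq_of_mem_smul_top, ?_⟩
  rintro ⟨y', rfl⟩
  exact Submodule.smul_mem_pointwise_smul _ _ _ Submodule.mem_top

lemma surjective_algebraLinearMap_quotient :
    Surjective (Algebra.linearMap A (A ⧸ Ideal.span {x})) :=
  Ideal.Quotient.mk_surjective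

instance isScalarTower_quotSMulTop (Y : Type) [AddCommGroup Y] [Module A Y] :
    IsScalarTower A (A ⧸ Ideal.span {x}) (QuotSMulTop x Y) :=
  ⟨fun a b y => by
    obtain ⟨b, rfl⟩ := Ideal.Quotient.mk_surjective b
    obtain ⟨y, rfl⟩ := Submodule.mkQ_surjective _ y
    exact congrArg (x • (⊤ : Submodule A Y)).mkQ (mul_smul a b y)⟩

lemma IsPresentation.quotient {G : Type} [AddCommGroup G] [Module A G]
    {M : Matrix (Fin m) (Fin n) A} {g : Fin m → G} (hM : IsPresentation M g) :
    IsPresentation (M.map (algebraMap A (A ⧸ Ideal.span {x})))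
      (fun i => (x • (⊤ : Submodule A G)).mkQ (g i)) := by
  let π := Algebra.linearMap A (A ⧸ Ideal.span {x})
  have hlift : ∀ {k : ℕ} (v : Fin k → A ⧸ Ideal.span {x}), ∃ u : Fin k → A, π ∘ u = v := by
    intro k v
    choose u hu using fun i => surjective_algebraLinearMap_quotient (v i)
    exact ⟨u, funext hu⟩
  have hlc : ∀ u : Fin m → A, Fintype.linearCombination (A ⧸ Ideal.span {x})
      (fun i => (x • (⊤ : Submodule A G)).mkQ (g i)) (π ∘ u) =
        (x • (⊤ : Submodule A G)).mkQ (Fintype.linearCombination A g u) := by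
    intro u
    rw [Fintype.linearCombination_apply, Fintype.linearCombination_apply, map_sum]
    rfl
  refine ⟨fun v => ⟨fun hv => ?_, ?_⟩, fun y => ?_⟩
  · obtain ⟨u, rfl⟩ := hlift v
    rw [hlc, mkQ_smul_top_eq_zero_iff] at hv
    obtain ⟨y, hy⟩ := hv
    obtain ⟨w, rfl⟩ := hM.surjective y
    obtain ⟨z, hz⟩ := (hM.exact (u - x • w)).mp (by rw [map_sub, map_smul, hy, sub_self])
    refine ⟨π ∘ z, ?_⟩
    rw [mact_map_algebraMap, mact_map, hz]
    ext i
    simp only [comp_apply, Pi.sub_apply, Pi.smul_apply, map_sub, sub_eq_self]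
    exact (algebraMap_quotient_eq_zero_iff _).mpr ⟨_, rfl⟩
  · rintro ⟨z, rfl⟩
    obtain ⟨u, rfl⟩ := hlift z
    rw [mact_map_algebraMap, mact_map, hlc, hM.exact.apply_apply_eq_zero, map_zero]
  · obtain ⟨y, rfl⟩ := Submodule.mkQ_surjective _ y
    obtain ⟨u, rfl⟩ := hM.surjective y
    exact ⟨_, hlc u⟩

variable (hx : IsSMulRegular A x)

include hx

lemma TRc.quotient {G : Type} [AddCommGroup G] [Module A G] (hG : TRc A G) :
    TRc (A ⧸ Ideal.span {x}) (QuotSMulTop x G) := by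
  obtain ⟨𝒮, hS, m, n, M, g, hMS, hM⟩ := hG
  refine ⟨_, hS.baseChange fun hM' h => ?_, m, n, _, _, ⟨M, hMS, rfl⟩, hM.quotient⟩
  obtain ⟨_, P, -, hP, -⟩ := hS.pred hM'
  exact h.of_surjective surjective_algebraLinearMap_quotient algebraMap_quotient_eq_zero_iff
    (hP.exists_eq_mact_of_eq_smul hx)

lemma TRc.isSMulRegular {G : Type} [AddCommGroup G] [Module A G] (hG : TRc A G) :
    IsSMulRegular G x := by
  obtain ⟨𝒮, hS, m, n, M, g, hMS, hM⟩ := hG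
  obtain ⟨_, P, -, hP, -⟩ := hS.pred hMS
  rw [isSMulRegular_iff_right_eq_zero_of_smul]
  intro y hy
  obtain ⟨v, rfl⟩ := hM.surjective y
  rw [← map_smul] at hy
  obtain ⟨u, hu⟩ := (hM.exact _).mp hy
  obtain ⟨v', rfl⟩ := hP.exists_eq_mact_of_eq_smul hx u v hu
  exact hM.exact.apply_apply_eq_zero v'

lemma GDc.quotient {n : ℕ} {N : Type} [AddCommGroup N] [Module A N] (hN : GDc A n N)
    (hxN : IsSMulRegular N x) : GDc (A ⧸ Ideal.span {x}) n (QuotSMulTop x N) := by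
  induction n generalizing N with
  | zero => exact TRc.quotient hx hN
  | succ n ih =>
    obtain ⟨X, G, _, _, _, _, f, g, hf, hfg, hg, hG, hX⟩ := hN
    have hxX : IsSMulRegular X x := fun a b hab =>
      hf (hG.isSMulRegular hx (by simpa using congrArg f hab))
    have hfx : Injective (QuotSMulTop.map x f) := by
      rw [injective_iff_map_eq_zero]
      intro a ha
      obtain ⟨a, rfl⟩ := Submodule.mkQ_surjective _ a
      obtain ⟨b, hb⟩ : ∃ b, x • b = f a := (mkQ_smul_top_eq_zero_iff _).mp ha
      have hgb : g b = 0 := hxN (by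
        change x • g b = x • 0
        rw [← map_smul, hb, hfg.apply_apply_eq_zero, smul_zero])
      obtain ⟨c, rfl⟩ := (hfg b).mp hgb
      exact (mkQ_smul_top_eq_zero_iff _).mpr ⟨c, hf (by rw [map_smul, hb])⟩
    exact ⟨QuotSMulTop x X, QuotSMulTop x G, inferInstance, inferInstance, inferInstance,
      inferInstance, (QuotSMulTop.map x f).extendScalarsOfSurjective
        surjective_algebraLinearMap_quotient, (QuotSMulTop.map x g).extendScalarsOfSurjective
        surjective_algebraLinearMap_quotient, hfx, QuotSMulTop.map_exact x hfg hg,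
      QuotSMulTop.map_surjective x hg, hG.quotient hx, ih hX hxX⟩

end Quotient

end BaseChange

section SocleQuotient

open Function

variable {A : Type} [CommRing A] [IsLocalRing A]

lemma span_singleton_ne_top_of_mem_maximalIdeal {x : A} (hx : x ∈ maximalIdeal A) :
    Ideal.span {x} ≠ ⊤ := fun h =>
  hx (Ideal.span_singleton_eq_top.mp h)

lemma nontrivial_quotient_span_singleton {x : A} (hx : x ∈ maximalIdeal A) :
    Nontrivial (A ⧸ Ideal.span {x}) :=
  Ideal.Quotient.nontrivial_iff.mpr (span_singleton_ne_top_of_mem_maximalIdeal hx)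

lemma isLocalRing_quotient_span_singleton {x : A} (hx : x ∈ maximalIdeal A) :
    IsLocalRing (A ⧸ Ideal.span {x}) :=
  have := nontrivial_quotient_span_singleton hx
  IsLocalRing.of_surjective' (Ideal.Quotient.mk (Ideal.span {x})) Ideal.Quotient.mk_surjective

lemma mk_mem_maximalIdeal_iff {x : A} (hx : x ∈ maximalIdeal A)
    [IsLocalRing (A ⧸ Ideal.span {x})] {r : A} :
    Ideal.Quotient.mk (Ideal.span {x}) r ∈ maximalIdeal (A ⧸ Ideal.span {x}) ↔
      r ∈ maximalIdeal A := by
  rw [mem_maximalIdeal, mem_maximalIdeal, mem_nonunits_iff, mem_nonunits_iff, not_iff_not]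
  refine ⟨fun h => ?_, fun h => h.map _⟩
  obtain ⟨s, hs⟩ := isUnit_iff_exists_inv.mp h
  obtain ⟨s, rfl⟩ := Ideal.Quotient.mk_surjective s
  rw [← map_mul, ← sub_eq_zero, ← map_one (Ideal.Quotient.mk (Ideal.span {x})), ← map_sub,
    Ideal.Quotient.eq_zero_iff_mem] at hs
  by_contra hr
  have h1 : (1 : A) ∈ maximalIdeal A := by
    have h₁ := (maximalIdeal A).mul_mem_right s ((mem_maximalIdeal r).mpr hr)
    have h₂ := ((Ideal.span_singleton_le_iff_mem _).mpr hx) hs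
    simpa using sub_mem h₁ h₂
  exact h1 isUnit_one

lemma nontrivial_quotSMulTop {N : Type} [AddCommGroup N] [Module A N] {x : A}
    (hx : x ∈ maximalIdeal A) [Module.Finite A N] [Nontrivial N] :
    Nontrivial (QuotSMulTop x N) := by
  refine Submodule.Quotient.nontrivial_iff.mpr fun h => ?_
  have := Submodule.eq_bot_of_le_smul_of_le_jacobson_bot (Ideal.span {x}) (⊤ : Submodule A N)
    Module.Finite.fg_top (by rw [Submodule.ideal_span_singleton_smul, h])
    ((Ideal.span_singleton_le_iff_mem _).mpr (by
      rwa [jacobson_eq_maximalIdeal ⊥ bot_ne_top]))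
  exact top_ne_bot this

variable [IsNoetherianRing A] {n : ℕ} {N : Type} [AddCommGroup N] [Module A N]

lemma GDc.exists_socle_ne_zero (hN : GDc A n N) {b : A} (hb : b ≠ 0)
    (hb' : ∀ r ∈ maximalIdeal A, r * b = 0) [Nontrivial N] :
    ∃ y : N, y ≠ 0 ∧ ∀ r ∈ maximalIdeal A, r • y = 0 := by
  have := hN.finite
  have := finite_dual (A := A) N
  exact _root_.exists_socle_ne_zero (hN.bijective_dual_eval_and_extVan hb hb').1 hb hb'

lemma GDc.exists_forall_apply_eq_smul (hN : GDc A n N) {b : A} (hb : b ≠ 0)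
    (hb' : ∀ r ∈ maximalIdeal A, r * b = 0)
    (hsoc : ∀ y z : N, (∀ r ∈ maximalIdeal A, r • y = 0) → (∀ r ∈ maximalIdeal A, r • z = 0) →
      ∃ a c : A, ¬ (a ∈ maximalIdeal A ∧ c ∈ maximalIdeal A) ∧ a • y + c • z = 0)
    (f : N →ₗ[A] N) : ∃ c : A, ∀ y, f y = c • y := by
  have := hN.finite
  have := finite_dual (A := A) N
  exact _root_.exists_forall_apply_eq_smul (hN.bijective_dual_eval_and_extVan hb hb').1 hb hb'
    hsoc f

section Quotient

variable {x : A} (hx : x ∈ maximalIdeal A) (hxA : IsSMulRegular A x) (hN : GDc A n N)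
  (hxN : IsSMulRegular N x) {b : A} (hb : b ∉ Ideal.span {x})
  (hb' : ∀ r ∈ maximalIdeal A, r * b ∈ Ideal.span {x})

include hx hxA hN hxN hb hb'

lemma GDc.exists_socle_quotient_ne_zero [Nontrivial N] :
    ∃ y : QuotSMulTop x N, y ≠ 0 ∧ ∀ r ∈ maximalIdeal A, r • y = 0 := by
  have := isLocalRing_quotient_span_singleton hx
  have := hN.finite
  have := nontrivial_quotSMulTop (N := N) hx
  obtain ⟨y, hy, hy'⟩ := (hN.quotient hxA hxN).exists_socle_ne_zero
    (b := Ideal.Quotient.mk _ b) (by rwa [Ne, Ideal.Quotient.eq_zero_iff_mem]) (by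
      intro r hr
      obtain ⟨r, rfl⟩ := Ideal.Quotient.mk_surjective r
      rw [← map_mul, Ideal.Quotient.eq_zero_iff_mem]
      exact hb' r ((mk_mem_maximalIdeal_iff hx).mp hr))
  exact ⟨y, hy, fun r hr => hy' (Ideal.Quotient.mk _ r) ((mk_mem_maximalIdeal_iff hx).mpr hr)⟩

lemma GDc.exists_forall_quotient_apply_eq_smul
    (hsoc : ∀ y z : QuotSMulTop x N, (∀ r ∈ maximalIdeal A, r • y = 0) →
      (∀ r ∈ maximalIdeal A, r • z = 0) →
      ∃ a c : A, ¬ (a ∈ maximalIdeal A ∧ c ∈ maximalIdeal A) ∧ a • y + c • z = 0)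
    (f : QuotSMulTop x N →ₗ[A] QuotSMulTop x N) : ∃ c : A, ∀ y, f y = c • y := by
  have := isLocalRing_quotient_span_singleton hx
  obtain ⟨c, hc⟩ := (hN.quotient hxA hxN).exists_forall_apply_eq_smul
    (b := Ideal.Quotient.mk _ b) (by rwa [Ne, Ideal.Quotient.eq_zero_iff_mem]) (by
      intro r hr
      obtain ⟨r, rfl⟩ := Ideal.Quotient.mk_surjective r
      rw [← map_mul, Ideal.Quotient.eq_zero_iff_mem]
      exact hb' r ((mk_mem_maximalIdeal_iff hx).mp hr)) (by
      intro y z hy hz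
      obtain ⟨a, c, hac, h⟩ := hsoc y z
        (fun r hr => hy (Ideal.Quotient.mk _ r) ((mk_mem_maximalIdeal_iff hx).mpr hr))
        (fun r hr => hz (Ideal.Quotient.mk _ r) ((mk_mem_maximalIdeal_iff hx).mpr hr))
      refine ⟨Ideal.Quotient.mk _ a, Ideal.Quotient.mk _ c, ?_, h⟩
      rwa [mk_mem_maximalIdeal_iff hx, mk_mem_maximalIdeal_iff hx])
    (f.extendScalarsOfSurjective surjective_algebraLinearMap_quotient)
  obtain ⟨c, rfl⟩ := Ideal.Quotient.mk_surjective c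
  exact ⟨c, hc⟩

end Quotient

end SocleQuotient

section PrimeLocalization

open Function

variable {R : Type} [CommRing R]

lemma Submodule.FG.exists_forall_smul_mem {M : Type} [AddCommGroup M] [Module R M]
    {N P : Submodule R M} (hN : N.FG) (S : Submonoid R)
    (h : ∀ y ∈ N, ∃ u ∈ S, u • y ∈ P) : ∃ u ∈ S, ∀ y ∈ N, u • y ∈ P := by
  induction N, hN using Submodule.fg_induction with
  | singleton y =>
    obtain ⟨u, hu, hy⟩ := h y (Submodule.mem_span_singleton_self y)
    refine ⟨u, hu, fun z hz => ?_⟩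
    obtain ⟨c, rfl⟩ := Submodule.mem_span_singleton.mp hz
    rw [smul_comm]
    exact P.smul_mem c hy
  | sup N₁ N₂ _ _ h₁ h₂ =>
    obtain ⟨u₁, hu₁, h₁⟩ := h₁ fun y hy => h y (Submodule.mem_sup_left hy)
    obtain ⟨u₂, hu₂, h₂⟩ := h₂ fun y hy => h y (Submodule.mem_sup_right hy)
    refine ⟨u₁ * u₂, S.mul_mem hu₁ hu₂, fun y hy => ?_⟩
    obtain ⟨y₁, hy₁, y₂, hy₂, rfl⟩ := Submodule.mem_sup.mp hy
    rw [smul_add]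
    refine P.add_mem ?_ ?_
    · rw [mul_comm, mul_smul]
      exact P.smul_mem _ (h₁ y₁ hy₁)
    · rw [mul_smul]
      exact P.smul_mem _ (h₂ y₂ hy₂)

variable (p : Ideal R) [p.IsPrime]

section Descent

variable {Q Q' : Type} [AddCommGroup Q] [Module R Q] [AddCommGroup Q'] [Module R Q']
  [Module (Localization.AtPrime p) Q'] [IsScalarTower R (Localization.AtPrime p) Q']

lemma forall_mem_maximalIdeal_smul_eq_zero_iff (y : Q') :
    (∀ r ∈ maximalIdeal (Localization.AtPrime p), r • y = 0) ↔ ∀ r ∈ p, r • y = 0 := by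
  refine ⟨fun h r hr => ?_, fun h r hr => ?_⟩
  · rw [← algebraMap_smul (Localization.AtPrime p)]
    exact h _ ((IsLocalization.AtPrime.to_map_mem_maximal_iff _ p r).mpr hr)
  · rw [← Localization.AtPrime.map_eq_maximalIdeal] at hr
    have : p.map (algebraMap R (Localization.AtPrime p)) ≤
        LinearMap.ker (LinearMap.toSpanSingleton (Localization.AtPrime p) Q' y) :=
      Ideal.map_le_iff_le_comap.mpr fun r hr => by
        rw [Ideal.mem_comap, LinearMap.mem_ker, LinearMap.toSpanSingleton_apply, algebraMap_smul]
        exact h r hr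
    exact this hr

variable {p} in
lemma smul_eq_zero_of_notMem {t : R} (ht : t ∉ p) {y : Q'} (h : t • y = 0) : y = 0 := by
  rw [← algebraMap_smul (Localization.AtPrime p)] at h
  exact (IsLocalization.map_units (Localization.AtPrime p)
    (⟨t, ht⟩ : p.primeCompl)).smul_eq_zero.mp h

variable [IsNoetherianRing R] {p} {φ : Q →ₗ[R] Q'} (h₁ : ∀ y, ∃ t ∉ p, ∃ z, φ z = t • y)
  (h₂ : ∀ z, φ z = 0 → ∃ t ∉ p, t • z = 0)

include h₁ h₂

lemma exists_apply_eq_smul_of_forall_smul_eq_zero {y : Q'}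
    (hy : ∀ r ∈ maximalIdeal (Localization.AtPrime p), r • y = 0) :
    ∃ t ∉ p, ∃ z, φ z = t • y ∧ ∀ r ∈ p, r • z = 0 := by
  rw [forall_mem_maximalIdeal_smul_eq_zero_iff] at hy
  obtain ⟨t, ht, z, hz⟩ := h₁ y
  have hfg : p.FG := IsNoetherian.noetherian p
  obtain ⟨u, hu, hu'⟩ := Submodule.FG.exists_forall_smul_mem (P := ⊥)
    (Submodule.FG.map (LinearMap.toSpanSingleton R Q z) hfg) p.primeCompl (by
      rintro _ ⟨r, hr, rfl⟩
      obtain ⟨u, hu, h⟩ := h₂ (r • z) (by rw [map_smul, hz, smul_comm, hy r hr, smul_zero])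
      exact ⟨u, hu, h⟩)
  refine ⟨u * t, p.primeCompl.mul_mem hu ht, u • z, by rw [map_smul, hz, mul_smul],
    fun r hr => ?_⟩
  rw [smul_comm]
  exact hu' _ ⟨r, hr, rfl⟩

lemma exists_ne_zero_of_exists_socle (h : ∃ y : Q', y ≠ 0 ∧
    ∀ r ∈ maximalIdeal (Localization.AtPrime p), r • y = 0) :
    ∃ z : Q, z ≠ 0 ∧ ∀ r ∈ p, r • z = 0 := by
  obtain ⟨y, hy, hy'⟩ := h
  obtain ⟨t, ht, z, hz, hz'⟩ := exists_apply_eq_smul_of_forall_smul_eq_zero h₁ h₂ hy'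
  refine ⟨z, ?_, hz'⟩
  rintro rfl
  rw [map_zero] at hz
  exact hy (smul_eq_zero_of_notMem ht hz.symm)

lemma exists_relation_of_forall_exists_relation
    (h : ∀ y z : Q, (∀ r ∈ p, r • y = 0) → (∀ r ∈ p, r • z = 0) →
      ∃ a c : R, ¬ (a ∈ p ∧ c ∈ p) ∧ a • y + c • z = 0) (y z : Q')
    (hy : ∀ r ∈ maximalIdeal (Localization.AtPrime p), r • y = 0)
    (hz : ∀ r ∈ maximalIdeal (Localization.AtPrime p), r • z = 0) :
    ∃ a c : Localization.AtPrime p, ¬ (a ∈ maximalIdeal (Localization.AtPrime p) ∧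
      c ∈ maximalIdeal (Localization.AtPrime p)) ∧ a • y + c • z = 0 := by
  obtain ⟨t, ht, y', hy', hy⟩ := exists_apply_eq_smul_of_forall_smul_eq_zero h₁ h₂ hy
  obtain ⟨u, hu, z', hz', hz⟩ := exists_apply_eq_smul_of_forall_smul_eq_zero h₁ h₂ hz
  obtain ⟨a, c, hac, h⟩ := h y' z' hy hz
  refine ⟨algebraMap R _ (a * t), algebraMap R _ (c * u), ?_, ?_⟩
  · rw [IsLocalization.AtPrime.to_map_mem_maximal_iff _ p,
      IsLocalization.AtPrime.to_map_mem_maximal_iff _ p]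
    exact fun H => hac ⟨(Ideal.IsPrime.mem_or_mem ‹_› H.1).resolve_right ht,
      (Ideal.IsPrime.mem_or_mem ‹_› H.2).resolve_right hu⟩
  · rw [algebraMap_smul, algebraMap_smul, mul_smul, mul_smul, ← hy', ← hz', ← map_smul,
      ← map_smul, ← map_add, h, map_zero]

end Descent

variable {M : Type} [AddCommGroup M] [Module R M]

lemma exists_mkLinearMap_eq_smul (y : LocalizedModule p.primeCompl M) :
    ∃ t ∉ p, ∃ z, LocalizedModule.mkLinearMap p.primeCompl M z = t • y := by
  obtain ⟨⟨z, t⟩, h⟩ := IsLocalizedModule.surj p.primeCompl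
    (LocalizedModule.mkLinearMap p.primeCompl M) y
  exact ⟨t, t.2, z, h.symm⟩

lemma exists_smul_eq_zero_of_mkLinearMap_eq_zero (z : M)
    (hz : LocalizedModule.mkLinearMap p.primeCompl M z = 0) : ∃ t ∉ p, t • z = 0 := by
  obtain ⟨t, ht⟩ := (IsLocalizedModule.eq_zero_iff p.primeCompl
    (LocalizedModule.mkLinearMap p.primeCompl M)).mp hz
  exact ⟨t, t.2, ht⟩

lemma IsSMulRegular.localizedModule {x : R} (hx : IsSMulRegular M x) :
    IsSMulRegular (LocalizedModule p.primeCompl M) (algebraMap R (Localization.AtPrime p) x) := by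
  rw [isSMulRegular_iff_right_eq_zero_of_smul]
  intro y hy
  obtain ⟨t, ht, z, hz⟩ := exists_mkLinearMap_eq_smul p y
  obtain ⟨u, hu, h⟩ := exists_smul_eq_zero_of_mkLinearMap_eq_zero p (x • z) (by
    rw [map_smul, hz, smul_comm, ← algebraMap_smul (Localization.AtPrime p) x, hy, smul_zero])
  rw [smul_comm] at h
  refine smul_eq_zero_of_notMem ht ?_
  refine smul_eq_zero_of_notMem hu ?_
  rw [← hz, ← map_smul, hx.right_eq_zero_of_smul h, map_zero]

lemma IsSMulRegular.algebraMap_localization {x : R} (hx : IsSMulRegular R x) :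
    IsSMulRegular (Localization.AtPrime p) (algebraMap R (Localization.AtPrime p) x) := by
  rw [isSMulRegular_iff_right_eq_zero_of_smul]
  intro y hy
  obtain ⟨⟨z, t⟩, h⟩ := IsLocalization.surj p.primeCompl y
  dsimp only at h
  rw [smul_eq_mul] at hy
  obtain ⟨u, hu⟩ := (IsLocalization.map_eq_zero_iff p.primeCompl
    (Localization.AtPrime p) (x * z)).mp (by rw [map_mul, ← h, ← mul_assoc, hy, zero_mul])
  rw [mul_left_comm] at hu
  have h0 : algebraMap R (Localization.AtPrime p) z = 0 :=
    (IsLocalization.map_eq_zero_iff p.primeCompl _ z).mpr ⟨u, hx.right_eq_zero_of_smul hu⟩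
  rw [h0] at h
  exact (IsLocalization.map_units (Localization.AtPrime p) t).mul_left_eq_zero.mp h

lemma exists_smul_eq_of_forall_mem {x : R} (hx : IsSMulRegular M x) (f : M →ₗ[R] M)
    (hf : ∀ z, f z ∈ x • (⊤ : Submodule R M)) : ∃ g : M →ₗ[R] M, f = x • g := by
  let e := LinearEquiv.ofInjective (LinearMap.lsmul R M x) hx
  have he (y) : x • e.symm y = y.1 := congrArg Subtype.val (e.apply_symm_apply y)
  refine ⟨e.symm.toLinearMap ∘ₗ f.codRestrict _ fun z => ?_, LinearMap.ext fun z => ?_⟩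
  · obtain ⟨w, -, hw⟩ := hf z
    exact ⟨w, hw⟩
  · exact (he ⟨f z, _⟩).symm

/-- The localization of a quotient as the quotient of the localization. -/
noncomputable def quotSMulTopMap (x : R) (M : Type) [AddCommGroup M] [Module R M] :
    QuotSMulTop x M →ₗ[R] QuotSMulTop (algebraMap R (Localization.AtPrime p) x)
      (LocalizedModule p.primeCompl M) :=
  Submodule.liftQ _ ((Submodule.mkQ _).restrictScalars R ∘ₗ
    LocalizedModule.mkLinearMap p.primeCompl M) (by
      rintro _ ⟨z, -, rfl⟩
      rw [LinearMap.mem_ker, LinearMap.comp_apply, DistribSMul.toLinearMap_apply, map_smul,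
        ← algebraMap_smul (Localization.AtPrime p)]
      exact (Submodule.Quotient.mk_eq_zero _).mpr
        (Submodule.smul_mem_pointwise_smul _ _ _ Submodule.mem_top))

lemma quotSMulTopMap_mkQ (x : R) (z : M) :
    quotSMulTopMap p x M (Submodule.mkQ _ z) =
      Submodule.mkQ _ (LocalizedModule.mkLinearMap p.primeCompl M z) := rfl

lemma exists_quotSMulTopMap_eq_smul (x : R)
    (y : QuotSMulTop (algebraMap R (Localization.AtPrime p) x)
      (LocalizedModule p.primeCompl M)) :
    ∃ t ∉ p, ∃ z, quotSMulTopMap p x M z = t • y := by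
  obtain ⟨y, rfl⟩ := Submodule.mkQ_surjective _ y
  obtain ⟨t, ht, z, hz⟩ := exists_mkLinearMap_eq_smul p y
  refine ⟨t, ht, Submodule.mkQ _ z, ?_⟩
  rw [quotSMulTopMap_mkQ, hz]
  rfl

lemma exists_smul_mem_of_mkQ_mkLinearMap_eq_zero (x : R) (z : M)
    (hz : (Submodule.mkQ _ (LocalizedModule.mkLinearMap p.primeCompl M z) :
      QuotSMulTop (algebraMap R (Localization.AtPrime p) x)
        (LocalizedModule p.primeCompl M)) = 0) :
    ∃ t ∉ p, t • z ∈ x • (⊤ : Submodule R M) := by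
  obtain ⟨y, -, hy⟩ := (Submodule.Quotient.mk_eq_zero _).mp hz
  obtain ⟨t, ht, w, hw⟩ := exists_mkLinearMap_eq_smul p y
  obtain ⟨u, hu, h⟩ := exists_smul_eq_zero_of_mkLinearMap_eq_zero p (t • z - x • w) (by
    rw [map_sub, map_smul, map_smul, hw, ← hy, DistribSMul.toLinearMap_apply, algebraMap_smul,
      smul_comm, sub_self])
  refine ⟨u * t, p.primeCompl.mul_mem hu ht, ?_⟩
  rw [smul_sub, sub_eq_zero] at h
  rw [mul_smul, h, smul_comm]
  exact Submodule.smul_mem_pointwise_smul _ _ _ Submodule.mem_top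

lemma exists_smul_eq_zero_of_quotSMulTopMap_eq_zero (x : R) (z : QuotSMulTop x M)
    (hz : quotSMulTopMap p x M z = 0) : ∃ t ∉ p, t • z = 0 := by
  obtain ⟨z, rfl⟩ := Submodule.mkQ_surjective _ z
  obtain ⟨t, ht, h⟩ := exists_smul_mem_of_mkQ_mkLinearMap_eq_zero p x z hz
  exact ⟨t, ht, (Submodule.Quotient.mk_eq_zero _).mpr h⟩

lemma nontrivial_localizedModule_of_annihilator_le [Module.Finite R M]
    (h : Module.annihilator R M ≤ p) : Nontrivial (LocalizedModule p.primeCompl M) := by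
  have : (⟨p, inferInstance⟩ : PrimeSpectrum R) ∈ Module.support R M := by
    rw [Module.support_eq_zeroLocus]
    exact h
  exact this

lemma exists_smul_eq_smul_algebraMap (c : Localization.AtPrime p) :
    ∃ t ∉ p, ∃ r, t • c = algebraMap R (Localization.AtPrime p) r := by
  obtain ⟨⟨r, t⟩, h⟩ := IsLocalization.surj p.primeCompl c
  exact ⟨t, t.2, r, by rw [Algebra.smul_def, mul_comm, h]⟩

lemma exists_smul_sub_mem_of_localizedModule [Module.Finite R M] {P : Submodule R M}
    {Q : Type} [AddCommGroup Q] [Module R Q] [Module (Localization.AtPrime p) Q]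
    [IsScalarTower R (Localization.AtPrime p) Q] (ψ : M →ₗ[R] Q)
    (hψ : ∀ z, ψ z = 0 → ∃ t ∉ p, t • z ∈ P) (s : M →ₗ[R] M) (f : Q →ₗ[Localization.AtPrime p] Q)
    (hf : ∀ z, f (ψ z) = ψ (s z)) {c : Localization.AtPrime p} (hc : ∀ y, f y = c • y) :
    ∃ t ∉ p, ∃ r : R, ∀ z, t • s z - r • z ∈ P := by
  obtain ⟨t, ht, r, h⟩ := exists_smul_eq_smul_algebraMap p c
  obtain ⟨u, hu, hu'⟩ := Submodule.FG.exists_forall_smul_mem (P := P)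
    (Module.Finite.fg_top.map (t • s - r • LinearMap.id)) p.primeCompl (by
      rintro _ ⟨z, -, rfl⟩
      refine hψ _ ?_
      simp only [LinearMap.sub_apply, LinearMap.smul_apply, LinearMap.id_apply, map_sub, map_smul,
        ← hf, hc]
      rw [← smul_assoc, h, algebraMap_smul, sub_self])
  refine ⟨u * t, p.primeCompl.mul_mem hu ht, u * r, fun z => ?_⟩
  rw [mul_smul, mul_smul, ← smul_sub]
  exact hu' _ ⟨z, trivial, rfl⟩

variable {p}

lemma forall_mem_maximalIdeal_mul_algebraMap_eq_zero {b : R}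
    (hb : ∀ r ∈ p, r * b = 0) :
    ∀ r ∈ maximalIdeal (Localization.AtPrime p),
      r * algebraMap R (Localization.AtPrime p) b = 0 :=
  (forall_mem_maximalIdeal_smul_eq_zero_iff p (algebraMap R (Localization.AtPrime p) b)).mpr
    fun r hr => by rw [Algebra.smul_def, ← map_mul, hb r hr, map_zero]

lemma algebraMap_localization_ne_zero {b : R} (hb' : ∀ t ∉ p, t * b ≠ 0) :
    algebraMap R (Localization.AtPrime p) b ≠ 0 := fun h => by
  obtain ⟨t, ht⟩ := (IsLocalization.map_eq_zero_iff p.primeCompl _ b).mp h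
  exact hb' t t.2 ht

lemma forall_mem_maximalIdeal_mul_algebraMap_mem_span {x b : R}
    (hb : ∀ r ∈ p, r * b ∈ Ideal.span {x}) :
    ∀ r ∈ maximalIdeal (Localization.AtPrime p),
      r * algebraMap R (Localization.AtPrime p) b ∈
        Ideal.span {algebraMap R (Localization.AtPrime p) x} := by
  intro r hr
  obtain ⟨t, ht, a, h⟩ := exists_smul_eq_smul_algebraMap p r
  have hu := IsLocalization.map_units (Localization.AtPrime p) (⟨t, ht⟩ : p.primeCompl)
  have ha : a ∈ p := by
    rw [← IsLocalization.AtPrime.to_map_mem_maximal_iff (Localization.AtPrime p) p, ← h,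
      Algebra.smul_def]
    exact Ideal.mul_mem_left _ _ hr
  rw [← Ideal.unit_mul_mem_iff_mem _ hu, ← mul_assoc, ← Algebra.smul_def, h, ← map_mul,
    ← Set.image_singleton, ← Ideal.map_span]
  exact Ideal.mem_map_of_mem _ (hb a ha)

lemma algebraMap_localization_notMem_span {x b : R}
    (hb' : ∀ t ∉ p, t * b ∉ Ideal.span {x}) : algebraMap R (Localization.AtPrime p) b ∉
    Ideal.span {algebraMap R (Localization.AtPrime p) x} := fun h => by
  rw [← Set.image_singleton, ← Ideal.map_span,
    IsLocalization.algebraMap_mem_map_algebraMap_iff p.primeCompl] at h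
  obtain ⟨t, ht, h⟩ := h
  exact hb' t ht h

variable [IsNoetherianRing R]

section Homothety

variable {n : ℕ} (hM : GDc R n M) {b : R} (hb : ∀ r ∈ p, r * b = 0) (hb' : ∀ t ∉ p, t * b ≠ 0)

include hM hb hb'

lemma GDc.exists_ne_zero_forall_smul_eq_zero (hp : Module.annihilator R M ≤ p) :
    ∃ y : M, y ≠ 0 ∧ ∀ r ∈ p, r • y = 0 := by
  have := hM.finite
  have := nontrivial_localizedModule_of_annihilator_le p hp
  exact exists_ne_zero_of_exists_socle (exists_mkLinearMap_eq_smul p)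
    (exists_smul_eq_zero_of_mkLinearMap_eq_zero p)
    ((hM.localization p.primeCompl).exists_socle_ne_zero (algebraMap_localization_ne_zero hb')
      (forall_mem_maximalIdeal_mul_algebraMap_eq_zero hb))

lemma GDc.exists_smul_eq_smul
    (hsoc : ∀ y z : M, (∀ r ∈ p, r • y = 0) → (∀ r ∈ p, r • z = 0) →
      ∃ a c : R, ¬ (a ∈ p ∧ c ∈ p) ∧ a • y + c • z = 0) (s : M →ₗ[R] M) :
    ∃ t ∉ p, ∃ r : R, ∀ z, t • s z = r • z := by
  have := hM.finite
  obtain ⟨c, hc⟩ := (hM.localization p.primeCompl).exists_forall_apply_eq_smul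
    (algebraMap_localization_ne_zero hb') (forall_mem_maximalIdeal_mul_algebraMap_eq_zero hb)
    (exists_relation_of_forall_exists_relation (exists_mkLinearMap_eq_smul p)
      (exists_smul_eq_zero_of_mkLinearMap_eq_zero p) hsoc) (LocalizedModule.map p.primeCompl s)
  obtain ⟨t, ht, r, h⟩ := exists_smul_sub_mem_of_localizedModule p (P := ⊥)
    (LocalizedModule.mkLinearMap p.primeCompl M)
    (exists_smul_eq_zero_of_mkLinearMap_eq_zero p) s _ (fun z => by
      rw [LocalizedModule.mkLinearMap_apply, LocalizedModule.mkLinearMap_apply,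
        LocalizedModule.map_mk]) hc
  exact ⟨t, ht, r, fun z => sub_eq_zero.mp (h z)⟩

end Homothety

section QuotientHomothety

variable {x : R} (hxp : x ∈ p) (hxR : IsSMulRegular R x) {n : ℕ} (hM : GDc R n M)
  (hxM : IsSMulRegular M x) {b : R} (hb : ∀ r ∈ p, r * b ∈ Ideal.span {x})
  (hb' : ∀ t ∉ p, t * b ∉ Ideal.span {x})

include hxp hxR hM hxM hb hb'

lemma GDc.exists_quotSMulTop_ne_zero_forall_smul_eq_zero (hp : Module.annihilator R M ≤ p) :
    ∃ y : QuotSMulTop x M, y ≠ 0 ∧ ∀ r ∈ p, r • y = 0 := by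
  have := hM.finite
  have := nontrivial_localizedModule_of_annihilator_le p hp
  exact exists_ne_zero_of_exists_socle (exists_quotSMulTopMap_eq_smul p x)
    (exists_smul_eq_zero_of_quotSMulTopMap_eq_zero p x)
    (GDc.exists_socle_quotient_ne_zero
      ((IsLocalization.AtPrime.to_map_mem_maximal_iff _ p x).mpr hxp)
      (hxR.algebraMap_localization p) (hM.localization p.primeCompl)
      (hxM.localizedModule p) (algebraMap_localization_notMem_span hb')
      (forall_mem_maximalIdeal_mul_algebraMap_mem_span hb))

lemma GDc.exists_smul_eq_smul_add_smul
    (hsoc : ∀ y z : QuotSMulTop x M, (∀ r ∈ p, r • y = 0) → (∀ r ∈ p, r • z = 0) →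
      ∃ a c : R, ¬ (a ∈ p ∧ c ∈ p) ∧ a • y + c • z = 0) (s : M →ₗ[R] M) :
    ∃ t ∉ p, ∃ (r : R) (s' : M →ₗ[R] M), t • s = r • LinearMap.id + x • s' := by
  have := hM.finite
  obtain ⟨c, hc⟩ := GDc.exists_forall_quotient_apply_eq_smul
      ((IsLocalization.AtPrime.to_map_mem_maximal_iff _ p x).mpr hxp)
      (hxR.algebraMap_localization p) (hM.localization p.primeCompl)
      (hxM.localizedModule p) (algebraMap_localization_notMem_span hb')
      (forall_mem_maximalIdeal_mul_algebraMap_mem_span hb)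
    (exists_relation_of_forall_exists_relation (exists_quotSMulTopMap_eq_smul p x)
      (exists_smul_eq_zero_of_quotSMulTopMap_eq_zero p x) hsoc)
    (QuotSMulTop.map _ (LocalizedModule.map p.primeCompl s))
  obtain ⟨t, ht, r, h⟩ := exists_smul_sub_mem_of_localizedModule p (P := x • ⊤)
    ((Submodule.mkQ _).restrictScalars R ∘ₗ LocalizedModule.mkLinearMap p.primeCompl M)
    (exists_smul_mem_of_mkQ_mkLinearMap_eq_zero p x) s _ (fun z => by
      simp only [LinearMap.comp_apply, LinearMap.restrictScalars_apply, Submodule.mkQ_apply,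
        QuotSMulTop.map_apply_mk, LocalizedModule.mkLinearMap_apply, LocalizedModule.map_mk]) hc
  obtain ⟨s', hs'⟩ := exists_smul_eq_of_forall_mem hxM (t • s - r • LinearMap.id) h
  exact ⟨t, ht, r, s', by rw [← hs', add_sub_cancel]⟩

end QuotientHomothety

end PrimeLocalization

section Faithful

open Function

variable {R : Type} [CommRing R]

lemma exists_forall_mem_iff_of_mem_associatedPrimes [IsNoetherianRing R] {N : Type}
    [AddCommGroup N] [Module R N] {p : Ideal R} (hp : p ∈ associatedPrimes R N) :
    ∃ y : N, ∀ r, r ∈ p ↔ r • y = 0 := by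
  obtain ⟨-, f, hf⟩ := (isAssociatedPrime_iff_exists_injective_linearMap p N).mp hp
  refine ⟨f (Submodule.mkQ p 1), fun r => ?_⟩
  rw [← map_smul, ← map_smul, map_eq_zero_iff f hf, smul_eq_mul, mul_one]
  exact (Submodule.Quotient.mk_eq_zero p).symm

lemma exists_notMem_forall_smul_eq_zero {p : Ideal R} [p.IsPrime] {x u : R} (hx : x ∈ p)
    (hu : u ∉ p) {N : Type} [AddCommGroup N] [Module R N] [Module.Finite R N]
    (h : ∀ y : N, u • y ∈ x • (⊤ : Submodule R N)) : ∃ v ∉ p, ∀ y : N, v • y = 0 := by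
  obtain ⟨f, hf, -, hfc, hf0⟩ :=
    LinearMap.exists_monic_and_natDegree_eq_and_coeff_mem_pow_and_aeval_eq_zero R
      (algebraMap R (Module.End R N) u) (Ideal.span {x}) (by
        rintro _ ⟨y, rfl⟩
        rw [Submodule.ideal_span_singleton_smul]
        exact h y)
  refine ⟨f.eval u, ?_, fun y => ?_⟩
  · rw [← Ideal.Quotient.eq_zero_iff_mem, Polynomial.eval_eq_sum_range, map_sum,
      Finset.sum_range_succ, Finset.sum_eq_zero, zero_add, hf.coeff_natDegree, one_mul,
      Ideal.Quotient.eq_zero_iff_mem]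
    · exact fun h => hu (Ideal.IsPrime.mem_of_pow_mem ‹_› _ h)
    · intro k hk
      rw [Ideal.Quotient.eq_zero_iff_mem]
      refine Ideal.mul_mem_right _ _ ?_
      exact (Ideal.pow_le_self (Nat.sub_ne_zero_of_lt (Finset.mem_range.mp hk))).trans
        ((Ideal.span_singleton_le_iff_mem _).mpr hx) (hfc k)
  · rw [Polynomial.aeval_algebraMap_apply, Polynomial.coe_aeval_eq_eval] at hf0
    exact LinearMap.congr_fun hf0 y

lemma ringKrullDim_quotient_le_of_eq {d : ℕ} (hd : ringKrullDim R = d) (I : Ideal R) :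
    ringKrullDim (R ⧸ I) ≤ d :=
  (ringKrullDim_le_of_surjective _ Ideal.Quotient.mk_surjective).trans hd.le

variable [IsLocalRing R] [IsNoetherianRing R]
  {E : Type} [AddCommGroup E] [Module R E] {M : Type} [AddCommGroup M] [Module R M] {d n : ℕ}
  (hE : IsInjHull R (maximalIdeal R) E) (hd : ringKrullDim R = d)
  (hM : Nonempty ((M →ₗ[R] E) ≃ₗ[R] LocCoh (maximalIdeal R) d R))

namespace IsInjHull

include hE hd hM

lemma ringKrullDim_quotient_eq_of_forall_smul_eq_zero {p : Ideal R} {y : M} (hy : y ≠ 0)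
    (hp : ∀ r ∈ p, r • y = 0) : ringKrullDim (R ⧸ p) = d := by
  refine (ringKrullDim_quotient_le_of_eq hd p).eq_of_not_lt fun h => hy ?_
  obtain ⟨φ, hφ⟩ := exists_surjective_quotient_bot hM
  exact hE.eq_zero_of_surjective_locCoh (ringKrullDim_quotient_le_of_eq hd ⊥) bot_le hφ h hp

lemma exists_relation_of_smul_eq_zero [Module.Finite R M] {p : Ideal R} [p.IsPrime] {y z : M}
    (hy : ∀ r ∈ p, r • y = 0) (hz : ∀ r ∈ p, r • z = 0) :
    ∃ a b : R, ¬ (a ∈ p ∧ b ∈ p) ∧ a • y + b • z = 0 := by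
  obtain ⟨φ, hφ⟩ := exists_surjective_quotient_bot hM
  exact hE.exists_relation_of_forall_smul_eq_zero (ringKrullDim_quotient_le_of_eq hd ⊥) bot_le hφ
    hy hz

lemma ringKrullDim_quotient_eq_of_mem_associatedPrimes (hG : GDc R n M) {p : Ideal R}
    (hp : p ∈ associatedPrimes R R) (hMp : Module.annihilator R M ≤ p) :
    ringKrullDim (R ⧸ p) = d := by
  have := hp.1
  obtain ⟨b, hb⟩ := exists_forall_mem_iff_of_mem_associatedPrimes hp
  obtain ⟨y, hy, hy'⟩ := hG.exists_ne_zero_forall_smul_eq_zero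
    (fun r hr => (hb r).mp hr) (fun t ht h => ht ((hb t).mpr h)) hMp
  exact hE.ringKrullDim_quotient_eq_of_forall_smul_eq_zero hd hM hy hy'

lemma exists_mem_isSMulRegular {I : Ideal R} (hI : ∀ p ∈ associatedPrimes R R, ¬ I ≤ p)
    (hI' : ∀ p : Ideal R, p.IsPrime → ringKrullDim (R ⧸ p) = d → ¬ I ≤ p) :
    ∃ x ∈ I, IsSMulRegular R x ∧ IsSMulRegular M x ∧
      ∀ e : ℕ, d = e + 1 → ringKrullDim (R ⧸ Ideal.span {x}) ≤ e := by
  obtain ⟨x, hxI, hx⟩ := Ideal.exists_mem_forall_notMem (I := I)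
    ((associatedPrimes.finite R R).union (finite_setOf_prime_ringKrullDim_quotient_eq
      (ringKrullDim_quotient_le_of_eq hd ⊥))) (by
        rintro p (hp | hp)
        exacts [hp.1, hp.1]) (by
        rintro p (hp | hp)
        exacts [hI p hp, hI' p hp.1 hp.2.2])
  have hxd (p : Ideal R) (hp : p.IsPrime) (hpd : ringKrullDim (R ⧸ p) = d) : x ∉ p :=
    hx p (Or.inr ⟨hp, bot_le, hpd⟩)
  refine ⟨x, hxI, .of_forall_associatedPrimes fun p hp => hx p (Or.inl hp),
    .of_forall_associatedPrimes fun p hp => ?_, ?_⟩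
  · obtain ⟨y, hy⟩ := exists_forall_mem_iff_of_mem_associatedPrimes hp
    refine hxd p hp.1 (hE.ringKrullDim_quotient_eq_of_forall_smul_eq_zero hd hM (y := y) ?_
      fun r hr => (hy r).mp hr)
    rintro rfl
    exact hp.1.ne_top ((Ideal.eq_top_iff_one p).mpr ((hy 1).mpr (smul_zero 1)))
  · rintro e rfl
    have := ringKrullDim_quotient_sup_span_le (I := ⊥) (x := x)
      (ringKrullDim_quotient_le_of_eq hd ⊥) fun p hp _ hpd => hxd p hp hpd
    rwa [bot_sup_eq] at this

/-- A canonical module of finite G-dimension is faithful. -/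
theorem annihilator_eq_bot (hG : GDc R n M) : Module.annihilator R M = ⊥ := by
  have hlt (p : Ideal R) [p.IsPrime] := ringKrullDim_quotient_lt_of_annihilator_annihilator_le
    hd hM p
  set K := Module.annihilator R M with hK
  set I := Module.annihilator R K with hI
  by_contra hK0
  have hIp (p : Ideal R) (hp : p.IsPrime) (hpd : ringKrullDim (R ⧸ p) = d) : ¬ I ⊔ K ≤ p :=
    fun h => (hlt p (le_sup_left.trans h)).ne hpd
  obtain ⟨x, hxI, hxR, hxM, hxd⟩ := hE.exists_mem_isSMulRegular hd hM (I := I ⊔ K)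
    (fun p hp h => hIp p hp.1 (hE.ringKrullDim_quotient_eq_of_mem_associatedPrimes hd hM hG hp
      (le_sup_right.trans h)) h) hIp
  obtain ⟨i, hi, k, hk, rfl⟩ := Submodule.mem_sup.mp hxI
  have hIK {r s : R} (hr : r ∈ I) (hs : s ∈ K) : r * s = 0 :=
    congrArg Subtype.val (Module.mem_annihilator.mp hr (⟨s, hs⟩ : K))
  have hnt : Nontrivial M := by
    by_contra h
    rw [not_nontrivial_iff_subsingleton] at h
    have hKt : K = ⊤ := (Ideal.eq_top_iff_one _).mpr
      (Module.mem_annihilator.mpr fun y => Subsingleton.elim _ _)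
    have hI0 : I = ⊥ := by
      refine (Submodule.eq_bot_iff _).mpr fun r hr => ?_
      simpa using hIK hr (hKt ▸ Submodule.mem_top : (1 : R) ∈ K)
    obtain ⟨q, hq, -, hqd⟩ := exists_prime_le_ringKrullDim_quotient (I := (⊥ : Ideal R))
      (n := d) (by
      rw [← hd]
      exact (ringKrullDim_eq_of_ringEquiv (RingEquiv.quotientBot R)).ge)
    exact not_lt.mpr hqd (hlt q (hI0 ▸ bot_le))
  have hi' : i ∉ Ideal.span {i + k} := by
    intro h
    obtain ⟨a, ha⟩ := Ideal.mem_span_singleton'.mp h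
    have hc : i * (1 - a) = a * k := by linear_combination -ha
    have hc0 : i * (1 - a) = 0 := by
      refine hxR.right_eq_zero_of_smul ?_
      rw [smul_eq_mul, add_mul]
      nth_rewrite 1 [hc]
      linear_combination (a + 1 - a) * hIK hi hk
    rcases IsLocalRing.isUnit_or_isUnit_one_sub_self a with hu | hu
    · have hk0 : k = 0 := hu.mul_right_eq_zero.mp (hc ▸ hc0)
      subst hk0
      refine hK0 ((Submodule.eq_bot_iff _).mpr fun r hr => hxR.right_eq_zero_of_smul ?_)
      rw [add_zero]
      exact hIK hi hr
    · have hi0 : i = 0 := hu.mul_left_eq_zero.mp hc0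
      subst hi0
      obtain ⟨y, hy⟩ := exists_ne (0 : M)
      refine hy (hxM.right_eq_zero_of_smul ?_)
      rw [zero_add]
      exact Module.mem_annihilator.mp hk y
  obtain ⟨p, hp, hpi⟩ := exists_le_isAssociatedPrime_of_isNoetherianRing R
    (Ideal.Quotient.mk (Ideal.span {i + k}) i) (by rwa [Ne, Ideal.Quotient.eq_zero_iff_mem])
  have := hp.1
  obtain ⟨b, hb⟩ := exists_forall_mem_iff_of_mem_associatedPrimes hp
  obtain ⟨b, rfl⟩ := Ideal.Quotient.mk_surjective b
  replace hb (r : R) : r ∈ p ↔ r * b ∈ Ideal.span {i + k} := by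
    rw [hb, ← Ideal.Quotient.eq_zero_iff_mem]
    rfl
  have hIKp : I ⊔ K ≤ p := by
    refine sup_le (fun r hr => hpi ?_) fun r hr => hpi ?_
    · rw [Submodule.mem_colon_singleton, Submodule.mem_bot]
      refine Ideal.Quotient.eq_zero_iff_mem.mpr (Ideal.mem_span_singleton'.mpr ⟨r, ?_⟩)
      linear_combination hIK hr hk
    · rw [Submodule.mem_colon_singleton, Submodule.mem_bot]
      refine Ideal.Quotient.eq_zero_iff_mem.mpr (Ideal.mem_span_singleton'.mpr ⟨0, ?_⟩)
      linear_combination - hIK hi hr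
  have hpd := hlt p (le_sup_left.trans hIKp)
  obtain ⟨y, hy, hy'⟩ := hG.exists_quotSMulTop_ne_zero_forall_smul_eq_zero (hIKp hxI) hxR hxM
    (fun r hr => (hb r).mp hr) (fun t ht h => ht ((hb t).mpr h)) (le_sup_right.trans hIKp)
  have : Nontrivial (R ⧸ p) := Ideal.Quotient.nontrivial_iff.mpr hp.1.ne_top
  cases d with
  | zero => exact not_le.mpr hpd (by exact_mod_cast ringKrullDim_nonneg_of_nontrivial)
  | succ e =>
    obtain ⟨φ, hφ⟩ := exists_surjective_quotient_span hM (hxd e rfl)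
    refine hy (hE.eq_zero_of_surjective_locCoh (hxd e rfl)
      ((Ideal.span_singleton_le_iff_mem _).mpr (hIKp hxI)) hφ ?_ hy')
    obtain ⟨q, hq, hqp⟩ := Ideal.exists_minimalPrimes_le (le_sup_left.trans hIKp)
    have hq' : q ∈ associatedPrimes R R := associatedPrimes.subset_of_injective
      (f := K.subtype) (Submodule.subtype_injective _)
      (Module.associatedPrimes.minimalPrimes_annihilator_subset_associatedPrimes R K hq)
    have := hq'.1
    have hqp' : q < p := lt_of_le_of_ne hqp fun h =>
      hxR.notMem_associatedPrimes q hq' (h ▸ hIKp hxI)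
    have h1 := ringKrullDim_quotient_add_one_le_of_lt hqp'
    have h2 := hlt q hq.1.2
    by_contra! h3
    refine not_lt.mpr ?_ h2
    refine le_trans ?_ h1
    push_cast
    exact add_le_add_left h3 1

end IsInjHull

end Faithful

section Endomorphism

open Function

variable {R : Type} [CommRing R] [IsLocalRing R] [IsNoetherianRing R]
  {E : Type} [AddCommGroup E] [Module R E] {M : Type} [AddCommGroup M] [Module R M] {d n : ℕ}

namespace IsInjHull

/-- The endomorphisms of a canonical module of finite G-dimension are homotheties. -/
theorem exists_forall_apply_eq_smul (hE : IsInjHull R (maximalIdeal R) E)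
    (hd : ringKrullDim R = d) (hM : Nonempty ((M →ₗ[R] E) ≃ₗ[R] LocCoh (maximalIdeal R) d R))
    (hG : GDc R n M) (s : M →ₗ[R] M) : ∃ c : R, ∀ y, s y = c • y := by
  have hfin := hG.finite
  have hann := hE.annihilator_eq_bot hd hM hG
  let C := (M →ₗ[R] M) ⧸ Submodule.span R {(LinearMap.id : M →ₗ[R] M)}
  have hCmk (s : M →ₗ[R] M) :
      (Submodule.Quotient.mk s : C) = 0 ↔ ∃ c : R, c • LinearMap.id = s := by
    rw [Submodule.Quotient.mk_eq_zero, Submodule.mem_span_singleton]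
  by_contra hs
  have hC : Nontrivial C := nontrivial_of_ne (Submodule.Quotient.mk s) 0 fun h => by
    obtain ⟨c, rfl⟩ := (hCmk s).mp h
    exact hs ⟨c, fun y => rfl⟩
  obtain ⟨p, hp⟩ := associatedPrimes.nonempty R C
  have := hp.1
  obtain ⟨s, hs⟩ := exists_forall_mem_iff_of_mem_associatedPrimes hp
  obtain ⟨s, rfl⟩ := Submodule.Quotient.mk_surjective _ s
  replace hs (r : R) : r ∈ p ↔ ∃ c : R, c • LinearMap.id = r • s := by
    rw [hs, ← hCmk]
    rfl
  have hnt : Nontrivial (R ⧸ p) := Ideal.Quotient.nontrivial_iff.mpr hp.1.ne_top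
  have hpM : Module.annihilator R M ≤ p := hann ▸ bot_le
  have key {q : Ideal R} (hq : q.IsPrime) (hqd : ringKrullDim (R ⧸ q) = d) {p : Ideal R}
      (hp : p.IsPrime) (hpq : p ≤ q) : p = q := by
    by_contra hne
    have h1 := ringKrullDim_quotient_add_one_le_of_lt (lt_of_le_of_ne hpq hne)
    have h2 := h1.trans (ringKrullDim_quotient_le_of_eq hd p)
    rw [hqd] at h2
    exact absurd (by exact_mod_cast h2 : d + 1 ≤ d) (by lia)
  by_cases hpd : ringKrullDim (R ⧸ p) = d
  · obtain ⟨q, hq, hqp⟩ := Ideal.exists_minimalPrimes_le (I := Module.annihilator R R) (J := p)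
      fun r hr => by
        have : r • (1 : R) = 0 := Module.mem_annihilator.mp hr 1
        rw [smul_eq_mul, mul_one] at this
        exact this ▸ p.zero_mem
    have hpA := Module.associatedPrimes.minimalPrimes_annihilator_subset_associatedPrimes R R hq
    obtain rfl := key hp.1 hpd hpA.1 hqp
    obtain ⟨b, hb⟩ := exists_forall_mem_iff_of_mem_associatedPrimes hpA
    obtain ⟨t, ht, r, h⟩ := hG.exists_smul_eq_smul
      (fun r hr => (hb r).mp hr) (fun t ht h => ht ((hb t).mpr h))
      (fun y z hy hz => hE.exists_relation_of_smul_eq_zero hd hM hy hz) s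
    exact ht ((hs t).mpr ⟨r, LinearMap.ext fun z => (h z).symm⟩)
  have hp' (q : Ideal R) (hq : q.IsPrime) (hqd : ringKrullDim (R ⧸ q) = d) : ¬ p ≤ q :=
    fun h => hpd (key hq hqd hp.1 h ▸ hqd)
  cases d with
  | zero =>
    refine hpd (le_antisymm (ringKrullDim_quotient_le_of_eq hd p) ?_)
    exact_mod_cast ringKrullDim_nonneg_of_nontrivial
  | succ e =>
    obtain ⟨x, hxp, hxR, hxM, hxd⟩ := hE.exists_mem_isSMulRegular hd hM (I := p)
      (fun q hq => hp' q hq.1 (hE.ringKrullDim_quotient_eq_of_mem_associatedPrimes hd hM hG hq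
        (hann ▸ bot_le))) hp'
    obtain ⟨φ, hφ⟩ := exists_surjective_quotient_span hM (hxd e rfl)
    obtain ⟨a, ha⟩ := (hs x).mp hxp
    have hC' (c : C) : ∃ u ∈ p.primeCompl, u • c ∈ x • (⊤ : Submodule R C) := by
      obtain ⟨f, rfl⟩ := Submodule.Quotient.mk_surjective _ c
      obtain ⟨u, hu, r, g, h⟩ := GDc.exists_smul_eq_smul_add_smul hxp hxR hG hxM (b := a)
        (fun r hr => by
          obtain ⟨c, hc⟩ := (hs r).mp hr
          refine Ideal.mem_span_singleton'.mpr ⟨c, ?_⟩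
          have : c * x - r * a ∈ Module.annihilator R M := by
            rw [Module.mem_annihilator]
            intro y
            have h1 : c • y = r • s y := LinearMap.congr_fun hc y
            have h2 : a • y = x • s y := LinearMap.congr_fun ha y
            rw [sub_smul, mul_comm, mul_smul, mul_smul, h1, h2, smul_comm, sub_self]
          rw [hann] at this
          exact sub_eq_zero.mp this)
        (fun t ht h => ht ((hs t).mpr (by
          obtain ⟨c, hc⟩ := Ideal.mem_span_singleton'.mp h
          refine ⟨c, LinearMap.ext fun y => hxM ?_⟩
          have h2 : a • y = x • s y := LinearMap.congr_fun ha y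
          change x • c • y = x • t • s y
          rw [smul_smul, mul_comm, hc, smul_comm, ← h2, mul_smul])))
        (fun y z hy hz => hE.exists_relation_of_forall_smul_eq_zero (hxd e rfl)
          ((Ideal.span_singleton_le_iff_mem _).mpr hxp) hφ hy hz) f
      refine ⟨u, hu, ?_⟩
      have : u • (Submodule.Quotient.mk f : C) = x • Submodule.Quotient.mk g := by
        rw [← Submodule.Quotient.mk_smul, ← Submodule.Quotient.mk_smul, h,
          Submodule.Quotient.mk_add, (hCmk _).mpr ⟨r, rfl⟩, zero_add]
      rw [this]
      exact Submodule.smul_mem_pointwise_smul _ _ _ Submodule.mem_top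
    obtain ⟨u, hu, hu'⟩ := Submodule.FG.exists_forall_smul_mem (P := x • (⊤ : Submodule R C))
      (Module.Finite.fg_top) p.primeCompl fun c _ => hC' c
    obtain ⟨v, hv, hv'⟩ := exists_notMem_forall_smul_eq_zero hxp hu fun c => hu' c trivial
    exact hv ((hs v).mpr ((hCmk _).mp (hv' (Submodule.Quotient.mk s))))

end IsInjHull

end Endomorphism

section DualExactness

open Function
open scoped Matrix

/-- The matrix `M` can be continued by an exact sequence of `t` further matrices over `A` whose
transposes are exact on `N`. -/
def EV (A N : Type) [CommRing A] [AddCommGroup N] [Module A N] :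
    ℕ → ∀ {m n : ℕ}, Matrix (Fin m) (Fin n) A → Prop
  | 0, _, _, _ => True
  | t + 1, _, n, M => ∃ (q : ℕ) (K : Matrix (Fin n) (Fin q) A),
      MExact A M K ∧ MExact N Kᵀ Mᵀ ∧ EV A N t K

variable {A : Type} [CommRing A] {N : Type} [AddCommGroup N] [Module A N] {m n : ℕ}

lemma EV.of_extVan [IsNoetherianRing A] {t : ℕ} {M : Matrix (Fin m) (Fin n) A}
    (h : ∀ i, i + 1 ≤ t → ExtVan A (Cok M) N (i + 1)) : EV A N t M := by
  induction t generalizing m n with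
  | zero => trivial
  | succ t ih =>
    obtain ⟨q, K, hK⟩ := exists_mexact M
    exact ⟨q, K, hK, hK.transpose_of_extVan_one (h 0 (by omega)),
      ih fun i hi => hK.extVan_of_succ (h (i + 1) (by omega))⟩

variable {x : A}

lemma EV.quotient {t : ℕ} {M : Matrix (Fin m) (Fin n) A} (h : EV A N (t + 1) M)
    (hxA : IsSMulRegular A x) (hxN : IsSMulRegular N x)
    (hM : ∀ (v : Fin n → A) (w : Fin m → A), mact M A v = x • w → ∃ v', w = mact M A v') :
    EV (A ⧸ Ideal.span {x}) (QuotSMulTop x N) t (M.map (algebraMap A (A ⧸ Ideal.span {x}))) := by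
  induction t generalizing m n with
  | zero => trivial
  | succ t ih =>
    obtain ⟨q, K, hMK, hKM, hK⟩ := h
    obtain ⟨r, L, hKL, hLK, hL⟩ := id hK
    refine ⟨q, K.map (algebraMap A (A ⧸ Ideal.span {x})), ?_, ?_,
      ih hK (hMK.exists_eq_mact_of_eq_smul hxA)⟩
    · exact mexact_map_algebraMap_iff.mpr (hMK.of_surjective surjective_algebraLinearMap_quotient
        algebraMap_quotient_eq_zero_iff hM)
    · rw [← Matrix.transpose_map, ← Matrix.transpose_map]
      exact mexact_map_algebraMap_iff.mpr (hKM.of_surjective (Submodule.mkQ_surjective _)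
        mkQ_smul_top_eq_zero_iff (hLK.exists_eq_mact_of_eq_smul hxN))

lemma IsPresentation.exists_eq_mact_of_eq_smul {M : Matrix (Fin m) (Fin n) A} {g : Fin m → N}
    (hM : IsPresentation M g) (hx : IsSMulRegular N x) (v : Fin n → A) (w : Fin m → A)
    (hv : mact M A v = x • w) : ∃ v', w = mact M A v' := by
  obtain ⟨v', hv'⟩ := (hM.exact w).mp (hx (by
    change x • _ = x • (0 : N)
    rw [← map_smul, ← hv, hM.exact.apply_apply_eq_zero, smul_zero]))
  exact ⟨v', hv'.symm⟩

lemma IsPresentation.exists_hom_mkQ {M : Matrix (Fin m) (Fin n) A} {g : Fin m → N}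
    (hM : IsPresentation M g) {t : ℕ} (h : EV A N (t + 1) M) (hx : IsSMulRegular N x)
    (f : N →ₗ[A] QuotSMulTop x N) :
    ∃ φ : N →ₗ[A] N, f = (x • (⊤ : Submodule A N)).mkQ ∘ₗ φ := by
  obtain ⟨q, K, hMK, hKM, hK⟩ := h
  choose y hy using fun i => Submodule.mkQ_surjective (x • (⊤ : Submodule A N)) (f (g i))
  have hy' : (x • (⊤ : Submodule A N)).mkQ ∘ y = f ∘ g := funext hy
  have hz := hM.mact_transpose_apply f
  rw [← hy', mact_map] at hz
  choose w hw using fun i => (mkQ_smul_top_eq_zero_iff _).mp (congrFun hz i)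
  obtain ⟨v', hv'⟩ := hKM.exists_eq_mact_of_eq_smul hx y w (funext fun i => (hw i).symm)
  obtain ⟨φ, hφ⟩ := hM.exists_hom (y := y - x • v') (by
    rw [map_sub, map_smul, ← hv']
    ext i
    simp [hw])
  refine ⟨φ, hM.hom_ext fun i => ?_⟩
  rw [LinearMap.comp_apply, hφ, Pi.sub_apply, map_sub, hy, eq_comm, sub_eq_self]
  exact (mkQ_smul_top_eq_zero_iff _).mpr ⟨_, rfl⟩

lemma IsPresentation.exists_forall_quotient {M : Matrix (Fin m) (Fin n) A} {g : Fin m → N}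
    (hM : IsPresentation M g) {t : ℕ} (h : EV A N (t + 1) M) (hx : IsSMulRegular N x)
    (hend : ∀ f : N →ₗ[A] N, ∃ c : A, ∀ y, f y = c • y)
    (f : QuotSMulTop x N →ₗ[A ⧸ Ideal.span {x}] QuotSMulTop x N) :
    ∃ c : A ⧸ Ideal.span {x}, ∀ y, f y = c • y := by
  obtain ⟨φ, hφ⟩ := hM.exists_hom_mkQ h hx
    (f.restrictScalars A ∘ₗ (x • (⊤ : Submodule A N)).mkQ)
  obtain ⟨c, hc⟩ := hend φ
  refine ⟨algebraMap A _ c, fun y => ?_⟩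
  obtain ⟨y, rfl⟩ := Submodule.mkQ_surjective _ y
  rw [algebraMap_smul, ← map_smul, ← hc]
  exact LinearMap.congr_fun hφ y

lemma faithful_quotient (hx : IsSMulRegular N x)
    (hend : ∀ f : N →ₗ[A] N, ∃ c : A, ∀ y, f y = c • y)
    (hfaith : ∀ c : A, (∀ y : N, c • y = 0) → c = 0) (c : A ⧸ Ideal.span {x})
    (hc : ∀ y : QuotSMulTop x N, c • y = 0) : c = 0 := by
  obtain ⟨a, rfl⟩ := surjective_algebraLinearMap_quotient c
  obtain ⟨f, hf⟩ := exists_smul_eq_of_forall_mem hx (LinearMap.lsmul A N a) fun z => by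
    have := hc ((x • (⊤ : Submodule A N)).mkQ z)
    rw [Algebra.linearMap_apply, algebraMap_smul, ← map_smul, Submodule.mkQ_apply,
      Submodule.Quotient.mk_eq_zero] at this
    exact this
  obtain ⟨b, hb⟩ := hend f
  refine (algebraMap_quotient_eq_zero_iff _).mpr ⟨b, (sub_eq_zero.mp (hfaith _ fun y => ?_)).symm⟩
  have := LinearMap.congr_fun hf y
  rw [LinearMap.lsmul_apply, LinearMap.smul_apply, hb] at this
  rw [sub_smul, this, smul_eq_mul, mul_smul, sub_self]

lemma isSMulRegular_of_faithful (hx : IsSMulRegular N x)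
    (hfaith : ∀ c : A, (∀ y : N, c • y = 0) → c = 0) : IsSMulRegular A x := by
  rw [isSMulRegular_iff_right_eq_zero_of_smul]
  intro a ha
  refine hfaith a fun y => hx ?_
  change x • a • y = x • (0 : N)
  rw [smul_zero, smul_smul, ← smul_eq_mul, ha, zero_smul]

lemma mkQ_mem_ofList_smul_top_iff (rs : List A) (z : N) :
    (x • (⊤ : Submodule A N)).mkQ z ∈
      (Ideal.ofList (rs.map (Ideal.Quotient.mk (Ideal.span {x}))) •
        ⊤ : Submodule (A ⧸ Ideal.span {x}) (QuotSMulTop x N)) ↔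
      z ∈ (Ideal.ofList (x :: rs) • ⊤ : Submodule A N) := by
  have hle : x • (⊤ : Submodule A N) ≤ Ideal.ofList (x :: rs) • ⊤ := by
    rw [Ideal.ofList_cons, ← Submodule.ideal_span_singleton_smul]
    exact Submodule.smul_mono_left le_sup_left
  refine ⟨fun h => ?_, fun h => ?_⟩
  · have key : ∀ u ∈ (Ideal.ofList (rs.map (Ideal.Quotient.mk (Ideal.span {x}))) •
        ⊤ : Submodule (A ⧸ Ideal.span {x}) (QuotSMulTop x N)),
        ∃ z ∈ (Ideal.ofList (x :: rs) • ⊤ : Submodule A N),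
          (x • (⊤ : Submodule A N)).mkQ z = u := by
      intro u hu
      induction hu using Submodule.smul_induction_on' with
      | smul r hr y _ =>
        rw [← Ideal.map_ofList,
          Ideal.mem_map_iff_of_surjective _ Ideal.Quotient.mk_surjective] at hr
        obtain ⟨r, hr, rfl⟩ := hr
        obtain ⟨y, rfl⟩ := Submodule.mkQ_surjective _ y
        exact ⟨r • y, Submodule.smul_mem_smul
          (by rw [Ideal.ofList_cons]; exact Ideal.mem_sup_right hr) trivial, rfl⟩
      | add u _ v _ h₁ h₂ =>
        obtain ⟨a, ha, rfl⟩ := h₁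
        obtain ⟨b, hb, rfl⟩ := h₂
        exact ⟨a + b, add_mem ha hb, map_add _ _ _⟩
    obtain ⟨w, hw, hwz⟩ := key _ h
    have : w - z ∈ x • (⊤ : Submodule A N) := (Submodule.Quotient.eq _).mp hwz
    simpa using sub_mem hw (hle this)
  · induction h using Submodule.smul_induction_on' with
    | smul r hr y _ =>
      rw [Ideal.ofList_cons] at hr
      obtain ⟨a, ha, b, hb, rfl⟩ := Submodule.mem_sup.mp hr
      obtain ⟨c, rfl⟩ := Ideal.mem_span_singleton'.mp ha
      have h₀ : (x • (⊤ : Submodule A N)).mkQ ((c * x + b) • y) =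
          Ideal.Quotient.mk (Ideal.span {x}) b • (x • (⊤ : Submodule A N)).mkQ y := by
        rw [add_smul, map_add, mul_comm, mul_smul,
          (mkQ_smul_top_eq_zero_iff (x • c • y)).mpr ⟨_, rfl⟩, zero_add]
        rfl
      rw [h₀]
      refine Submodule.smul_mem_smul ?_ trivial
      rw [← Ideal.map_ofList]
      exact Ideal.mem_map_of_mem _ hb
    | add u _ v _ h₁ h₂ =>
      rw [map_add]
      exact add_mem h₁ h₂

end DualExactness

section Cyclic

open Function
open scoped Matrix

variable {A : Type} [CommRing A] [IsLocalRing A] {N : Type} [AddCommGroup N] [Module A N]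

lemma span_singleton_eq_top_of_quotient [Module.Finite A N] {x : A} (hx : x ∈ maximalIdeal A)
    {y : N} (hy : Submodule.span (A ⧸ Ideal.span {x}) {(x • (⊤ : Submodule A N)).mkQ y} = ⊤) :
    Submodule.span A {y} = ⊤ := by
  refine top_le_iff.mp (Submodule.le_of_le_smul_of_le_jacobson_bot (I := Ideal.span {x})
    Module.Finite.fg_top ((Ideal.span_singleton_le_iff_mem _).mpr (by
      rwa [jacobson_eq_maximalIdeal ⊥ bot_ne_top])) fun z _ => ?_)
  have hz : (x • (⊤ : Submodule A N)).mkQ z ∈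
      Submodule.span (A ⧸ Ideal.span {x}) {(x • (⊤ : Submodule A N)).mkQ y} := by
    rw [hy]; trivial
  obtain ⟨a, ha⟩ := Submodule.mem_span_singleton.mp hz
  obtain ⟨a, rfl⟩ := surjective_algebraLinearMap_quotient a
  rw [Algebra.linearMap_apply, algebraMap_smul, ← map_smul] at ha
  have : z - a • y ∈ x • (⊤ : Submodule A N) := (Submodule.Quotient.eq _).mp ha.symm
  rw [← add_sub_cancel (a • y) z, Submodule.ideal_span_singleton_smul]
  exact Submodule.add_mem_sup (Submodule.smul_mem _ _ (Submodule.mem_span_singleton_self y)) this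

lemma exists_socle_ne_zero_of_forall_end [Module.Finite A N] [Nontrivial N]
    (hend : ∀ f : N →ₗ[A] N, ∃ c : A, ∀ y, f y = c • y)
    (hfaith : ∀ c : A, (∀ y : N, c • y = 0) → c = 0) {z : N} (hz : z ≠ 0)
    (hz' : ∀ r ∈ maximalIdeal A, r • z = 0) :
    ∃ b : A, b ≠ 0 ∧ ∀ r ∈ maximalIdeal A, r * b = 0 := by
  obtain ⟨θ, hθ⟩ := exists_surjective_residue (A := A) N
  obtain ⟨t, ht⟩ := exists_socHom_apply_eq (Y := N) hθ
  let z' : Submodule.torsionBySet A N (maximalIdeal A) :=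
    ⟨z, (Submodule.mem_torsionBySet_iff _ _).mpr fun r => hz' r r.2⟩
  obtain ⟨c, hc⟩ := hend (socHom N z' ∘ₗ θ)
  refine ⟨c, ?_, fun r hr => hfaith _ fun y => ?_⟩
  · rintro rfl
    refine hz ?_
    rw [← zero_smul A t, ← hc t]
    exact (ht z').symm
  · rw [mul_smul, ← hc, LinearMap.comp_apply, ← map_smul, smul_residue_eq_zero hr, map_zero]

end Cyclic

/-- Over a Noetherian local ring, a faithful module of finite G-dimension on which every
endomorphism is a homothety is cyclic, if enough extensions of it by itself vanish. -/
lemma GDc.exists_span_singleton_eq_top {t : ℕ} {A : Type} [CommRing A] [IsLocalRing A]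
    [IsNoetherianRing A] {N : Type} [AddCommGroup N] [Module A N] [Nontrivial N]
    {n p q : ℕ} {M : Matrix (Fin p) (Fin q) A} {g : Fin p → N} (hN : GDc A n N)
    (hM : IsPresentation M g) (hev : EV A N t M)
    (hend : ∀ f : N →ₗ[A] N, ∃ c : A, ∀ y, f y = c • y)
    (hfaith : ∀ c : A, (∀ y : N, c • y = 0) → c = 0) {rs : List A} (ht : rs.length = t)
    (hrs : ∀ r ∈ rs, r ∈ maximalIdeal A) (hreg : RingTheory.Sequence.IsWeaklyRegular N rs)
    {z : N} (hz : z ∉ (Ideal.ofList rs • ⊤ : Submodule A N))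
    (hz' : ∀ r ∈ maximalIdeal A, r • z ∈ (Ideal.ofList rs • ⊤ : Submodule A N)) :
    ∃ y : N, Submodule.span A {y} = ⊤ := by
  induction t generalizing A N n p q with
  | zero =>
    obtain rfl := List.length_eq_zero_iff.mp ht
    simp only [Ideal.ofList_nil, Submodule.bot_smul, Submodule.mem_bot] at hz hz'
    have := hN.finite
    obtain ⟨b, hb, hb'⟩ := exists_socle_ne_zero_of_forall_end hend hfaith hz hz'
    exact exists_span_singleton_eq_top_of_forall_end (hN.bijective_dual_eval_and_extVan hb hb').1
      hend hfaith hz hz'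
  | succ t ih =>
    obtain _ | ⟨x, rs⟩ := rs
    · cases ht
    have := hN.finite
    have hx : x ∈ maximalIdeal A := hrs x List.mem_cons_self
    obtain ⟨hxN, hreg⟩ := (RingTheory.Sequence.isWeaklyRegular_cons_iff' N x rs).mp hreg
    have hxA := isSMulRegular_of_faithful hxN hfaith
    have := isLocalRing_quotient_span_singleton hx
    have := nontrivial_quotSMulTop (N := N) hx
    obtain ⟨y, hy⟩ := ih (z := (x • (⊤ : Submodule A N)).mkQ z) (hN.quotient hxA hxN) hM.quotient
      (hev.quotient hxA hxN (hM.exists_eq_mact_of_eq_smul hxN))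
      (hM.exists_forall_quotient hev hxN hend) (faithful_quotient hxN hend hfaith)
      (rs := rs.map (Ideal.Quotient.mk (Ideal.span {x}))) (by simpa using ht)
      (fun r hr => by
        obtain ⟨s, hs, rfl⟩ := List.mem_map.mp hr
        exact (mk_mem_maximalIdeal_iff hx).mpr (hrs s (List.mem_cons_of_mem _ hs)))
      hreg (by rwa [mkQ_mem_ofList_smul_top_iff]) fun r hr => by
        obtain ⟨r, rfl⟩ := Ideal.Quotient.mk_surjective r
        exact (mkQ_mem_ofList_smul_top_iff rs (r • z)).mpr
          (hz' r ((mk_mem_maximalIdeal_iff hx).mp hr))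
    obtain ⟨y, rfl⟩ := Submodule.mkQ_surjective _ y
    exact ⟨y, span_singleton_eq_top_of_quotient hx hy⟩

section RegularSequence

variable {A : Type} [CommRing A] [IsLocalRing A] [IsNoetherianRing A] (N : Type) [AddCommGroup N]
  [Module A N] [Module.Finite A N] [Nontrivial N]

/-- A finite module over a Noetherian local ring has a maximal regular sequence. -/
lemma exists_isWeaklyRegular_and_socle :
    ∃ rs : List A, (∀ r ∈ rs, r ∈ maximalIdeal A) ∧ RingTheory.Sequence.IsWeaklyRegular N rs ∧
      ∃ z : N, z ∉ (Ideal.ofList rs • ⊤ : Submodule A N) ∧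
        ∀ r ∈ maximalIdeal A, r • z ∈ (Ideal.ofList rs • ⊤ : Submodule A N) := by
  obtain ⟨_, ⟨rs, hrs, hreg, rfl⟩, hmax⟩ := set_has_maximal_iff_noetherian.mpr
    (inferInstance : IsNoetherian A A)
    {I | ∃ rs : List A, (∀ r ∈ rs, r ∈ maximalIdeal A) ∧
      RingTheory.Sequence.IsWeaklyRegular N rs ∧ Ideal.ofList rs = I}
    ⟨_, [], by simp, RingTheory.Sequence.IsWeaklyRegular.nil A N, rfl⟩
  have hN : Nontrivial (N ⧸ (Ideal.ofList rs • ⊤ : Submodule A N)) := by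
    refine Submodule.Quotient.nontrivial_iff.mpr fun h => ?_
    exact ((IsLocalRing.isRegular_iff_isWeaklyRegular_of_subset_maximalIdeal hrs).mpr
      hreg).top_ne_smul h.symm
  refine ⟨rs, hrs, hreg, ?_⟩
  by_cases hm : maximalIdeal A ∈ associatedPrimes A (N ⧸ (Ideal.ofList rs • ⊤ : Submodule A N))
  · obtain ⟨y, hy⟩ := exists_forall_mem_iff_of_mem_associatedPrimes hm
    obtain ⟨z, rfl⟩ := Submodule.mkQ_surjective _ y
    refine ⟨z, fun hz => ?_, fun r hr => ?_⟩
    · refine (maximalIdeal A).ne_top_iff_one.mp Ideal.IsPrime.ne_top' ((hy 1).mpr ?_)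
      rw [one_smul]
      exact (Submodule.Quotient.mk_eq_zero _).mpr hz
    · exact (Submodule.Quotient.mk_eq_zero _).mp ((hy r).mp hr)
  · exfalso
    obtain ⟨x, hx, hxN⟩ := Ideal.exists_mem_forall_notMem (I := maximalIdeal A)
      (associatedPrimes.finite A (N ⧸ (Ideal.ofList rs • ⊤ : Submodule A N)))
      (fun p hp => hp.isPrime)
      (fun p hp h => hm (le_antisymm (le_maximalIdeal hp.isPrime.ne_top) h ▸ hp))
    have hreg' : RingTheory.Sequence.IsWeaklyRegular N (rs ++ [x]) :=
      (RingTheory.Sequence.isWeaklyRegular_append_iff N rs [x]).mpr ⟨hreg,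
        (RingTheory.Sequence.isWeaklyRegular_singleton_iff _ _).mpr
          (.of_forall_associatedPrimes hxN)⟩
    refine hmax _ ⟨rs ++ [x], fun r hr => ?_, hreg', rfl⟩ ?_
    · obtain hr | hr := List.mem_append.mp hr
      · exact hrs r hr
      · rwa [List.mem_singleton.mp hr]
    · rw [Ideal.ofList_append]
      refine lt_of_le_of_ne le_sup_left fun h => ?_
      have hxm : x ∈ Ideal.ofList rs := by
        rw [h]
        exact Ideal.mem_sup_right (Ideal.subset_span List.mem_cons_self)
      obtain ⟨y, hy⟩ := exists_ne (0 : N ⧸ (Ideal.ofList rs • ⊤ : Submodule A N))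
      obtain ⟨z, rfl⟩ := Submodule.mkQ_surjective _ y
      refine hy (IsSMulRegular.of_forall_associatedPrimes hxN ?_)
      change x • Submodule.mkQ _ z = x • 0
      rw [smul_zero, ← map_smul]
      exact (Submodule.Quotient.mk_eq_zero _).mpr (Submodule.smul_mem_smul hxm trivial)

end RegularSequence

theorem stmt11 (R : Type) [CommRing R] [IsNoetherianRing R] [IsLocalRing R]
    (d : ℕ) (hd : ringKrullDim R = (d : WithBot ℕ∞))
    (ω : ModuleCat R)
    (hω : IsCanonicalModule R (maximalIdeal R) d (ModuleCat.of R R) ω)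
    (hG : ∃ n : ℕ, GdimLE R n ω)
    (hExt : ∀ i : ℕ, 1 ≤ i → (i : ℕ∞) ≤ gradeI R (maximalIdeal R) ↥ω →
      Subsingleton ↥(((Ext R (ModuleCat R) i).obj (Opposite.op ω)).obj ω)) :
    Nonempty (↥ω ≃ₗ[R] R) := by
  obtain ⟨hfin, E, hE, ⟨e⟩⟩ := hω
  obtain ⟨n, hG⟩ := hG
  have hG := hG.gdc
  obtain ⟨e'⟩ := LocCoh.nonempty_linearEquiv_localCohomology (maximalIdeal R) d R
  have hM : Nonempty ((ω →ₗ[R] E) ≃ₗ[R] LocCoh (maximalIdeal R) d R) := ⟨e.trans e'.symm⟩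
  have hann : Module.annihilator R ω = ⊥ := hE.annihilator_eq_bot hd hM hG
  have hfaith (c : R) (hc : ∀ y : ω, c • y = 0) : c = 0 := by
    rw [← Ideal.mem_bot, ← hann]
    exact Module.mem_annihilator.mpr hc
  have hnt : Nontrivial ω := by
    refine not_subsingleton_iff_nontrivial.mp fun h => one_ne_zero (α := R) (hfaith 1 fun y => ?_)
    exact Subsingleton.elim _ _
  have hend := hE.exists_forall_apply_eq_smul hd hM hG
  obtain ⟨rs, hrs, hreg, z, hz, hz'⟩ := exists_isWeaklyRegular_and_socle (A := R) ω
  obtain ⟨p, q, M, g, hMg⟩ := exists_isPresentation (A := R) ω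
  have hdepth : (rs.length : ℕ∞) ≤ gradeI R (maximalIdeal R) ω :=
    le_sSup ⟨rs, rfl, hrs,
      (IsLocalRing.isRegular_iff_isWeaklyRegular_of_subset_maximalIdeal hrs).mpr hreg⟩
  have hev : EV R ω rs.length M := EV.of_extVan fun i hi => by
    obtain ⟨f⟩ := hMg.nonempty_equiv
    refine ExtVan.congr ?_ f.symm
    have := hExt (i + 1) (by omega) (le_trans (by exact_mod_cast hi) hdepth)
    exact (extEquiv (projectiveResolution ω) ω (i + 1)).symm.toEquiv.subsingleton
  obtain ⟨y, hy⟩ := hG.exists_span_singleton_eq_top hMg hev hend hfaith rfl hrs hreg hz hz'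
  refine ⟨(LinearEquiv.ofBijective (LinearMap.toSpanSingleton R ω y) ⟨?_, ?_⟩).symm⟩
  · refine (injective_iff_map_eq_zero _).mpr fun a ha => hfaith a fun w => ?_
    obtain ⟨b, rfl⟩ := Submodule.mem_span_singleton.mp (hy ▸ Submodule.mem_top (x := w))
    rw [smul_comm, show a • y = 0 from ha, smul_zero]
  · rw [← LinearMap.range_eq_top, LinearMap.range_toSpanSingleton, hy]
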